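/- Let d > 1 and let f(x_1,…,x_N) = (x_1^d + g_1(x_1,…,x_N), …, x_N^d + g_N(x_1,…,x_N)) be a regular endomorphism of 𝔸^N over ℂ in which each g_i has degree ≤ d−3. Let C ⊆ 𝔸^N be an irreducible closed curve. Suppose there is a point x ∈ 𝔸^N(ℂ) such that the orbit O_f(x) has infinite intersection with C(ℂ), and suppose C̄ ∩ H_∞ is contained in the open set {x_1⋯x_N ≠ 0}. Then C is an f-periodic vertical line. In particular, every irreducible f-periodic curve C with C̄ ∩ H_∞ ⊆ {x_1⋯x_N ≠ 0} is a vertical line. -/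

import Mathlib

open MvPolynomial
open scoped ENNReal NNReal

namespace DML

variable (K : Type*) [Field K]

/-- Zariski-closed subsets of affine `N`-space over `K`. -/
def AffClosed {N : ℕ} (C : Set (Fin N → K)) : Prop :=
  ∃ T : Set (MvPolynomial (Fin N) K), C = {x | ∀ p ∈ T, MvPolynomial.eval x p = 0}

/-- `C` is an irreducible closed curve in `A^N`: it is Zariski closed, irreducible,
infinite (dimension `≥ 1`), and every proper closed subset of it is finite
(dimension `≤ 1`). -/
structure IsIrredCurve {N : ℕ} (C : Set (Fin N → K)) : Prop where
  closed : AffClosed K C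
  infinite : C.Infinite
  irred : ∀ Z₁ Z₂ : Set (Fin N → K), AffClosed K Z₁ → AffClosed K Z₂ →
    C ⊆ Z₁ ∪ Z₂ → C ⊆ Z₁ ∨ C ⊆ Z₂
  dim_le_one : ∀ Z : Set (Fin N → K), AffClosed K Z → ¬ C ⊆ Z → (C ∩ Z).Finite

/-- Points of projective `(n-1)`-space over `K`. -/
abbrev PP (n : ℕ) := Projectivization K (Fin n → K)

/-- Zariski-closed subsets of projective space: common zero sets of families of
homogeneous polynomials. -/
def ProjClosed {n : ℕ} (Z : Set (PP K n)) : Prop :=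
  ∃ T : Set (MvPolynomial (Fin n) K),
    (∀ q ∈ T, ∃ m, q.IsHomogeneous m) ∧
    Z = {P | ∀ q ∈ T, MvPolynomial.eval P.rep q = 0}

/-- Zariski closure in projective space. -/
def projClosure {n : ℕ} (S : Set (PP K n)) : Set (PP K n) :=
  ⋂₀ {Z | ProjClosed K Z ∧ S ⊆ Z}

/-- The hyperplane at infinity `{x_0 = 0}` in `P^N`. -/
def Hinf (N : ℕ) : Set (PP K (N + 1)) := {P | P.rep 0 = 0}

/-- The embedding of affine `N`-space into `P^N`, `x ↦ [1, x]`. -/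
noncomputable def affToProj {N : ℕ} (x : Fin N → K) : PP K (N + 1) :=
  Projectivization.mk K (Fin.cons 1 x) (by
    intro h
    have h0 := congrFun h 0
    simp [Fin.cons] at h0)

/-- A point of the hyperplane at infinity, viewed as a point of `P^(N-1)`. -/
noncomputable def ptAtInf {N : ℕ} (Q : PP K (N + 1)) (h : Q.rep 0 = 0) : PP K N :=
  Projectivization.mk K (Fin.tail Q.rep) (by
    intro h0
    apply Q.rep_nonzero
    funext j
    refine Fin.cases ?_ ?_ j
    · exact h
    · intro i
      exact congrFun h0 i)

/-- The endomorphism of `P^(N-1)` induced by a tuple of homogeneous polynomials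
(the restriction `f_∞` of a regular endomorphism to the hyperplane at infinity).
If the polynomials had a nonzero common zero the junk value `P` is returned; this never
happens for regular endomorphisms. -/
noncomputable def infMap {N : ℕ} (F : Fin N → MvPolynomial (Fin N) K) (P : PP K N) : PP K N :=
  letI := Classical.propDecidable ((fun i => MvPolynomial.eval P.rep (F i)) = 0)
  if h : (fun i => MvPolynomial.eval P.rep (F i)) = 0 then P
  else Projectivization.mk K _ h

/-- A regular endomorphism of `A^N` of degree `d` with degree gap `k`:
`f = (f_1 + g_1, …, f_N + g_N)` with `f_i` homogeneous of degree `d` having no nonzero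
common zero, and `deg g_i ≤ d - k`. -/
structure RegEndo (N d k : ℕ) where
  F : Fin N → MvPolynomial (Fin N) K
  G : Fin N → MvPolynomial (Fin N) K
  one_le_d : 1 ≤ d
  one_le_k : 1 ≤ k
  k_le_d : k ≤ d
  F_hom : ∀ i, (F i).IsHomogeneous d
  F_elim : ∀ v : Fin N → K, (∀ i, MvPolynomial.eval v (F i) = 0) → v = 0
  G_deg : ∀ i, (G i).totalDegree ≤ d - k

/-- The self-map of `A^N(K)` given by a regular endomorphism. -/
noncomputable def RegEndo.toFun {N d k : ℕ} (f : RegEndo K N d k) :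
    (Fin N → K) → (Fin N → K) :=
  fun x i => MvPolynomial.eval x (f.F i + f.G i)

/-- `C` is a vertical line: a straight line through the origin. -/
def IsVertLine {N : ℕ} (C : Set (Fin N → K)) : Prop :=
  ∃ a : Fin N → K, a ≠ 0 ∧ C = Set.range fun t : K => t • a

/-- `C` is a periodic subvariety for the self-map `g`: `g^[m](C) = C` for some `m ≥ 1`. -/
def IsPerCurve {N : ℕ} (g : (Fin N → K) → (Fin N → K)) (C : Set (Fin N → K)) : Prop :=
  ∃ m : ℕ, 1 ≤ m ∧ g^[m] '' C = C

end DML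

namespace Roth

open Filter

/-- A family of absolute values satisfying the product formula. -/
structure Places (K : Type*) [Field K] where
  V : Type
  abv : V → AbsoluteValue K ℝ
  arch : Finset V
  nonarch : ∀ v ∉ arch, IsNonarchimedean (abv v)
  prod_eq_one : ∀ x : K, x ≠ 0 → ∀ᶠ T : Finset V in atTop, ∏ v ∈ T, abv v x = 1

variable {K : Type*} [Field K] (p : Places K)

open Classical in
/-- Size of a finite family at a place: the `ℓ¹`-norm at the archimedean places and the
maximum at the others. -/
noncomputable def Places.nrm {ι : Type*} (v : p.V) (f : ι →₀ K) : ℝ :=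
  if v ∈ p.arch then ∑ i ∈ f.support, p.abv v (f i)
  else ((f.support.sup fun i => (⟨p.abv v (f i), (p.abv v).nonneg _⟩ : ℝ≥0) : ℝ≥0) : ℝ)

open Classical in
/-- `c` at archimedean places, `1` elsewhere. -/
noncomputable def Places.cst (v : p.V) (c : ℝ) : ℝ := if v ∈ p.arch then c else 1

variable {p}

theorem Places.abv_natCast_le (v : p.V) (n : ℕ) : p.abv v (n : K) ≤ n := by
  induction n with
  | zero => simp
  | succ n ih =>
    push_cast
    exact ((p.abv v).add_le _ _).trans (by simpa using ih)

theorem Places.abv_natCast_le_one {v : p.V} (hv : v ∉ p.arch) (n : ℕ) :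
    p.abv v (n : K) ≤ 1 := by
  induction n with
  | zero => simp
  | succ n ih =>
    push_cast
    exact (p.nonarch v hv _ _).trans (by simpa using ih)

theorem Places.abv_natCast_le_cst (v : p.V) {n : ℕ} {c : ℝ} (h : (n : ℝ) ≤ c) :
    p.abv v (n : K) ≤ p.cst v c := by
  unfold Places.cst
  split_ifs with hv
  · exact (abv_natCast_le v n).trans h
  · exact abv_natCast_le_one hv n

theorem Places.one_le_cst (v : p.V) {c : ℝ} (hc : 1 ≤ c) : 1 ≤ p.cst v c := by
  unfold Places.cst; split_ifs <;> simp [hc]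

theorem Places.cst_mul (v : p.V) (a b : ℝ) : p.cst v (a * b) = p.cst v a * p.cst v b := by
  unfold Places.cst; split_ifs <;> simp

theorem Places.cst_mono (v : p.V) {a b : ℝ} (h : a ≤ b) : p.cst v a ≤ p.cst v b := by
  unfold Places.cst; split_ifs <;> simp [h]

theorem Places.cst_nonneg (v : p.V) {a : ℝ} (h : 0 ≤ a) : 0 ≤ p.cst v a := by
  unfold Places.cst; split_ifs <;> simp [h]

open Classical in
theorem Places.prod_cst (c : ℝ) {T : Finset p.V} (hT : p.arch ⊆ T) :
    ∏ v ∈ T, p.cst v c = c ^ p.arch.card := by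
  unfold Places.cst
  rw [Finset.prod_ite, Finset.prod_const_one, mul_one, Finset.prod_const]
  congr 2
  ext v
  simp only [Finset.mem_filter]
  exact ⟨fun h => h.2, fun h => ⟨hT h, h⟩⟩

theorem Places.abv_sum_le (v : p.V) {ι : Type*} (s : Finset ι) (f : ι → K) {B : ℝ}
    (hB : 0 ≤ B) (h : ∀ i ∈ s, p.abv v (f i) ≤ B) {c : ℝ} (hc : (s.card : ℝ) ≤ c) :
    p.abv v (∑ i ∈ s, f i) ≤ p.cst v c * B := by
  unfold Places.cst
  split_ifs with hv
  · refine ((p.abv v).sum_le s f).trans ?_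
    refine (Finset.sum_le_card_nsmul s _ B h).trans ?_
    rw [nsmul_eq_mul]
    gcongr
  · rw [one_mul]
    classical
    clear hc
    induction s using Finset.induction_on with
    | empty => simpa using hB
    | insert a s ha ih =>
      rw [Finset.sum_insert ha]
      refine (p.nonarch v hv _ _).trans (max_le (h a (by simp)) (ih fun i hi => h i (by simp [hi])))

section nrm

variable {ι : Type*}

theorem Places.nrm_nonneg (v : p.V) (f : ι →₀ K) : 0 ≤ p.nrm v f := by
  unfold Places.nrm
  split_ifs
  · exact Finset.sum_nonneg fun i _ => (p.abv v).nonneg _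
  · exact NNReal.coe_nonneg _

theorem Places.le_nrm (v : p.V) (f : ι →₀ K) (i : ι) : p.abv v (f i) ≤ p.nrm v f := by
  by_cases hi : f i = 0
  · rw [hi, map_zero]; exact nrm_nonneg v f
  have hi' : i ∈ f.support := by simpa using hi
  unfold Places.nrm
  split_ifs
  · exact Finset.single_le_sum (f := fun i => p.abv v (f i))
      (fun i _ => (p.abv v).nonneg _) hi'
  · have := Finset.le_sup (f := fun i => (⟨p.abv v (f i), (p.abv v).nonneg _⟩ : ℝ≥0)) hi'
    exact this

/-- A uniform way to bound weighted sums over a finite family by its norm. -/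
theorem Places.abv_sum_mul_le (v : p.V) (f : ι →₀ K) (s : Finset ι) (c : ι → K) {B : ℝ}
    (hB : 0 ≤ B) (h : ∀ i ∈ s, p.abv v (c i) ≤ B) :
    p.abv v (∑ i ∈ s, c i * f i) ≤ B * p.nrm v f := by
  classical
  by_cases hv : v ∈ p.arch
  · refine ((p.abv v).sum_le s _).trans ?_
    have h1 : ∑ i ∈ s, p.abv v (c i * f i) ≤ ∑ i ∈ s, B * p.abv v (f i) := by
      refine Finset.sum_le_sum fun i hi => ?_
      rw [map_mul]
      exact mul_le_mul_of_nonneg_right (h i hi) ((p.abv v).nonneg _)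
    refine h1.trans ?_
    rw [← Finset.mul_sum]
    refine mul_le_mul_of_nonneg_left ?_ hB
    unfold Places.nrm
    rw [if_pos hv]
    calc ∑ i ∈ s, p.abv v (f i) = ∑ i ∈ s ∩ f.support, p.abv v (f i) := by
          symm
          apply Finset.sum_subset Finset.inter_subset_left
          intro i hi hi'
          have : f i = 0 := by simpa [hi] using hi'
          simp [this]
      _ ≤ _ := Finset.sum_le_sum_of_subset_of_nonneg Finset.inter_subset_right
          (fun i _ _ => (p.abv v).nonneg _)
  · have := abv_sum_le v s (fun i => c i * f i) (B := B * p.nrm v f)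
      (mul_nonneg hB (nrm_nonneg v f)) (fun i hi => by
        rw [map_mul]
        exact mul_le_mul (h i hi) (le_nrm v f i) ((p.abv v).nonneg _) hB) (c := s.card) le_rfl
    simpa [Places.cst, hv] using this

theorem Places.prod_nrm_ge_one {f : ι →₀ K} (hf : f ≠ 0) :
    ∀ᶠ T : Finset p.V in atTop, 1 ≤ ∏ v ∈ T, p.nrm v f := by
  obtain ⟨i, hi⟩ : ∃ i, f i ≠ 0 := by
    by_contra! h
    exact hf (Finsupp.ext h)
  filter_upwards [p.prod_eq_one _ hi] with T hT
  rw [← hT]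
  exact Finset.prod_le_prod (fun v _ => (p.abv v).nonneg _) fun v _ => le_nrm v f i

/-- Bounding the norm of `f` termwise against a family of finitely many elements. -/
theorem Places.nrm_le_of_nonarch {v : p.V} (hv : v ∉ p.arch) {f : ι →₀ K} {B : ℝ} (hB : 0 ≤ B)
    (h : ∀ i, p.abv v (f i) ≤ B) : p.nrm v f ≤ B := by
  unfold Places.nrm
  rw [if_neg hv]
  have : (f.support.sup fun i => (⟨p.abv v (f i), (p.abv v).nonneg _⟩ : ℝ≥0)) ≤ ⟨B, hB⟩ :=
    Finset.sup_le fun i _ => h i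
  exact this

theorem Places.nrm_arch {v : p.V} (hv : v ∈ p.arch) {f : ι →₀ K} {s : Finset ι}
    (hs : f.support ⊆ s) : p.nrm v f = ∑ i ∈ s, p.abv v (f i) := by
  unfold Places.nrm
  rw [if_pos hv]
  apply Finset.sum_subset hs
  intro i _ hi
  have : f i = 0 := by simpa using hi
  simp [this]

theorem Places.nrm_add_le_arch {v : p.V} (hv : v ∈ p.arch) (f g : ι →₀ K) :
    p.nrm v (f + g) ≤ p.nrm v f + p.nrm v g := by
  classical
  rw [nrm_arch hv (f := f) (s := f.support ∪ g.support) Finset.subset_union_left,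
    nrm_arch hv (f := g) (s := f.support ∪ g.support) Finset.subset_union_right,
    nrm_arch hv (f := f + g) (s := f.support ∪ g.support) Finsupp.support_add,
    ← Finset.sum_add_distrib]
  exact Finset.sum_le_sum fun i _ => (p.abv v).add_le _ _

theorem Places.nrm_add_le_nonarch {v : p.V} (hv : v ∉ p.arch) (f g : ι →₀ K) :
    p.nrm v (f + g) ≤ max (p.nrm v f) (p.nrm v g) := by
  refine nrm_le_of_nonarch hv (le_max_of_le_left (nrm_nonneg v f)) fun i => ?_
  exact (p.nonarch v hv _ _).trans (max_le_max (le_nrm v f i) (le_nrm v g i))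

@[simp] theorem Places.nrm_zero (v : p.V) : p.nrm v (0 : ι →₀ K) = 0 := by
  by_cases hv : v ∈ p.arch
  · simp [Places.nrm, hv]
  · exact le_antisymm (nrm_le_of_nonarch hv le_rfl (by simp)) (nrm_nonneg v _)

theorem Places.nrm_sum_le (v : p.V) {κ : Type*} (s : Finset κ) (f : κ → ι →₀ K) {B : ℝ}
    (hB : 0 ≤ B) (h : ∀ i ∈ s, p.nrm v (f i) ≤ B) {c : ℝ} (hc : (s.card : ℝ) ≤ c) :
    p.nrm v (∑ i ∈ s, f i) ≤ p.cst v c * B := by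
  classical
  unfold Places.cst
  split_ifs with hv
  · refine le_trans ?_ (mul_le_mul_of_nonneg_right hc hB)
    clear hc
    induction s using Finset.induction_on with
    | empty => simp
    | insert a s ha ih =>
      rw [Finset.sum_insert ha, Finset.card_insert_of_notMem ha]
      refine (nrm_add_le_arch hv _ _).trans ?_
      have h1 := h a (by simp)
      have h2 := ih fun i hi => h i (by simp [hi])
      push_cast
      linarith
  · rw [one_mul]
    clear hc
    induction s using Finset.induction_on with
    | empty => simpa using hB
    | insert a s ha ih =>
      rw [Finset.sum_insert ha]
      exact (nrm_add_le_nonarch hv _ _).trans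
        (max_le (h a (by simp)) (ih fun i hi => h i (by simp [hi])))

end nrm

/-- The norm of a polynomial. -/
noncomputable def Places.pnrm {σ : Type*} (p : Places K) (v : p.V) (P : MvPolynomial σ K) : ℝ :=
  p.nrm v (AddMonoidAlgebra.coeff P)

section pnrm

variable {σ : Type*}

theorem Places.pnrm_nonneg (v : p.V) (P : MvPolynomial σ K) : 0 ≤ p.pnrm v P := nrm_nonneg v _

theorem Places.coeff_le_pnrm (v : p.V) (P : MvPolynomial σ K) (i : σ →₀ ℕ) :
    p.abv v (coeff i P) ≤ p.pnrm v P := le_nrm v _ i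

theorem Places.prod_pnrm_ge_one {P : MvPolynomial σ K} (hP : P ≠ 0) :
    ∀ᶠ T : Finset p.V in atTop, 1 ≤ ∏ v ∈ T, p.pnrm v P :=
  prod_nrm_ge_one (by simpa using hP)

theorem Places.pnrm_sum_le (v : p.V) {κ : Type*} (s : Finset κ) (f : κ → MvPolynomial σ K) {B : ℝ}
    (hB : 0 ≤ B) (h : ∀ i ∈ s, p.pnrm v (f i) ≤ B) {c : ℝ} (hc : (s.card : ℝ) ≤ c) :
    p.pnrm v (∑ i ∈ s, f i) ≤ p.cst v c * B := by
  have := nrm_sum_le v s (fun i => AddMonoidAlgebra.coeff (f i)) hB h hc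
  unfold Places.pnrm
  convert this using 2
  ext i
  simp

theorem Places.pnrm_neg (v : p.V) (P : MvPolynomial σ K) : p.pnrm v (-P) = p.pnrm v P := by
  unfold Places.pnrm Places.nrm
  simp

theorem Places.pnrm_zsmul_sign (v : p.V) (P : MvPolynomial σ K) (u : ℤˣ) :
    p.pnrm v (u • P) = p.pnrm v P := by
  rcases Int.units_eq_one_or u with rfl | rfl
  · simp
  · simp [Units.smul_def, pnrm_neg]

theorem Places.pnrm_le_of_nonarch {v : p.V} (hv : v ∉ p.arch) {P : MvPolynomial σ K} {B : ℝ}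
    (hB : 0 ≤ B) (h : ∀ i, p.abv v (coeff i P) ≤ B) : p.pnrm v P ≤ B :=
  nrm_le_of_nonarch hv hB h

theorem Places.pnrm_arch {v : p.V} (hv : v ∈ p.arch) {P : MvPolynomial σ K}
    {s : Finset (σ →₀ ℕ)} (hs : P.support ⊆ s) :
    p.pnrm v P = ∑ i ∈ s, p.abv v (coeff i P) :=
  nrm_arch hv hs

theorem Places.pnrm_mul_le (v : p.V) (P Q : MvPolynomial σ K) :
    p.pnrm v (P * Q) ≤ p.pnrm v P * p.pnrm v Q := by
  classical
  by_cases hv : v ∈ p.arch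
  · have hmon : ∀ (a : σ →₀ ℕ) (c : K) (R : MvPolynomial σ K),
        p.pnrm v (monomial a c * R) ≤ p.abv v c * p.pnrm v R := by
      intro a c R
      rw [pnrm_arch hv (P := monomial a c * R) (s := R.support.map (addLeftEmbedding a)),
        Finset.sum_map, pnrm_arch hv (P := R) subset_rfl, Finset.mul_sum]
      · refine Finset.sum_le_sum fun i _ => ?_
        simp [coeff_monomial_mul]
      · intro i hi
        rw [mem_support_iff, coeff_monomial_mul'] at hi
        split_ifs at hi with h
        · simp only [Finset.mem_map, addLeftEmbedding_apply]
          exact ⟨i - a, by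
            rw [mem_support_iff]; exact right_ne_zero_of_mul hi, by
            rw [add_tsub_cancel_of_le h]⟩
        · exact absurd rfl hi
    have h1 : P * Q = ∑ a ∈ P.support, monomial a (coeff a P) * Q := by
      conv_lhs => rw [P.as_sum]
      rw [Finset.sum_mul]
    have hadd : ∀ (s : Finset (σ →₀ ℕ)) (F : (σ →₀ ℕ) → MvPolynomial σ K),
        p.pnrm v (∑ a ∈ s, F a) ≤ ∑ a ∈ s, p.pnrm v (F a) := by
      intro s F
      induction s using Finset.induction_on with
      | empty => simp [Places.pnrm]
      | insert a s ha ih =>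
        rw [Finset.sum_insert ha, Finset.sum_insert ha]
        refine le_trans ?_ (add_le_add le_rfl ih)
        have := nrm_add_le_arch hv (AddMonoidAlgebra.coeff (F a))
          (AddMonoidAlgebra.coeff (∑ a ∈ s, F a))
        unfold Places.pnrm
        simpa using this
    rw [h1, pnrm_arch hv (P := P) subset_rfl, Finset.sum_mul]
    exact (hadd _ _).trans (Finset.sum_le_sum fun a _ => hmon _ _ _)
  · refine pnrm_le_of_nonarch hv (mul_nonneg (pnrm_nonneg v P) (pnrm_nonneg v Q)) fun i => ?_
    rw [coeff_mul]
    have := abv_sum_le v (Finset.HasAntidiagonal.antidiagonal i) (fun x => coeff x.1 P * coeff x.2 Q)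
      (mul_nonneg (pnrm_nonneg v P) (pnrm_nonneg v Q)) (fun x _ => by
        rw [map_mul]
        exact mul_le_mul (coeff_le_pnrm v P _) (coeff_le_pnrm v Q _) ((p.abv v).nonneg _)
          (pnrm_nonneg v P)) le_rfl
    simpa [Places.cst, hv] using this

theorem Places.pnrm_one (v : p.V) : p.pnrm v (1 : MvPolynomial σ K) ≤ 1 := by
  classical
  by_cases hv : v ∈ p.arch
  · rw [pnrm_arch hv (s := {0})]
    · simp
    · intro i hi
      by_contra h
      simp only [Finset.mem_singleton] at h
      rw [mem_support_iff] at hi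
      exact hi (by rw [coeff_one, if_neg (Ne.symm h)])
  · refine pnrm_le_of_nonarch hv zero_le_one fun i => ?_
    rw [coeff_one]
    split_ifs <;> simp

theorem Places.pnrm_prod_le (v : p.V) {κ : Type*} (s : Finset κ) (f : κ → MvPolynomial σ K) {B : ℝ}
    (hB : 0 ≤ B) (h : ∀ i ∈ s, p.pnrm v (f i) ≤ B) :
    p.pnrm v (∏ i ∈ s, f i) ≤ B ^ s.card := by
  classical
  induction s using Finset.induction_on with
  | empty => simpa using pnrm_one v
  | insert a s ha ih =>
    rw [Finset.prod_insert ha, Finset.card_insert_of_notMem ha, pow_succ']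
    exact (pnrm_mul_le v _ _).trans (mul_le_mul (h a (by simp))
      (ih fun i hi => h i (by simp [hi])) (pnrm_nonneg v _) hB)

theorem Places.pnrm_det_le (v : p.V) {n : ℕ} (M : Matrix (Fin n) (Fin n) (MvPolynomial σ K))
    {B : ℝ} (hB : 0 ≤ B) (h : ∀ i j, p.pnrm v (M i j) ≤ B) :
    p.pnrm v M.det ≤ p.cst v (n.factorial : ℝ) * B ^ n := by
  rw [Matrix.det_apply]
  refine pnrm_sum_le v _ _ (pow_nonneg hB n) (fun e _ => ?_) (by
    rw [Finset.card_univ, Fintype.card_perm, Fintype.card_fin])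
  rw [pnrm_zsmul_sign]
  simpa using pnrm_prod_le v Finset.univ (fun i => M (e i) i) hB fun i _ => h _ _

end pnrm

end Roth

namespace Roth

section hasse

variable {σ : Type*} {K : Type*} [Field K]

/-- The generic translation `P(x + y)`, as a polynomial in `x` with coefficients in `K[y]`. -/
noncomputable def genTranslate : MvPolynomial σ K →ₐ[K] MvPolynomial σ (MvPolynomial σ K) :=
  aeval fun i => X i + C (X i)

/-- Translation by a point. -/
noncomputable def translate (ξ : σ → K) : MvPolynomial σ K →ₐ[K] MvPolynomial σ K :=
  aeval fun i => X i + C (ξ i)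

/-- Hasse derivatives. -/
noncomputable def hasse (κ : σ →₀ ℕ) (P : MvPolynomial σ K) : MvPolynomial σ K :=
  coeff κ (genTranslate P)

/-- Product of binomial coefficients. -/
def binom [Fintype σ] (α κ : σ →₀ ℕ) : ℕ := ∏ i, (α i).choose (κ i)

theorem hasse_add (κ : σ →₀ ℕ) (P Q : MvPolynomial σ K) :
    hasse κ (P + Q) = hasse κ P + hasse κ Q := by simp [hasse]

theorem hasse_sum (κ : σ →₀ ℕ) {ι : Type*} (s : Finset ι) (P : ι → MvPolynomial σ K) :
    hasse κ (∑ i ∈ s, P i) = ∑ i ∈ s, hasse κ (P i) := by simp [hasse, coeff_sum]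

theorem eval_hasse (κ : σ →₀ ℕ) (ξ : σ → K) (P : MvPolynomial σ K) :
    eval ξ (hasse κ P) = coeff κ (translate ξ P) := by
  have : translate ξ P = map (eval ξ) (genTranslate P) := by
    have : (translate ξ : MvPolynomial σ K →+* _) =
        (map (eval ξ)).comp (genTranslate : MvPolynomial σ K →ₐ[K] _).toRingHom := by
      apply MvPolynomial.ringHom_ext
      · intro r
        simp [translate, genTranslate, IsScalarTower.algebraMap_apply K (MvPolynomial σ K)
          (MvPolynomial σ (MvPolynomial σ K)), algebraMap_eq]
      · intro i
        simp [translate, genTranslate]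
    exact congrFun (congrArg DFunLike.coe this) P
  rw [this, coeff_map, hasse]

theorem binom_eq_zero [Fintype σ] {α κ : σ →₀ ℕ} (h : ¬ κ ≤ α) : binom α κ = 0 := by
  obtain ⟨i, hi⟩ : ∃ i, ¬ κ i ≤ α i := by
    by_contra! h'
    exact h h'
  exact Finset.prod_eq_zero (Finset.mem_univ i) (Nat.choose_eq_zero_of_lt (not_le.mp hi))

theorem hasse_monomial [Fintype σ] (κ α : σ →₀ ℕ) (c : K) :
    hasse κ (monomial α c) = monomial (α - κ) (binom α κ * c) := by
  classical
  have hT : genTranslate (monomial α c) = C (C c) *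
      ∑ x ∈ Fintype.piFinset fun i => Finset.range (α i + 1),
        monomial (Finsupp.equivFunOnFinite.symm x)
          (monomial (α - Finsupp.equivFunOnFinite.symm x)
            ((binom α (Finsupp.equivFunOnFinite.symm x) : ℕ) : K)) := by
    rw [genTranslate, aeval_monomial]
    congr 1
    rw [Finsupp.prod_fintype _ _ (by simp)]
    simp_rw [add_pow]
    rw [Finset.prod_univ_sum]
    refine Finset.sum_congr rfl fun x _ => ?_
    rw [Finset.prod_mul_distrib, Finset.prod_mul_distrib, monomial_eq, monomial_eq,
      Finsupp.prod_fintype _ _ (by simp), Finsupp.prod_fintype _ _ (by simp)]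
    simp only [Finsupp.equivFunOnFinite_symm_apply_apply, Finsupp.coe_tsub, Pi.sub_apply, binom,
      map_mul, map_prod, map_pow, Nat.cast_prod, map_natCast]
    ring
  rw [hasse, hT, coeff_C_mul, coeff_sum]
  simp only [coeff_monomial]
  by_cases h : κ ≤ α
  · rw [Finset.sum_eq_single (κ : σ → ℕ)]
    · simp [C_mul_monomial, mul_comm]
    · intro x _ hx
      rw [if_neg]
      rintro rfl
      simp at hx
    · intro hκ
      exact absurd (by simpa [Nat.lt_succ_iff] using fun i => h i) hκ
  · rw [binom_eq_zero h, Finset.sum_eq_zero]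
    · simp
    · intro x hx
      rw [if_neg]
      rintro rfl
      refine h fun i => ?_
      have := (Fintype.mem_piFinset.mp hx) i
      simpa [Nat.lt_succ_iff] using this

theorem coeff_hasse [Fintype σ] (κ μ : σ →₀ ℕ) (P : MvPolynomial σ K) :
    coeff κ (hasse μ P) = binom (κ + μ) μ * coeff (κ + μ) P := by
  classical
  induction P using MvPolynomial.induction_on' with
  | monomial α c =>
    rw [hasse_monomial, coeff_monomial, coeff_monomial]
    by_cases h : μ ≤ α
    · by_cases h' : α - μ = κ
      · subst h'
        simp [tsub_add_cancel_of_le h]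
      · rw [if_neg h', if_neg]
        · simp
        · rintro rfl
          simp at h'
    · rw [binom_eq_zero h, if_neg (c := α = κ + μ)]
      · simp
      · rintro rfl
        exact h le_add_self
  | add p q hp hq => rw [hasse_add, coeff_add, coeff_add, hp, hq, mul_add]

theorem hasse_translate (μ : σ →₀ ℕ) (ξ : σ → K) (P : MvPolynomial σ K) :
    hasse μ (translate ξ P) = translate ξ (hasse μ P) := by
  have : (genTranslate : MvPolynomial σ K →ₐ[K] _).toRingHom.comp (translate ξ).toRingHom =
      (map (translate ξ).toRingHom).comp (genTranslate : MvPolynomial σ K →ₐ[K] _).toRingHom := by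
    apply MvPolynomial.ringHom_ext
    · intro r
      simp [translate, genTranslate, IsScalarTower.algebraMap_apply K (MvPolynomial σ K)
        (MvPolynomial σ (MvPolynomial σ K)), algebraMap_eq]
    · intro i
      simp [translate, genTranslate, IsScalarTower.algebraMap_apply K (MvPolynomial σ K)
        (MvPolynomial σ (MvPolynomial σ K)), algebraMap_eq, add_assoc]
  have h := congrFun (congrArg DFunLike.coe this) P
  simp only [AlgHom.toRingHom_eq_coe, RingHom.coe_comp, RingHom.coe_coe, Function.comp_apply] at h
  rw [hasse, h, coeff_map, hasse]
  rfl

theorem degreeOf_hasse_le [Fintype σ] (μ : σ →₀ ℕ) (P : MvPolynomial σ K) (i : σ) :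
    degreeOf i (hasse μ P) ≤ degreeOf i P := by
  classical
  rw [degreeOf_le_iff]
  intro κ hκ
  rw [mem_support_iff, coeff_hasse] at hκ
  have := degreeOf_le_iff.mp (le_refl (degreeOf i P)) (κ + μ)
    (mem_support_iff.mpr (right_ne_zero_of_mul hκ))
  simp only [Finsupp.add_apply] at this
  omega

theorem binom_le [Fintype σ] {α κ r : σ →₀ ℕ} (h : α ≤ r) : binom α κ ≤ 2 ^ (∑ i, r i) := by
  rw [← Finset.prod_pow_eq_pow_sum]
  refine Finset.prod_le_prod' fun i _ => ?_
  exact (Nat.choose_le_two_pow _ _).trans (Nat.pow_le_pow_right (by norm_num) (h i))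

theorem pnrm_hasse_le [Fintype σ] {p : Places K} (v : p.V) (μ r : σ →₀ ℕ) (P : MvPolynomial σ K)
    (hr : ∀ i, degreeOf i P ≤ r i) :
    p.pnrm v (hasse μ P) ≤ p.cst v (2 ^ (∑ i, r i)) * p.pnrm v P := by
  classical
  have hb : ∀ κ, coeff (κ + μ) P ≠ 0 →
      p.abv v (binom (κ + μ) μ : K) ≤ p.cst v (2 ^ (∑ i, r i)) := by
    intro κ hκ
    apply Places.abv_natCast_le_cst
    exact_mod_cast binom_le (fun i => (degreeOf_le_iff.mp (hr i)) _ (mem_support_iff.mpr hκ))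
  have h1 : (1 : ℝ) ≤ p.cst v (2 ^ (∑ i, r i)) := Places.one_le_cst v (one_le_pow₀ (by norm_num))
  have hterm : ∀ κ, p.abv v (coeff κ (hasse μ P)) ≤
      p.cst v (2 ^ (∑ i, r i)) * p.abv v (coeff (κ + μ) P) := by
    intro κ
    rw [coeff_hasse, map_mul]
    by_cases h : coeff (κ + μ) P = 0
    · simp [h]
    · exact mul_le_mul_of_nonneg_right (hb κ h) ((p.abv v).nonneg _)
  by_cases hv : v ∈ p.arch
  · rw [Places.pnrm_arch hv (P := hasse μ P) subset_rfl]
    refine (Finset.sum_le_sum fun κ _ => hterm κ).trans ?_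
    rw [← Finset.mul_sum]
    refine mul_le_mul_of_nonneg_left ?_ (zero_le_one.trans h1)
    rw [Places.pnrm_arch hv (P := P) (s := P.support ∪ (hasse μ P).support.map
      (addRightEmbedding μ)) Finset.subset_union_left]
    rw [show ∑ κ ∈ (hasse μ P).support, p.abv v (coeff (κ + μ) P) =
      ∑ κ ∈ (hasse μ P).support.map (addRightEmbedding μ), p.abv v (coeff κ P) by
        rw [Finset.sum_map]; rfl]
    exact Finset.sum_le_sum_of_subset_of_nonneg Finset.subset_union_right
      fun _ _ _ => (p.abv v).nonneg _
  · refine Places.pnrm_le_of_nonarch hv (mul_nonneg (zero_le_one.trans h1)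
      (Places.pnrm_nonneg v P)) fun κ => (hterm κ).trans ?_
    exact mul_le_mul_of_nonneg_left (Places.coeff_le_pnrm v P _) (zero_le_one.trans h1)

theorem pderiv_hasse [Fintype σ] [DecidableEq σ] (e : σ) (μ : σ →₀ ℕ) (P : MvPolynomial σ K) :
    pderiv e (hasse μ P) = ((μ e + 1 : ℕ) : K) • hasse (μ + Finsupp.single e 1) P := by
  have hcoeff : ∀ (κ : σ →₀ ℕ) (Q : MvPolynomial σ K),
      coeff κ (pderiv e Q) = ((κ e + 1 : ℕ) : K) * coeff (κ + Finsupp.single e 1) Q := by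
    intro κ Q
    rw [coeff_pderiv]
    push_cast
    ring
  ext κ
  rw [hcoeff, coeff_smul, coeff_hasse, coeff_hasse, smul_eq_mul, ← mul_assoc, ← mul_assoc,
    show κ + Finsupp.single e 1 + μ = κ + (μ + Finsupp.single e 1) by abel]
  congr 1
  norm_cast
  unfold binom
  rw [← Finset.mul_prod_erase _ _ (Finset.mem_univ e), ← Finset.mul_prod_erase _ _
    (Finset.mem_univ e), ← mul_assoc, ← mul_assoc]
  refine congrArg Nat.cast (congrArg₂ (fun a b : ℕ => a * b) ?_ ?_)
  · have := Nat.choose_succ_right_eq ((κ + (μ + Finsupp.single e 1) : σ →₀ ℕ) e) (μ e)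
    simp only [Finsupp.add_apply, Finsupp.single_eq_same] at this ⊢
    rw [show κ e + (μ e + 1) - μ e = κ e + 1 by omega] at this
    linarith
  · refine Finset.prod_congr rfl fun i hi => ?_
    have : e ≠ i := (Finset.ne_of_mem_erase hi).symm
    simp [Finsupp.single_apply, this]

end hasse

section wronskian

variable {σ : Type*} [Fintype σ] [DecidableEq σ] {K : Type*} [Field K] [CharZero K] {n : ℕ}

theorem hasse_zero (P : MvPolynomial σ K) : hasse 0 P = P := by
  ext κ
  rw [coeff_hasse]
  simp [binom]

/-- Vectors of polynomials annihilating all Hasse derivatives of order at most `i`. -/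
def annih (f : Fin n → MvPolynomial σ K) (i : ℕ) (a : Fin n → MvPolynomial σ K) : Prop :=
  ∀ μ : σ →₀ ℕ, μ.degree ≤ i → ∑ j, a j * hasse μ (f j) = 0

theorem annih_pderiv {f : Fin n → MvPolynomial σ K} {i : ℕ} {a : Fin n → MvPolynomial σ K}
    (h : annih f (i + 1) a) (e : σ) : annih f i fun j => pderiv e (a j) := by
  intro μ hμ
  have h1 := congrArg (pderiv e) (h μ (by omega))
  rw [map_sum, map_zero] at h1
  have h2 := h (μ + Finsupp.single e 1) (by simp; omega)
  simp only [Derivation.leibniz, smul_eq_mul, Finset.sum_add_distrib, pderiv_hasse,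
    mul_smul_comm] at h1
  rw [← Finset.smul_sum, h2, smul_zero, zero_add] at h1
  rw [← h1]
  exact Finset.sum_congr rfl fun j _ => mul_comm _ _

theorem annih_eq_zero {f : Fin n → MvPolynomial σ K} (hf : LinearIndependent K f) {i : ℕ}
    (hst : ∀ a, annih f i a → annih f (i + 1) a) (a : Fin n → MvPolynomial σ K)
    (ha : annih f i a) : a = 0 := by
  by_contra hne
  -- some derivative of `a` is a nonzero constant vector
  have key : ∀ (D : ℕ) (a : Fin n → MvPolynomial σ K), annih f i a → a ≠ 0 →
      (∀ j, (a j).totalDegree ≤ D) → False := by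
    intro D
    induction D with
    | zero =>
      intro a ha hne hD
      have h0 := ha 0 (by simp)
      simp only [hasse_zero] at h0
      apply hne
      funext j
      have hc : ∀ j, a j = C (coeff 0 (a j)) := fun j =>
        (totalDegree_eq_zero_iff_eq_C).mp (Nat.le_zero.mp (hD j))
      have := Fintype.linearIndependent_iff.mp hf (fun j => coeff 0 (a j)) (by
        rw [← h0]
        refine Finset.sum_congr rfl fun j _ => ?_
        rw [smul_eq_C_mul, ← hc j])
      rw [hc j, this j, C_0]
      rfl
    | succ D ih =>
      intro a ha hne hD
      by_cases hD' : ∀ j, (a j).totalDegree ≤ D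
      · exact ih a ha hne hD'
      push Not at hD'
      obtain ⟨j, hj⟩ := hD'
      have hjd : (a j).totalDegree = D + 1 := le_antisymm (hD j) hj
      obtain ⟨α, hα, hαd⟩ : ∃ α ∈ (a j).support, α.degree = D + 1 := by
        have hne : (a j).support.Nonempty := by
          rw [Finset.nonempty_iff_ne_empty]
          intro h
          simp [totalDegree, h] at hjd
        obtain ⟨α, hα, h⟩ := Finset.exists_mem_eq_sup _ hne fun s => s.sum fun _ e => e
        exact ⟨α, hα, h.symm.trans hjd⟩
      obtain ⟨e, he⟩ : ∃ e, α e ≠ 0 := by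
        by_contra! h
        have : α = 0 := Finsupp.ext h
        simp [this] at hαd
      refine ih (fun j => pderiv e (a j)) (annih_pderiv (hst a ha) e) ?_ ?_
      · intro h
        have h1 := congrArg (coeff (α - Finsupp.single e 1)) (congrFun h j)
        simp only [coeff_pderiv, Pi.zero_apply, coeff_zero] at h1
        rw [tsub_add_cancel_of_le (by simpa [Nat.one_le_iff_ne_zero] using he)] at h1
        rcases mul_eq_zero.mp h1 with h2 | h2
        · exact (mem_support_iff.mp hα) h2
        · exact Nat.cast_add_one_ne_zero _ h2
      · intro k
        refine Finset.sup_le fun κ hκ => ?_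
        rw [mem_support_iff, coeff_pderiv] at hκ
        have h1 := (le_totalDegree (mem_support_iff.mpr (left_ne_zero_of_mul hκ))).trans (hD k)
        change (κ + Finsupp.single e 1).degree ≤ D + 1 at h1
        change κ.degree ≤ D
        rw [map_add, Finsupp.degree_single] at h1
        omega
  exact key (Finset.univ.sup fun j => (a j).totalDegree) a ha hne
    fun j => Finset.le_sup (f := fun j => (a j).totalDegree) (Finset.mem_univ j)

theorem exists_wronskian_ne_zero (f : Fin n → MvPolynomial σ K) (hf : LinearIndependent K f) :
    ∃ μ : Fin n → σ →₀ ℕ, (∀ i, (μ i).degree < n) ∧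
      (Matrix.of fun i j => hasse (μ i) (f j)).det ≠ 0 := by
  classical
  let A := MvPolynomial σ K
  let L := FractionRing A
  let v : (σ →₀ ℕ) → Fin n → L := fun μ j => algebraMap A L (hasse μ (f j))
  let W : ℕ → Submodule L (Fin n → L) := fun i =>
    { carrier := {a | ∀ μ : σ →₀ ℕ, μ.degree ≤ i → ∑ j, a j * v μ j = 0}
      add_mem' := by
        intro a b ha hb μ hμ
        simp [add_mul, Finset.sum_add_distrib, ha μ hμ, hb μ hμ]
      zero_mem' := by intro μ hμ; simp
      smul_mem' := by
        intro c a ha μ hμ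
        simp [mul_assoc, ← Finset.mul_sum, ha μ hμ] }
  have hWA : ∀ i (a : Fin n → A), annih f i a ↔ (fun j => algebraMap A L (a j)) ∈ W i := by
    intro i a
    refine forall₂_congr fun μ _ => ?_
    simp only [v]
    rw [← (IsFractionRing.injective A L).eq_iff]
    simp
  have hclear : ∀ a : Fin n → L, ∃ b : A, b ≠ 0 ∧ ∃ c : Fin n → A,
      (fun j => algebraMap A L (c j)) = (algebraMap A L b) • a := by
    intro a
    obtain ⟨b, hb⟩ := IsLocalization.exist_integer_multiples_of_finite (nonZeroDivisors A) a
    choose c hc using hb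
    refine ⟨b, nonZeroDivisors.coe_ne_zero b, c, ?_⟩
    funext j
    rw [hc j]
    simp [Algebra.smul_def, Submonoid.smul_def]
  have hstep : ∀ i, (W i ≤ W (i + 1)) → W i = ⊥ := by
    intro i hi
    rw [Submodule.eq_bot_iff]
    intro a ha
    obtain ⟨b, hb, c, hc⟩ := hclear a
    have h0 := annih_eq_zero hf (i := i) (fun a ha => (hWA _ a).mpr (hi ((hWA _ a).mp ha))) c
      ((hWA i c).mpr (by rw [hc]; exact Submodule.smul_mem _ _ ha))
    rw [h0] at hc
    have hb' : algebraMap A L b ≠ 0 := by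
      rwa [Ne, IsFractionRing.to_map_eq_zero_iff]
    have : algebraMap A L b • a = 0 := by
      rw [← hc]; funext j; simp
    exact (smul_eq_zero.mp this).resolve_left hb'
  have hanti : ∀ i, W (i + 1) ≤ W i := fun i a ha μ hμ => ha μ (by omega)
  have hdim : ∀ i, W i = ⊥ ∨ Module.finrank L (W i) + (i + 1) ≤ n := by
    intro i
    induction i with
    | zero =>
      by_cases hn : W 0 = ⊤
      · left
        rw [Submodule.eq_bot_iff]
        intro a _
        funext j
        exfalso
        have := (hWA 0 (fun k => if k = j then 1 else 0)).mpr (by rw [hn]; trivial) 0 (by simp)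
        simp [hasse_zero] at this
        exact hf.ne_zero j this
      · right
        have := Submodule.finrank_lt hn
        simpa using this
    | succ i ih =>
      rcases ih with h | h
      · left
        exact le_bot_iff.mp (h ▸ hanti i)
      · by_cases hi : W i ≤ W (i + 1)
        · left
          exact le_bot_iff.mp (hstep i hi ▸ hanti i)
        · right
          have := Submodule.finrank_lt_finrank_of_lt (lt_of_le_not_ge (hanti i) hi)
          omega
  rcases n.eq_zero_or_pos with rfl | hn
  · exact ⟨Fin.elim0, fun i => i.elim0, by simp⟩
  have hbot : W (n - 1) = ⊥ := by
    rcases hdim (n - 1) with h | h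
    · exact h
    · exact Submodule.finrank_eq_zero.mp (by omega)
  have hspan : Submodule.span L (v '' {μ | μ.degree < n}) = ⊤ := by
    by_contra hne
    obtain ⟨φ, hφ, hker⟩ := Submodule.exists_le_ker_of_lt_top _ (lt_top_iff_ne_top.mpr hne)
    apply hφ
    have hmem : (fun j => φ (Pi.single j 1)) ∈ W (n - 1) := by
      intro μ hμ
      have := hker (Submodule.subset_span ⟨μ, show μ.degree < n by omega, rfl⟩)
      rw [LinearMap.mem_ker, LinearMap.pi_apply_eq_sum_univ] at this
      rw [← this]
      refine Finset.sum_congr rfl fun j _ => ?_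
      rw [smul_eq_mul, mul_comm]
      congr 1
      change φ (Pi.single j 1) = _
      congr 1
      funext k
      simp [Pi.single_apply, eq_comm]
    rw [hbot, Submodule.mem_bot] at hmem
    apply LinearMap.pi_ext'
    intro j
    ext
    simpa using congrFun hmem j
  obtain ⟨g, hg, -, hlin⟩ := Submodule.exists_fun_fin_finrank_span_eq L (v '' {μ | μ.degree < n})
  have hfin : Module.finrank L (Submodule.span L (v '' {μ | μ.degree < n})) = n := by
    rw [hspan, finrank_top, Module.finrank_fin_fun]
  choose μ hμ hμg using fun i => hg (Fin.cast hfin.symm i)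
  refine ⟨μ, hμ, fun hdet => ?_⟩
  have hlin' : LinearIndependent L fun i : Fin n => v (μ i) := by
    have := hlin.comp (Fin.cast hfin.symm) (Fin.cast_injective _)
    rwa [show (fun i : Fin n => v (μ i)) = g ∘ Fin.cast hfin.symm from funext hμg]
  have hunit := (Matrix.linearIndependent_rows_iff_isUnit
    (A := Matrix.of fun i => v (μ i))).mp hlin'
  rw [Matrix.isUnit_iff_isUnit_det] at hunit
  apply hunit.ne_zero
  have := congrArg (algebraMap A L) hdet
  rw [RingHom.map_det, map_zero] at this
  exact this

end wronskian

end Roth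

namespace Roth

open Filter

section univariate

variable {K : Type*} [Field K] {p : Places K}

theorem coeff_X_sub_C_mul (ξ : K) (Q : Polynomial K) (i : ℕ) :
    ((Polynomial.X - Polynomial.C ξ) * Q).coeff i =
      (if i = 0 then 0 else Q.coeff (i - 1)) - ξ * Q.coeff i := by
  rw [sub_mul, Polynomial.coeff_sub, Polynomial.coeff_C_mul]
  cases i <;> simp

theorem sum_half_le (v : p.V) {ξ : K} (hξ : 1 ≤ p.abv v ξ) (Q : Polynomial K) (n : ℕ) :
    p.abv v ξ / 2 * ∑ i ∈ Finset.range n, p.abv v (Q.coeff i) * (1 / 2) ^ i ≤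
      ∑ i ∈ Finset.range n,
        p.abv v (((Polynomial.X - Polynomial.C ξ) * Q).coeff i) * (1 / 2) ^ i := by
  set S := ∑ i ∈ Finset.range n, p.abv v (Q.coeff i) * (1 / 2 : ℝ) ^ i with hS
  have hS0 : 0 ≤ S := Finset.sum_nonneg fun i _ => by positivity
  have h1 : ∑ i ∈ Finset.range n,
      p.abv v (if i = 0 then 0 else Q.coeff (i - 1)) * (1 / 2 : ℝ) ^ i ≤ 1 / 2 * S := by
    rcases n with _ | n
    · simp [hS]
    · rw [Finset.sum_range_succ', hS, Finset.sum_range_succ, mul_add, Finset.mul_sum]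
      simp only [Nat.add_eq_zero_iff, one_ne_zero, and_false, if_false, Nat.add_sub_cancel,
        if_true, map_zero, zero_mul, add_zero]
      have : 0 ≤ 1 / 2 * (p.abv v (Q.coeff n) * (1 / 2 : ℝ) ^ n) := by positivity
      refine le_trans (le_of_eq ?_) (le_add_of_nonneg_right this)
      refine Finset.sum_congr rfl fun i _ => by rw [pow_succ]; ring
  have h2 : p.abv v ξ * S ≤ ∑ i ∈ Finset.range n,
        p.abv v (((Polynomial.X - Polynomial.C ξ) * Q).coeff i) * (1 / 2) ^ i +
      ∑ i ∈ Finset.range n,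
        p.abv v (if i = 0 then 0 else Q.coeff (i - 1)) * (1 / 2 : ℝ) ^ i := by
    rw [hS, Finset.mul_sum, ← Finset.sum_add_distrib]
    refine Finset.sum_le_sum fun i _ => ?_
    rw [← mul_assoc, ← add_mul, coeff_X_sub_C_mul]
    refine mul_le_mul_of_nonneg_right ?_ (by positivity)
    rw [← map_mul]
    calc p.abv v (ξ * Q.coeff i) = p.abv v ((if i = 0 then 0 else Q.coeff (i - 1)) +
        -((if i = 0 then 0 else Q.coeff (i - 1)) - ξ * Q.coeff i)) := by
          congr 1; ring
      _ ≤ _ := by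
        refine ((p.abv v).add_le _ _).trans ?_
        rw [(p.abv v).map_neg, add_comm]
  nlinarith

theorem lead_mul_pow_le (v : p.V) {ξ : K} {a r : ℕ} {Q : Polynomial K} {B : ℝ}
    (hr : ((Polynomial.X - Polynomial.C ξ) ^ a * Q).natDegree ≤ r) 
    (hB : ∀ i, p.abv v (((Polynomial.X - Polynomial.C ξ) ^ a * Q).coeff i) ≤ B)
    (hB' : v ∈ p.arch → ∑ i ∈ Finset.range (r + 1),
      p.abv v (((Polynomial.X - Polynomial.C ξ) ^ a * Q).coeff i) ≤ B) :
    p.abv v ((Polynomial.X - Polynomial.C ξ) ^ a * Q).leadingCoeff * max 1 (p.abv v ξ) ^ a ≤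
      p.cst v (2 ^ r) * B := by
  have hB0 : 0 ≤ B := ((p.abv v).nonneg _).trans (hB 0)
  have h2 : (1 : ℝ) ≤ p.cst v (2 ^ r) := Places.one_le_cst v (one_le_pow₀ (by norm_num))
  rcases le_or_gt (p.abv v ξ) 1 with h | h
  · rw [max_eq_left h, one_pow, mul_one]
    exact (hB _).trans (le_mul_of_one_le_left hB0 h2)
  rw [max_eq_right h.le]
  have hmon : ((Polynomial.X - Polynomial.C ξ) ^ a).Monic := (Polynomial.monic_X_sub_C ξ).pow a
  rw [Polynomial.leadingCoeff_monic_mul hmon]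
  by_cases hQ : Q = 0
  · simp only [hQ, Polynomial.leadingCoeff_zero, map_zero, zero_mul]
    exact mul_nonneg (zero_le_one.trans h2) hB0
  have hdeg : a + Q.natDegree ≤ r := by
    rw [Polynomial.natDegree_mul hmon.ne_zero hQ, (Polynomial.monic_X_sub_C ξ).natDegree_pow,
      Polynomial.natDegree_X_sub_C, mul_one] at hr
    exact hr
  by_cases hv : v ∈ p.arch
  · have key : ∀ a, (p.abv v ξ / 2) ^ a * ∑ i ∈ Finset.range (r + 1),
        p.abv v (Q.coeff i) * (1 / 2) ^ i ≤ ∑ i ∈ Finset.range (r + 1),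
        p.abv v (((Polynomial.X - Polynomial.C ξ) ^ a * Q).coeff i) * (1 / 2) ^ i := by
      intro a
      induction a with
      | zero => simp
      | succ a ih =>
        rw [pow_succ', mul_assoc, pow_succ', mul_assoc]
        exact (mul_le_mul_of_nonneg_left ih (by positivity)).trans (sum_half_le v h.le _ _)
    have h3 : p.abv v Q.leadingCoeff * (1 / 2) ^ Q.natDegree ≤ ∑ i ∈ Finset.range (r + 1),
        p.abv v (Q.coeff i) * (1 / 2) ^ i :=
      Finset.single_le_sum (f := fun i => p.abv v (Q.coeff i) * (1 / 2) ^ i)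
        (fun i _ => by positivity) (Finset.mem_range.mpr (by omega))
    have h4 : ∑ i ∈ Finset.range (r + 1),
        p.abv v (((Polynomial.X - Polynomial.C ξ) ^ a * Q).coeff i) * (1 / 2) ^ i ≤ B := by
      refine le_trans (Finset.sum_le_sum fun i _ => ?_) (hB' hv)
      exact mul_le_of_le_one_right ((p.abv v).nonneg _) (pow_le_one₀ (by norm_num) (by norm_num))
    have h5 := (mul_le_mul_of_nonneg_left h3 (by positivity)).trans ((key a).trans h4)
    have h6 : (2 : ℝ) ^ (a + Q.natDegree) ≤ p.cst v (2 ^ r) := by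
      rw [Places.cst, if_pos hv]
      exact pow_le_pow_right₀ (by norm_num) hdeg
    calc p.abv v Q.leadingCoeff * p.abv v ξ ^ a = 2 ^ (a + Q.natDegree) *
        ((p.abv v ξ / 2) ^ a * (p.abv v Q.leadingCoeff * (1 / 2) ^ Q.natDegree)) := by
          rw [div_pow, pow_add, div_pow, one_pow]; field_simp
      _ ≤ 2 ^ (a + Q.natDegree) * B := mul_le_mul_of_nonneg_left h5 (by positivity)
      _ ≤ _ := mul_le_mul_of_nonneg_right h6 hB0
  · have key : ∀ a B, (∀ i, p.abv v (((Polynomial.X - Polynomial.C ξ) ^ a * Q).coeff i) ≤ B) →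
        ∀ i, p.abv v (Q.coeff i) * p.abv v ξ ^ a ≤ B := by
      intro a
      induction a with
      | zero => intro B h; simpa using h
      | succ a ih =>
        intro B hB i
        have hξ0 : 0 < p.abv v ξ := zero_lt_one.trans h
        have hB0 : 0 ≤ B := ((p.abv v).nonneg _).trans (hB 0)
        rw [pow_succ, ← mul_assoc, ← le_div_iff₀ hξ0]
        refine ih _ (fun k => ?_) i
        rw [le_div_iff₀ hξ0]
        have hrec := fun k => coeff_X_sub_C_mul ξ ((Polynomial.X - Polynomial.C ξ) ^ a * Q) k
        simp only [← mul_assoc, ← pow_succ'] at hrec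
        set R := (Polynomial.X - Polynomial.C ξ) ^ a * Q
        induction k with
        | zero =>
          have := hB 0
          rw [hrec, if_pos rfl, zero_sub, (p.abv v).map_neg, map_mul] at this
          linarith
        | succ k ihk =>
          have h1 := hB (k + 1)
          have h2 := hrec (k + 1)
          simp only [Nat.add_eq_zero_iff, one_ne_zero, and_false, if_false,
            Nat.add_sub_cancel] at h2
          have h3 : R.coeff (k + 1) * ξ = R.coeff k +
            -((Polynomial.X - Polynomial.C ξ) ^ (a + 1) * Q).coeff (k + 1) := by
            rw [h2]; ring
          rw [← map_mul, h3]
          refine (p.nonarch v hv _ _).trans (max_le ?_ ?_)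
          · exact le_trans (le_mul_of_one_le_right ((p.abv v).nonneg _) h.le) ihk
          · rwa [(p.abv v).map_neg]
    rw [Places.cst, if_neg hv, one_mul]
    exact key a B hB _

/-- Roth's lemma in `m` variables. -/
def RothLemma (p : Places K) (m : ℕ) : Prop :=
  ∀ ε : ℝ, 0 < ε → ∃ η : ℝ, 0 < η ∧ ∀ r : Fin m → ℕ, (∀ i, 1 ≤ r i) →
    (∀ i j, i < j → (r i : ℝ) ≤ η * r j) → ∀ ρ h : ℝ, (∀ i, (r i : ℝ) ≤ ρ) → ρ ≤ h →
    ∀ P : MvPolynomial (Fin m) K, P ≠ 0 → (∀ i, degreeOf i P ≤ r i) →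
    (∀ᶠ T : Finset p.V in atTop, ∏ v ∈ T, p.pnrm v P ≤ Real.exp h) →
    ∀ (ξ : Fin m → K) (H : Fin m → ℝ),
    (∀ i, ∀ᶠ T : Finset p.V in atTop, Real.exp (H i) ≤ ∏ v ∈ T, max 1 (p.abv v (ξ i))) →
    (∀ i, h ≤ η * (r i * H i)) →
    ∃ α, coeff α (translate ξ P) ≠ 0 ∧ ∑ i, (α i : ℝ) / r i ≤ ε

theorem rothLemma_one (p : Places K) : RothLemma p 1 := by
  intro ε hε
  set A := p.arch.card
  refine ⟨ε / (2 * (A + 1)), by positivity, ?_⟩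
  intro r hr _ ρ h hρ hh P hP hdeg hnrm ξ H hH hbig
  by_contra! hcon
  set a := ⌊ε * r 0⌋₊ + 1 with ha
  let φ : MvPolynomial (Fin 1) K →ₐ[K] Polynomial K := aeval fun _ => Polynomial.X
  have hφ : ∀ (Q : MvPolynomial (Fin 1) K) n, (φ Q).coeff n = coeff (Finsupp.single 0 n) Q := by
    intro Q n
    induction Q using MvPolynomial.induction_on' with
    | monomial α c =>
      have : α = Finsupp.single 0 (α 0) := by
        refine Finsupp.ext fun i => ?_
        rw [Subsingleton.elim i 0]; simp
      rw [this]
      simp only [φ, aeval_monomial, coeff_monomial]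
      rw [Finsupp.prod_single_index (by simp), ← Polynomial.C_eq_algebraMap, Polynomial.coeff_C_mul,
        Polynomial.coeff_X_pow]
      by_cases h : n = α 0
      · simp [h]
      · simp [h, Ne.symm h]
    | add p q hp hq => simp [hp, hq]
  have hφ0 : φ P ≠ 0 := by
    intro h
    apply hP
    ext α
    have : α = Finsupp.single 0 (α 0) := by
      refine Finsupp.ext fun i => ?_
      rw [Subsingleton.elim i 0]; simp
    rw [this, ← hφ, h]; simp
  have htr : φ (translate ξ P) = (φ P).comp (Polynomial.X + Polynomial.C (ξ 0)) := by
    have : φ.comp (translate ξ) =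
        (Polynomial.aeval (Polynomial.X + Polynomial.C (ξ 0))).comp φ := by
      apply MvPolynomial.algHom_ext
      intro i
      rw [Subsingleton.elim i 0]
      simp [φ, translate, ← Polynomial.C_eq_algebraMap, MvPolynomial.algebraMap_eq]
    have h := congrFun (congrArg DFunLike.coe this) P
    simpa [Polynomial.comp, Polynomial.aeval_def, Polynomial.eval₂_eq_eval_map] using h
  have hdvd : (Polynomial.X - Polynomial.C (ξ 0)) ^ a ∣ φ P := by
    rw [Polynomial.X_sub_C_pow_dvd_iff, ← htr, Polynomial.X_pow_dvd_iff]
    intro n hn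
    rw [hφ]
    by_contra hne
    have := hcon _ hne
    simp only [Fin.sum_univ_one, Finsupp.single_eq_same] at this
    have hr0 : (0 : ℝ) < r 0 := by exact_mod_cast hr 0
    rw [lt_div_iff₀ hr0] at this
    have h2 := (Nat.le_floor_iff (by positivity)).mp (Nat.lt_succ_iff.mp (ha ▸ hn))
    linarith
  obtain ⟨Q, hQ⟩ := hdvd
  have hdegφ : (φ P).natDegree ≤ r 0 := by
    rw [Polynomial.natDegree_le_iff_coeff_eq_zero]
    intro n hn
    rw [hφ]
    by_contra hne
    have := degreeOf_le_iff.mp (hdeg 0) _ (mem_support_iff.mpr hne)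
    simp at this
    omega
  have hplace : ∀ v, p.abv v (φ P).leadingCoeff * max 1 (p.abv v (ξ 0)) ^ a ≤
      p.cst v (2 ^ r 0) * p.pnrm v P := by
    intro v
    rw [hQ]
    apply lead_mul_pow_le
    · rw [← hQ]; exact hdegφ
    · intro i
      rw [← hQ, hφ]
      exact Places.coeff_le_pnrm v P _
    · intro hv
      classical
      rw [← hQ, Places.pnrm_arch hv (P := P) (s := P.support ∪ (Finset.range (r 0 + 1)).map
        ⟨fun n => Finsupp.single 0 n, Finsupp.single_injective 0⟩) Finset.subset_union_left]
      refine le_trans (le_of_eq ?_) (Finset.sum_le_sum_of_subset_of_nonneg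
        Finset.subset_union_right fun _ _ _ => (p.abv v).nonneg _)
      rw [Finset.sum_map]
      exact Finset.sum_congr rfl fun i _ => by rw [hφ]; rfl
  obtain ⟨T, h1, h2, h3, h4⟩ := ((p.prod_eq_one _ (Polynomial.leadingCoeff_ne_zero.mpr hφ0)).and
    (hnrm.and ((hH 0).and (eventually_ge_atTop p.arch)))).exists
  have h5 := Finset.prod_le_prod (s := T) (fun v _ => by positivity) fun v _ => hplace v
  rw [Finset.prod_mul_distrib, Finset.prod_mul_distrib, h1, one_mul, Finset.prod_pow,
    Places.prod_cst _ h4] at h5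
  have hr0 : (1 : ℝ) ≤ r 0 := by exact_mod_cast hr 0
  have h6 : Real.exp (a * H 0) ≤ Real.exp (r 0 * A * 1 + h) := by
    rw [Real.exp_nat_mul, Real.exp_add]
    refine (pow_le_pow_left₀ (Real.exp_pos _).le h3 a).trans (h5.trans ?_)
    refine mul_le_mul ?_ h2 (Finset.prod_nonneg fun v _ => Places.pnrm_nonneg v P)
      (Real.exp_pos _).le
    rw [← pow_mul, show (r 0 * A * 1 : ℝ) = ((r 0 * A : ℕ) : ℝ) * 1 by push_cast; ring,
      Real.exp_nat_mul]
    exact pow_le_pow_left₀ (by norm_num) (by linarith [Real.add_one_le_exp (1 : ℝ)]) _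
  have h7 := Real.exp_le_exp.mp h6
  have h8 := hbig 0
  have h9 : ε * r 0 < a := by rw [ha]; push_cast; exact Nat.lt_floor_add_one _
  have hrh : (r 0 : ℝ) ≤ h := (hρ 0).trans hh
  have hA : (0 : ℝ) ≤ A := Nat.cast_nonneg _
  have hH0 : 0 < H 0 := by
    by_contra hneg
    push Not at hneg
    have : ε / (2 * (A + 1)) * (r 0 * H 0) ≤ 0 :=
      mul_nonpos_of_nonneg_of_nonpos (by positivity)
        (mul_nonpos_of_nonneg_of_nonpos (by positivity) hneg)
    linarith
  have h10 : ε * r 0 * H 0 ≤ (A + 1) * h := by nlinarith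
  have h11 : (A + 1) * h ≤ ε / 2 * (r 0 * H 0) := by
    have := mul_le_mul_of_nonneg_left h8 (by positivity : (0 : ℝ) ≤ A + 1)
    refine this.trans (le_of_eq ?_)
    field_simp
  have : 0 < ε * (r 0 * H 0) := by positivity
  nlinarith

end univariate

/-- Reducing a finite sum of values of a bilinear map so that both families are independent. -/
theorem exists_indep_decomp {K M N P : Type*} [Field K] [AddCommGroup M] [Module K M]
    [AddCommGroup N] [Module K N] [AddCommGroup P] [Module K P] (B : M →ₗ[K] N →ₗ[K] P)
    (G : Submodule K M) (F : Submodule K N) (n₀ : ℕ) :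
    ∀ (g₀ : Fin n₀ → M) (f₀ : Fin n₀ → N), (∀ l, g₀ l ∈ G) → (∀ l, f₀ l ∈ F) →
    ∃ n ≤ n₀, ∃ (g : Fin n → M) (f : Fin n → N), (∀ l, g l ∈ G) ∧ (∀ l, f l ∈ F) ∧
      LinearIndependent K g ∧ LinearIndependent K f ∧
      ∑ l, B (g l) (f l) = ∑ l, B (g₀ l) (f₀ l) := by
  induction n₀ with
  | zero =>
    intro g f hg hf
    exact ⟨0, le_rfl, g, f, hg, hf, linearIndependent_empty_type, linearIndependent_empty_type, rfl⟩
  | succ n₀ ih =>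
    intro g f hg hf
    by_cases hgi : LinearIndependent K g
    · by_cases hfi : LinearIndependent K f
      · exact ⟨_, le_rfl, g, f, hg, hf, hgi, hfi, rfl⟩
      · obtain ⟨c, hc, k, hk⟩ := Fintype.not_linearIndependent_iff.mp hfi
        have hfk : f k = -∑ l, ((c k)⁻¹ * c (k.succAbove l)) • f (k.succAbove l) := by
          rw [Fin.sum_univ_succAbove _ k] at hc
          have := congrArg ((c k)⁻¹ • ·) hc
          simp only [smul_add, smul_smul, inv_mul_cancel₀ hk, one_smul, smul_zero,
            Finset.smul_sum] at this
          exact eq_neg_of_add_eq_zero_left this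
        obtain ⟨n, hn, g', f', h1, h2, h3, h4, h5⟩ := ih
          (fun l => g (k.succAbove l) - ((c k)⁻¹ * c (k.succAbove l)) • g k)
          (fun l => f (k.succAbove l)) (fun l => G.sub_mem (hg _) (G.smul_mem _ (hg _)))
          (fun l => hf _)
        refine ⟨n, hn.trans (Nat.le_succ _), g', f', h1, h2, h3, h4, h5.trans ?_⟩
        rw [Fin.sum_univ_succAbove _ k, hfk]
        simp only [map_sub, LinearMap.sub_apply, map_smul, LinearMap.smul_apply,
          Finset.sum_sub_distrib, map_neg, map_sum]
        abel
    · obtain ⟨c, hc, k, hk⟩ := Fintype.not_linearIndependent_iff.mp hgi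
      have hfk : g k = -∑ l, ((c k)⁻¹ * c (k.succAbove l)) • g (k.succAbove l) := by
        rw [Fin.sum_univ_succAbove _ k] at hc
        have := congrArg ((c k)⁻¹ • ·) hc
        simp only [smul_add, smul_smul, inv_mul_cancel₀ hk, one_smul, smul_zero,
          Finset.smul_sum] at this
        exact eq_neg_of_add_eq_zero_left this
      obtain ⟨n, hn, g', f', h1, h2, h3, h4, h5⟩ := ih
        (fun l => g (k.succAbove l))
        (fun l => f (k.succAbove l) - ((c k)⁻¹ * c (k.succAbove l)) • f k)
        (fun l => hg _) (fun l => F.sub_mem (hf _) (F.smul_mem _ (hf _)))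
      refine ⟨n, hn.trans (Nat.le_succ _), g', f', h1, h2, h3, h4, h5.trans ?_⟩
      rw [Fin.sum_univ_succAbove _ k, hfk]
      simp only [map_sub, map_smul, LinearMap.smul_apply, LinearMap.neg_apply,
        LinearMap.sum_apply, Finset.sum_sub_distrib, map_neg, map_sum]
      abel

theorem sum_max_ge {θ : ℝ} (h0 : 0 < θ) (h1 : θ ≤ 1) {n r : ℕ} (hr : 1 ≤ r) (hn : n ≤ 2 * r) :
    θ ^ 2 * n / 8 ≤ ∑ ν ∈ Finset.range n, max 0 (θ - ν / r) := by
  have hr' : (0 : ℝ) < r := by exact_mod_cast hr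
  have hn' : (n : ℝ) ≤ 2 * r := by exact_mod_cast hn
  have hn0 : (0 : ℝ) ≤ n := Nat.cast_nonneg n
  set c := ⌈θ * n / 4⌉₊ with hc
  have hcn : c ≤ n := by
    rw [hc, Nat.ceil_le]
    nlinarith
  calc θ ^ 2 * n / 8 = (θ * n / 4) * (θ / 2) := by ring
    _ ≤ c * (θ / 2) := mul_le_mul_of_nonneg_right (Nat.le_ceil _) (by positivity)
    _ = ∑ ν ∈ Finset.range c, θ / 2 := by simp
    _ ≤ ∑ ν ∈ Finset.range c, max 0 (θ - ν / r) := by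
        refine Finset.sum_le_sum fun ν hν => le_max_of_le_right ?_
        have := Nat.lt_ceil.mp (hc ▸ Finset.mem_range.mp hν)
        have h2 : (ν : ℝ) / r ≤ θ / 2 := by
          rw [div_le_iff₀ hr']
          nlinarith
        linarith
    _ ≤ _ := Finset.sum_le_sum_of_subset_of_nonneg (Finset.range_subset_range.mpr hcn)
        fun _ _ _ => le_max_left _ _

section split

variable {K : Type*} [Field K] {m : ℕ}

/-- Polynomials in the first variable. -/
noncomputable def inFst (m : ℕ) : MvPolynomial (Fin 1) K →ₐ[K] MvPolynomial (Fin (m + 1)) K :=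
  rename fun _ => 0

/-- Polynomials in the remaining variables. -/
noncomputable def inRest (m : ℕ) : MvPolynomial (Fin m) K →ₐ[K] MvPolynomial (Fin (m + 1)) K :=
  rename Fin.succ

theorem inFst_mul_inRest_monomial (a : Fin 1 →₀ ℕ) (b : Fin m →₀ ℕ) (c c' : K) :
    inFst m (monomial a c) * inRest m (monomial b c') =
      monomial (Finsupp.cons (a 0) b) (c * c') := by
  rw [inFst, inRest, rename_monomial, rename_monomial, monomial_mul]
  have ha : a = Finsupp.single 0 (a 0) := by
    refine Finsupp.ext fun i => ?_
    rw [Subsingleton.elim i 0]; simp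
  refine congrArg (fun e => monomial e (c * c')) (Finsupp.ext fun i => ?_)
  refine Fin.cases ?_ (fun j => ?_) i
  · rw [Finsupp.add_apply, Finsupp.mapDomain_of_notMem_range b 0 (by simp), ha,
      Finsupp.mapDomain_single]
    simp
  · rw [Finsupp.add_apply, Finsupp.mapDomain_apply (Fin.succ_injective m), ha,
      Finsupp.mapDomain_single]
    simp

theorem binom_cons (a k : ℕ) (b l : Fin m →₀ ℕ) :
    binom (Finsupp.cons a b) (Finsupp.cons k l) = a.choose k * binom b l := by
  simp [binom, Fin.prod_univ_succ]

theorem hasse_inFst_mul_inRest (ν : Fin 1 →₀ ℕ) (μ : Fin m →₀ ℕ) (g : MvPolynomial (Fin 1) K)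
    (f : MvPolynomial (Fin m) K) :
    hasse (Finsupp.cons (ν 0) μ) (inFst m g * inRest m f) =
      inFst m (hasse ν g) * inRest m (hasse μ f) := by
  induction g using MvPolynomial.induction_on' with
  | add p q hp hq => rw [map_add, add_mul, hasse_add, hp, hq, hasse_add, map_add, add_mul]
  | monomial a c =>
    induction f using MvPolynomial.induction_on' with
    | add p q hp hq => rw [map_add, mul_add, hasse_add, hp, hq, hasse_add, map_add, mul_add]
    | monomial b c' =>
      rw [inFst_mul_inRest_monomial, hasse_monomial, hasse_monomial, hasse_monomial,
        inFst_mul_inRest_monomial, binom_cons]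
      have h1 : (Finsupp.cons (a 0) b - Finsupp.cons (ν 0) μ : Fin (m + 1) →₀ ℕ) =
          Finsupp.cons ((a - ν) 0) (b - μ) := by
        refine Finsupp.ext fun i => ?_
        refine Fin.cases ?_ (fun j => ?_) i <;> simp
      rw [h1]
      refine congrArg (monomial _) ?_
      simp [binom]; ring

theorem coeff_inFst_mul_inRest (a : Fin 1 →₀ ℕ) (b : Fin m →₀ ℕ) (g : MvPolynomial (Fin 1) K)
    (f : MvPolynomial (Fin m) K) :
    coeff (Finsupp.cons (a 0) b) (inFst m g * inRest m f) = coeff a g * coeff b f := by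
  classical
  induction g using MvPolynomial.induction_on' with
  | add p q hp hq => rw [map_add, add_mul, coeff_add, hp, hq, coeff_add, add_mul]
  | monomial a' c =>
    induction f using MvPolynomial.induction_on' with
    | add p q hp hq => rw [map_add, mul_add, coeff_add, hp, hq, coeff_add, mul_add]
    | monomial b' c' =>
      rw [inFst_mul_inRest_monomial, coeff_monomial, coeff_monomial, coeff_monomial]
      have : Finsupp.cons (a' 0) b' = Finsupp.cons (a 0) b ↔ a' = a ∧ b' = b := by
        constructor
        · intro h
          constructor
          · refine Finsupp.ext fun i => ?_
            rw [Subsingleton.elim i 0]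
            simpa using DFunLike.congr_fun h 0
          · ext j
            simpa using DFunLike.congr_fun h j.succ
        · rintro ⟨rfl, rfl⟩; rfl
      simp only [this]
      by_cases h1 : a' = a <;> by_cases h2 : b' = b <;> simp [h1, h2]

theorem translate_inFst_mul_inRest (ξ : Fin (m + 1) → K) (g : MvPolynomial (Fin 1) K)
    (f : MvPolynomial (Fin m) K) :
    translate ξ (inFst m g * inRest m f) =
      inFst m (translate (fun _ => ξ 0) g) * inRest m (translate (fun i => ξ i.succ) f) := by
  rw [map_mul]
  congr 1
  · have : (translate ξ).comp (inFst m) = (inFst m).comp (translate fun _ => ξ 0) := by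
      apply MvPolynomial.algHom_ext
      intro i
      simp [translate, inFst]
    exact congrFun (congrArg DFunLike.coe this) g
  · have : (translate ξ).comp (inRest m) = (inRest m).comp (translate fun i => ξ i.succ) := by
      apply MvPolynomial.algHom_ext
      intro i
      simp [translate, inRest]
    exact congrFun (congrArg DFunLike.coe this) f

theorem pnrm_mul_pnrm_le {p : Places K} (v : p.V) (g : MvPolynomial (Fin 1) K)
    (f : MvPolynomial (Fin m) K) :
    p.pnrm v g * p.pnrm v f ≤ p.pnrm v (inFst m g * inRest m f) := by
  classical
  set N := p.pnrm v (inFst m g * inRest m f) with hN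
  have hN0 : 0 ≤ N := Places.pnrm_nonneg v _
  have hab : ∀ a b, p.abv v (coeff a g) * p.abv v (coeff b f) ≤ N := by
    intro a b
    rw [← map_mul, ← coeff_inFst_mul_inRest]
    exact Places.coeff_le_pnrm v _ _
  by_cases hv : v ∈ p.arch
  · have hinj : Function.Injective fun x : (Fin 1 →₀ ℕ) × (Fin m →₀ ℕ) =>
        (Finsupp.cons (x.1 0) x.2 : Fin (m + 1) →₀ ℕ) := by
      rintro ⟨a, b⟩ ⟨a', b'⟩ h
      simp only at h
      refine Prod.ext ?_ ?_
      · refine Finsupp.ext fun i => ?_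
        rw [Subsingleton.elim i 0]
        simpa using DFunLike.congr_fun h 0
      · ext j
        simpa using DFunLike.congr_fun h j.succ
    rw [hN, Places.pnrm_arch hv (P := g) subset_rfl, Places.pnrm_arch hv (P := f) subset_rfl,
      Finset.sum_mul_sum, ← Finset.sum_product',
      Places.pnrm_arch hv (s := (inFst m g * inRest m f).support ∪
        (g.support ×ˢ f.support).map ⟨_, hinj⟩) Finset.subset_union_left]
    refine le_trans (le_of_eq ?_) (Finset.sum_le_sum_of_subset_of_nonneg
        Finset.subset_union_right fun _ _ _ => (p.abv v).nonneg _)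
    rw [Finset.sum_map]
    refine Finset.sum_congr rfl fun x _ => ?_
    simp only [Function.Embedding.coeFn_mk]
    rw [coeff_inFst_mul_inRest, map_mul]
  · have h1 : ∀ a, p.abv v (coeff a g) * p.pnrm v f ≤ N := by
      intro a
      rcases (p.abv v).nonneg (coeff a g) |>.eq_or_lt with h | h
      · rw [← h, zero_mul]; exact hN0
      rw [mul_comm, ← le_div_iff₀ h]
      refine Places.pnrm_le_of_nonarch hv (by positivity) fun b => ?_
      rw [le_div_iff₀ h, mul_comm]
      exact hab a b
    rcases (Places.pnrm_nonneg v f).eq_or_lt with h | h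
    · rw [← h, mul_zero]; exact hN0
    rw [← le_div_iff₀ h]
    refine Places.pnrm_le_of_nonarch hv (by positivity) fun a => ?_
    rw [le_div_iff₀ h]
    exact h1 a

end split

section weight

variable {σ : Type*} [Fintype σ] {K : Type*} [Field K] (r : σ → ℕ)

/-- All monomials occurring in `P` have weight `∑ αᵢ / rᵢ` at least `w`. -/
def WtGe (w : ℝ) (P : MvPolynomial σ K) : Prop :=
  ∀ α, coeff α P ≠ 0 → w ≤ ∑ i, (α i : ℝ) / r i

variable {r}

theorem WtGe.sum {ι : Type*} {s : Finset ι} {f : ι → MvPolynomial σ K} {w : ℝ}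
    (h : ∀ i ∈ s, WtGe r w (f i)) : WtGe r w (∑ i ∈ s, f i) := by
  intro α hα
  rw [coeff_sum] at hα
  obtain ⟨i, hi, h'⟩ := Finset.exists_ne_zero_of_sum_ne_zero hα
  exact h i hi α h'

theorem WtGe.mul {P Q : MvPolynomial σ K} {a b : ℝ} (hP : WtGe r a P) (hQ : WtGe r b Q) :
    WtGe r (a + b) (P * Q) := by
  classical
  intro α hα
  rw [coeff_mul] at hα
  obtain ⟨⟨x, y⟩, hi, h'⟩ := Finset.exists_ne_zero_of_sum_ne_zero hα
  rw [Finset.HasAntidiagonal.mem_antidiagonal] at hi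
  obtain rfl : x + y = α := hi
  have h1 := hP x (left_ne_zero_of_mul h')
  have h2 := hQ y (right_ne_zero_of_mul h')
  refine (add_le_add h1 h2).trans (le_of_eq ?_)
  rw [← Finset.sum_add_distrib]
  refine Finset.sum_congr rfl fun i _ => ?_
  rw [Finsupp.add_apply]; push_cast; ring

theorem WtGe.one : WtGe r 0 (1 : MvPolynomial σ K) := fun α _ =>
  Finset.sum_nonneg fun _ _ => by positivity

theorem WtGe.prod {ι : Type*} {s : Finset ι} {f : ι → MvPolynomial σ K} {w : ι → ℝ}
    (h : ∀ i ∈ s, WtGe r (w i) (f i)) : WtGe r (∑ i ∈ s, w i) (∏ i ∈ s, f i) := by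
  classical
  induction s using Finset.induction_on with
  | empty => simpa using WtGe.one
  | insert a s ha ih =>
    rw [Finset.sum_insert ha, Finset.prod_insert ha]
    exact (h a (by simp)).mul (ih fun i hi => h i (by simp [hi]))

theorem WtGe.det {n : ℕ} {M : Matrix (Fin n) (Fin n) (MvPolynomial σ K)} {w : Fin n → ℝ}
    (h : ∀ i j, WtGe r (w i) (M i j)) : WtGe r (∑ i, w i) M.det := by
  rw [Matrix.det_apply]
  refine WtGe.sum fun e _ => ?_
  have h1 : WtGe r (∑ i, w (e i)) (∏ i, M (e i) i) := WtGe.prod fun i _ => h _ _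
  rw [Equiv.sum_comp e w] at h1
  rcases Int.units_eq_one_or (Equiv.Perm.sign e) with h2 | h2
  · rw [h2, one_smul]; exact h1
  · rw [h2]
    intro α hα
    refine h1 α fun h0 => hα ?_
    rw [Units.neg_smul, one_smul, coeff_neg, h0, neg_zero]

theorem WtGe.hasse {P : MvPolynomial σ K} {w : ℝ} (hP : WtGe r w P) (κ : σ →₀ ℕ) :
    WtGe r (max 0 (w - ∑ i, (κ i : ℝ) / r i)) (hasse κ P) := by
  intro α hα
  rw [coeff_hasse] at hα
  have h1 := hP _ (right_ne_zero_of_mul hα)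
  refine max_le (Finset.sum_nonneg fun _ _ => by positivity) ?_
  rw [sub_le_iff_le_add, ← Finset.sum_add_distrib]
  refine h1.trans (le_of_eq (Finset.sum_congr rfl fun i _ => ?_))
  rw [Finsupp.add_apply]; push_cast; ring

theorem WtGe.mono {P : MvPolynomial σ K} {a b : ℝ} (hP : WtGe r b P) (h : a ≤ b) : WtGe r a P :=
  fun α hα => h.trans (hP α hα)

end weight

section degree

variable {σ : Type*} {K : Type*} [Field K]

/-- Polynomials of bounded partial degrees. -/
def degSub (K : Type*) [Field K] (r : σ → ℕ) : Submodule K (MvPolynomial σ K) where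
  carrier := {f | ∀ i, degreeOf i f ≤ r i}
  add_mem' := fun {a b} ha hb i => (degreeOf_add_le i a b).trans (max_le (ha i) (hb i))
  zero_mem' := fun i => by simp
  smul_mem' := fun c x hx i => by
    rw [smul_eq_C_mul]
    exact (degreeOf_C_mul_le x i c).trans (hx i)

theorem degreeOf_det_le {n : ℕ} (M : Matrix (Fin n) (Fin n) (MvPolynomial σ K)) (i : σ) {B : ℕ}
    (h : ∀ a b, degreeOf i (M a b) ≤ B) : degreeOf i M.det ≤ n * B := by
  rw [Matrix.det_apply]
  refine (degreeOf_sum_le i _ _).trans (Finset.sup_le fun e _ => ?_)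
  have h1 : degreeOf i (∏ j, M (e j) j) ≤ n * B := by
    refine (degreeOf_prod_le i _ _).trans ((Finset.sum_le_card_nsmul _ _ B fun j _ => h _ _).trans ?_)
    simp
  rcases Int.units_eq_one_or (Equiv.Perm.sign e) with h2 | h2
  · rw [h2, one_smul]; exact h1
  · rw [h2, Units.neg_smul, one_smul, degreeOf_neg]; exact h1

end degree

variable {K : Type*} [Field K] {m : ℕ}

theorem exists_split (P : MvPolynomial (Fin (m + 1)) K) :
    P = ∑ l : Fin (degreeOf 0 P + 1),
      inFst m (X 0 ^ (l : ℕ)) * inRest m (Polynomial.coeff (finSuccEquiv K m P) l) := by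
  apply (finSuccEquiv K m).injective
  rw [map_sum]
  have h : ∀ l : ℕ, finSuccEquiv K m (inFst m (X 0 ^ l) *
      inRest m (Polynomial.coeff (finSuccEquiv K m P) l)) =
      Polynomial.C (Polynomial.coeff (finSuccEquiv K m P) l) * Polynomial.X ^ l := by
    intro l
    have h1 : ∀ Q : MvPolynomial (Fin m) K, finSuccEquiv K m (inRest m Q) = Polynomial.C Q := by
      intro Q
      induction Q using MvPolynomial.induction_on with
      | C a => simp [inRest, finSuccEquiv_apply]
      | add a b ha hb => rw [map_add, map_add, ha, hb, map_add]
      | mul_X a i ha => rw [map_mul, map_mul, ha, map_mul]; simp [inRest, finSuccEquiv_X_succ]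
    have h2 : inFst (K := K) m (X 0 ^ l) = X 0 ^ l := by rw [map_pow, inFst, rename_X]
    rw [map_mul, h1, h2, map_pow, finSuccEquiv_X_zero, mul_comm]
  simp only [h]
  rw [Fin.sum_univ_eq_sum_range (fun l => Polynomial.C (Polynomial.coeff (finSuccEquiv K m P) l) *
    Polynomial.X ^ l), ← natDegree_finSuccEquiv]
  exact Polynomial.as_sum_range_C_mul_X_pow _

end Roth

namespace Roth

open Filter

variable {K : Type*} [Field K] {m : ℕ} {p : Places K}

theorem exists_prod_wronskian [CharZero K] (P : MvPolynomial (Fin (m + 1)) K) (hP : P ≠ 0) :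
    ∃ n, 0 < n ∧ n ≤ degreeOf 0 P + 1 ∧ ∃ (ν : Fin n → ℕ) (μ : Fin n → Fin m →₀ ℕ)
      (U : MvPolynomial (Fin m) K) (V : MvPolynomial (Fin 1) K),
      (∀ i, ν i < n) ∧ Function.Injective ν ∧ (∀ i, (μ i).degree < n) ∧ U ≠ 0 ∧ V ≠ 0 ∧
      (∀ i, degreeOf i U ≤ n * degreeOf i.succ P) ∧ (∀ i, degreeOf i V ≤ n * degreeOf 0 P) ∧
      (Matrix.of fun k i => hasse (Finsupp.cons (ν k) (μ i)) P).det = inFst m V * inRest m U := by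
  classical
  let B : MvPolynomial (Fin 1) K →ₗ[K] MvPolynomial (Fin m) K →ₗ[K] MvPolynomial (Fin (m + 1)) K :=
    (LinearMap.mul K (MvPolynomial (Fin (m + 1)) K)).compl₁₂ (inFst m).toLinearMap
      (inRest m).toLinearMap
  have hB : ∀ g f, B g f = inFst m g * inRest m f := fun _ _ => rfl
  obtain ⟨n, hn, g, f, hg, hf, hgi, hfi, hsum⟩ := exists_indep_decomp B
    (degSub K fun _ => degreeOf 0 P) (degSub K fun i => degreeOf i.succ P) (degreeOf 0 P + 1)
    (fun l => X 0 ^ (l : ℕ)) (fun l => Polynomial.coeff (finSuccEquiv K m P) l)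
    (fun l i => by
      rw [Subsingleton.elim i 0]
      refine (degreeOf_pow_le _ _ _).trans ?_
      rw [degreeOf_X]
      simpa using Nat.lt_succ_iff.mp l.2)
    (fun l i => degreeOf_coeff_finSuccEquiv P i l)
  simp only [hB] at hsum
  rw [← exists_split] at hsum
  have hn0 : 0 < n := by
    rcases Nat.eq_zero_or_pos n with h | h
    · subst h
      exact absurd (by simpa using hsum.symm) hP
    · exact h
  obtain ⟨ν, hν, hνd⟩ := exists_wronskian_ne_zero g hgi
  obtain ⟨μ, hμ, hμd⟩ := exists_wronskian_ne_zero f hfi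
  have hν1 : ∀ i, ν i 0 < n := fun i => lt_of_le_of_lt (Finsupp.le_degree 0 (ν i)) (hν i)
  refine ⟨n, hn0, hn, fun i => ν i 0, μ, _, _, hν1, ?_, hμ, hμd, hνd, ?_, ?_, ?_⟩
  · intro a b hab
    by_contra hne
    apply hνd
    refine Matrix.det_zero_of_row_eq hne ?_
    have : ν a = ν b := by
      refine Finsupp.ext fun i => ?_
      rw [Subsingleton.elim i 0]; exact hab
    funext j
    simp [this]
  · intro i
    exact degreeOf_det_le _ _ fun a b => (degreeOf_hasse_le _ _ _).trans (hf b i)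
  · intro i
    exact degreeOf_det_le _ _ fun a b => (degreeOf_hasse_le _ _ _).trans (hg b i)
  · rw [AlgHom.map_det, AlgHom.map_det, ← Matrix.det_transpose ((inRest m).mapMatrix _),
      ← Matrix.det_mul]
    congr 1
    refine Matrix.ext fun k i => ?_
    rw [Matrix.of_apply, ← hsum, hasse_sum, Matrix.mul_apply]
    exact Finset.sum_congr rfl fun l _ => hasse_inFst_mul_inRest _ _ _ _

end Roth

namespace Roth

open Filter

variable {K : Type*} [Field K] {m : ℕ} {p : Places K}

theorem height_det_hasse_le {m n : ℕ} {P : MvPolynomial (Fin m) K}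
    {r : Fin m → ℕ} (hr : ∀ i, degreeOf i P ≤ r i) {ρ h : ℝ} (hρ : ∀ i, (r i : ℝ) ≤ ρ) (hρh : ρ ≤ h)
    (hρ0 : 0 ≤ ρ) (hn : (n : ℝ) ≤ Real.exp ρ)
    (hP : ∀ᶠ T : Finset p.V in atTop, ∏ v ∈ T, p.pnrm v P ≤ Real.exp h)
    (κ : Fin n → Fin n → Fin m →₀ ℕ) :
    ∀ᶠ T : Finset p.V in atTop, ∏ v ∈ T, p.pnrm v (Matrix.of fun k i => hasse (κ k i) P).det ≤
      Real.exp (n * ((p.arch.card * (m + 1) + 1) * h)) := by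
  filter_upwards [hP, eventually_ge_atTop p.arch] with T hT hA
  have h1 : ∀ v, p.pnrm v (Matrix.of fun k i => hasse (κ k i) P).det ≤
      p.cst v (n.factorial : ℝ) * (p.cst v (2 ^ (∑ i, r i)) * p.pnrm v P) ^ n := fun v =>
    Places.pnrm_det_le v _ (mul_nonneg (p.cst_nonneg v (by positivity)) (Places.pnrm_nonneg v P))
      fun i j => by
        simpa using pnrm_hasse_le v (κ i j) (Finsupp.equivFunOnFinite.symm r) P (by simpa using hr)
  refine (Finset.prod_le_prod (fun v _ => Places.pnrm_nonneg v _) fun v _ => h1 v).trans ?_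
  rw [Finset.prod_mul_distrib, Finset.prod_pow, Finset.prod_mul_distrib, p.prod_cst _ hA,
    p.prod_cst _ hA]
  have hf : (n.factorial : ℝ) ≤ Real.exp (n * ρ) := by
    calc (n.factorial : ℝ) ≤ (n : ℝ) ^ n := by exact_mod_cast Nat.factorial_le_pow n
      _ ≤ Real.exp ρ ^ n := pow_le_pow_left₀ (Nat.cast_nonneg n) hn n
      _ = Real.exp (n * ρ) := by rw [Real.exp_nat_mul]
  have h2 : (2 : ℝ) ^ (∑ i, r i) ≤ Real.exp (m * ρ) := by
    have : (2 : ℝ) ≤ Real.exp 1 := by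
      have := Real.add_one_le_exp (1 : ℝ); linarith
    calc (2 : ℝ) ^ (∑ i, r i) ≤ Real.exp 1 ^ (∑ i, r i) := pow_le_pow_left₀ (by norm_num) this _
      _ = Real.exp (∑ i, (r i : ℝ)) := by
        rw [← Real.exp_nat_mul]; push_cast; rw [mul_one]
      _ ≤ _ := Real.exp_le_exp.mpr ((Finset.sum_le_card_nsmul _ _ ρ fun i _ => hρ i).trans (by simp))
  have h0 : 0 ≤ ∏ v ∈ T, p.pnrm v P := Finset.prod_nonneg fun v _ => Places.pnrm_nonneg v P
  set A := p.arch.card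
  calc (n.factorial : ℝ) ^ A * (((2 : ℝ) ^ (∑ i, r i)) ^ A * ∏ v ∈ T, p.pnrm v P) ^ n
      ≤ Real.exp (n * ρ) ^ A * (Real.exp (m * ρ) ^ A * Real.exp h) ^ n := by
        gcongr
    _ = Real.exp (n * (A * (m + 1) * ρ + h)) := by
        rw [← Real.exp_nat_mul, ← Real.exp_nat_mul, ← Real.exp_add, ← Real.exp_nat_mul,
          ← Real.exp_add]
        congr 1; ring
    _ ≤ _ := by
        apply Real.exp_le_exp.mpr
        apply mul_le_mul_of_nonneg_left _ (Nat.cast_nonneg n)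
        have : (A * (m + 1) : ℝ) * ρ ≤ A * (m + 1) * h :=
          mul_le_mul_of_nonneg_left hρh (by positivity)
        linarith

theorem rothLemma_succ [CharZero K] (hm : RothLemma p m) : RothLemma p (m + 1) := by
  classical
  intro ε₀ hε₀
  obtain ⟨ε, hε, hε1, hεε⟩ : ∃ ε : ℝ, 0 < ε ∧ ε ≤ 1 ∧ ε ≤ ε₀ :=
    ⟨min ε₀ 1, lt_min hε₀ one_pos, min_le_right _ _, min_le_left _ _⟩
  obtain ⟨η₁, hη₁, H₁⟩ := rothLemma_one p (ε ^ 2 / 128) (by positivity)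
  obtain ⟨η₂, hη₂, H₂⟩ := hm (ε ^ 2 / 128) (by positivity)
  set c : ℝ := p.arch.card * ((m + 1 : ℕ) + 1) + 1 with hc
  have hc1 : 1 ≤ c := by
    have : (0 : ℝ) ≤ p.arch.card * ((m + 1 : ℕ) + 1) := by positivity
    linarith
  have hc0 : 0 < c := by linarith
  obtain ⟨η, hη, hηa, hηb, hηc, hηd⟩ : ∃ η : ℝ, 0 < η ∧ c * η ≤ η₁ ∧ c * η ≤ η₂ ∧ η ≤ η₂ ∧
      η ≤ ε / 2 := by
    refine ⟨min (min (η₁ / c) (η₂ / c)) (ε / 2), by positivity, ?_, ?_, ?_, min_le_right _ _⟩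
    · rw [mul_comm, ← le_div_iff₀ hc0]; exact (min_le_left _ _).trans (min_le_left _ _)
    · rw [mul_comm, ← le_div_iff₀ hc0]; exact (min_le_left _ _).trans (min_le_right _ _)
    · refine ((min_le_left _ _).trans (min_le_right _ _)).trans ?_
      exact div_le_self hη₂.le hc1
  refine ⟨η, hη, ?_⟩
  intro r hr hrr ρ h hρ hρh P hP0 hdeg hP ξ H hH hhH
  by_contra! hcon
  have hwt : WtGe r ε (translate ξ P) := fun α hα => hεε.trans (hcon α hα).le
  have hr0 : ∀ i, (1 : ℝ) ≤ r i := fun i => by exact_mod_cast hr i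
  have hρ1 : 1 ≤ ρ := (hr0 0).trans (hρ 0)
  have hh0 : 0 < h := by linarith
  obtain ⟨n, hn0, hn, ν, μ, U, V, hν, hνi, hμ, hU0, hV0, hUd, hVd, hUV⟩ :=
    exists_prod_wronskian P hP0
  have hn1 : (1 : ℝ) ≤ n := by exact_mod_cast hn0
  have hnr : n ≤ r 0 + 1 := hn.trans (by simpa using hdeg 0)
  have hnρ : (n : ℝ) ≤ Real.exp ρ := by
    have h1 : (n : ℝ) ≤ r 0 + 1 := by exact_mod_cast hnr
    have := Real.add_one_le_exp ρ
    linarith [hρ 0]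
  have hW := height_det_hasse_le (p := p) hdeg hρ hρh (by linarith) hnρ hP
    (fun k i => Finsupp.cons (ν k) (μ i))
  rw [hUV, ← hc] at hW
  have hV : ∀ᶠ T : Finset p.V in atTop, ∏ v ∈ T, p.pnrm v V ≤ Real.exp (n * (c * h)) := by
    filter_upwards [hW, Places.prod_pnrm_ge_one (p := p) hU0] with T h1 h2
    have h3 : (∏ v ∈ T, p.pnrm v V) * ∏ v ∈ T, p.pnrm v U ≤ Real.exp (n * (c * h)) := by
      rw [← Finset.prod_mul_distrib]
      exact (Finset.prod_le_prod (fun v _ => mul_nonneg (Places.pnrm_nonneg v _)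
        (Places.pnrm_nonneg v _)) fun v _ => pnrm_mul_pnrm_le v V U).trans h1
    exact (le_mul_of_one_le_right (Finset.prod_nonneg fun v _ => Places.pnrm_nonneg v _) h2).trans h3
  have hU : ∀ᶠ T : Finset p.V in atTop, ∏ v ∈ T, p.pnrm v U ≤ Real.exp (n * (c * h)) := by
    filter_upwards [hW, Places.prod_pnrm_ge_one (p := p) hV0] with T h1 h2
    have h3 : (∏ v ∈ T, p.pnrm v V) * ∏ v ∈ T, p.pnrm v U ≤ Real.exp (n * (c * h)) := by
      rw [← Finset.prod_mul_distrib]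
      exact (Finset.prod_le_prod (fun v _ => mul_nonneg (Places.pnrm_nonneg v _)
        (Places.pnrm_nonneg v _)) fun v _ => pnrm_mul_pnrm_le v V U).trans h1
    exact (le_mul_of_one_le_left (Finset.prod_nonneg fun v _ => Places.pnrm_nonneg v _) h2).trans h3
  have hρ' : n * ρ ≤ n * (c * h) := by
    apply mul_le_mul_of_nonneg_left _ (by linarith)
    nlinarith
  have hrH : ∀ i, 0 < r i * H i := fun i => by
    have h1 := hhH i
    by_contra! h2
    have := mul_nonpos_of_nonneg_of_nonpos hη.le h2
    linarith
  have hkey : ∀ i (η' : ℝ), c * η ≤ η' → n * (c * h) ≤ η' * ((n * r i : ℕ) * H i) := by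
    intro i η' hη'
    have h1 := mul_le_mul_of_nonneg_left (hhH i) hc0.le
    have h2 := mul_le_mul_of_nonneg_right hη' (hrH i).le
    push_cast
    calc n * (c * h) ≤ n * (η' * (r i * H i)) := by
          apply mul_le_mul_of_nonneg_left _ (by linarith)
          linarith [mul_assoc c η (r i * H i)]
      _ = _ := by ring
  obtain ⟨a, ha, haw⟩ := H₁ (fun _ => n * r 0) (fun _ => Nat.mul_pos hn0 (hr 0))
    (fun i j hij => absurd hij (by rw [Subsingleton.elim i j]; exact lt_irrefl _)) (n * ρ)
    (n * (c * h)) (fun _ => by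
      push_cast
      exact mul_le_mul_of_nonneg_left (hρ 0) (by linarith)) hρ' V hV0
    (fun i => (hVd i).trans (Nat.mul_le_mul_left n (hdeg 0))) hV (fun _ => ξ 0) (fun _ => H 0)
    (fun _ => hH 0) (fun _ => hkey 0 η₁ hηa)
  obtain ⟨b, hb, hbw⟩ := H₂ (fun i => n * r i.succ) (fun i => Nat.mul_pos hn0 (hr _))
    (fun i j hij => by
      have h1 := hrr i.succ j.succ (Fin.succ_lt_succ_iff.mpr hij)
      have h2 : η * r j.succ ≤ η₂ * r j.succ :=
        mul_le_mul_of_nonneg_right hηc (Nat.cast_nonneg _)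
      push_cast
      calc (n : ℝ) * r i.succ ≤ n * (η₂ * r j.succ) :=
            mul_le_mul_of_nonneg_left (h1.trans h2) (by linarith)
        _ = _ := by ring) (n * ρ)
    (n * (c * h)) (fun i => by
      push_cast
      exact mul_le_mul_of_nonneg_left (hρ _) (by linarith)) hρ' U hU0
    (fun i => (hUd i).trans (Nat.mul_le_mul_left n (hdeg _))) hU (fun i => ξ i.succ)
    (fun i => H i.succ) (fun i => hH _) (fun i => hkey i.succ η₂ hηb)
  have hcoeff : coeff (Finsupp.cons (a 0) b) (translate ξ (inFst m V * inRest m U)) ≠ 0 := by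
    rw [translate_inFst_mul_inRest, coeff_inFst_mul_inRest]
    exact mul_ne_zero ha hb
  have hκ : ∀ k i, WtGe r (max 0 (ε / 2 - (ν k : ℝ) / r 0))
      (translate ξ (hasse (Finsupp.cons (ν k) (μ i)) P)) := by
    intro k i
    rw [← hasse_translate]
    refine (hwt.hasse _).mono (max_le_max le_rfl ?_)
    rw [Fin.sum_univ_succ]
    simp only [Finsupp.cons_zero, Finsupp.cons_succ]
    have hμi : ∑ j, ((μ i j : ℕ) : ℝ) ≤ r 0 := by
      have h1 : (μ i).degree ≤ r 0 := by have := hμ i; omega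
      rw [Finsupp.degree_eq_sum] at h1
      exact_mod_cast h1
    have : ∑ j : Fin m, (μ i j : ℝ) / r j.succ ≤ η := by
      calc ∑ j : Fin m, (μ i j : ℝ) / r j.succ ≤ ∑ j : Fin m, η / r 0 * (μ i j : ℝ) := by
            refine Finset.sum_le_sum fun j _ => ?_
            have h1 := hrr 0 j.succ (Fin.succ_pos j)
            have h2 := hr0 0
            have h3 := hr0 j.succ
            rw [div_le_iff₀ (by linarith), div_mul_eq_mul_div, div_mul_eq_mul_div,
              le_div_iff₀ (by linarith)]
            have := mul_le_mul_of_nonneg_left h1 (Nat.cast_nonneg (α := ℝ) (μ i j))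
            linarith
        _ = η / r 0 * ∑ j, (μ i j : ℝ) := by rw [Finset.mul_sum]
        _ ≤ η / r 0 * r 0 := mul_le_mul_of_nonneg_left hμi (by have := hr0 0; positivity)
        _ = η := div_mul_cancel₀ _ (by have := hr0 0; positivity)
    linarith
  have hdet : WtGe r (∑ k, max 0 (ε / 2 - (ν k : ℝ) / r 0))
      (translate ξ (inFst m V * inRest m U)) := by
    rw [← hUV, AlgHom.map_det]
    exact WtGe.det hκ
  have hge := hdet _ hcoeff
  have hsum : ∑ k, max 0 (ε / 2 - (ν k : ℝ) / r 0) =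
      ∑ k ∈ Finset.range n, max 0 (ε / 2 - (k : ℝ) / r 0) := by
    have hbij : Function.Bijective fun k : Fin n => (⟨ν k, hν k⟩ : Fin n) :=
      Finite.injective_iff_bijective.mp fun x y hxy => hνi (by simpa using hxy)
    rw [← Fin.sum_univ_eq_sum_range (fun k => max 0 (ε / 2 - (k : ℝ) / r 0))]
    exact hbij.sum_comp fun k : Fin n => max 0 (ε / 2 - ((k : ℕ) : ℝ) / r 0)
  rw [hsum, Fin.sum_univ_succ] at hge
  simp only [Finsupp.cons_zero, Finsupp.cons_succ] at hge
  have hlow := sum_max_ge (θ := ε / 2) (by positivity) (by linarith) (hr 0)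
    (n := n) (by have := hr 0; omega)
  simp only [Fin.sum_univ_one] at haw
  have hsc : ∀ x s : ℝ, x / ((n : ℝ) * s) = x / s / n := fun x s => by
    rw [div_div, mul_comm]
  push_cast at haw hbw
  simp only [hsc, ← Finset.sum_div] at haw hbw
  rw [div_le_iff₀ (by linarith)] at haw hbw
  have : 0 < ε ^ 2 * n := by positivity
  nlinarith

theorem rothLemma [CharZero K] (p : Places K) (m : ℕ) : RothLemma p (m + 1) := by
  induction m with
  | zero => exact rothLemma_one p
  | succ m ih => exact rothLemma_succ ih

end Roth

namespace Roth

open Filter NumberField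

/-- The places of a number field, an infinite place occurring as often as its multiplicity. -/
noncomputable def nfPlaces (K : Type) [Field K] [NumberField K] : Places K where
  V := (Σ w : InfinitePlace K, Fin w.mult) ⊕ FinitePlace K
  abv := Sum.elim (fun w => w.1.1) fun w => w.1
  arch := Finset.univ.map Function.Embedding.inl
  nonarch := by
    rintro (w | w) hw
    · exact absurd (by simp) hw
    · intro x y
      exact FinitePlace.add_le w x y
  prod_eq_one := by
    classical
    intro x hx
    have hfin : (Function.mulSupport fun w : FinitePlace K => w x).Finite :=
      FinitePlace.hasFiniteMulSupport hx
    filter_upwards [eventually_ge_atTop ((Finset.univ.map Function.Embedding.inl) ∪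
      hfin.toFinset.map Function.Embedding.inr)] with T hT
    rw [← prod_abs_eq_one hx, finprod_eq_prod _ hfin]
    have h1 : ∏ w : InfinitePlace K, w x ^ w.mult =
        ∏ v ∈ (Finset.univ : Finset (Σ w : InfinitePlace K, Fin w.mult)).map
          (Function.Embedding.inl (β := FinitePlace K)),
          (Sum.elim (fun w => w.1.1) (fun w => w.1) v : AbsoluteValue K ℝ) x := by
      rw [Finset.prod_map]
      simp only [Function.Embedding.inl_apply, Sum.elim_inl]
      rw [Fintype.prod_sigma]
      refine Finset.prod_congr rfl fun w _ => ?_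
      simp only [Finset.prod_const, Finset.card_univ, Fintype.card_fin]
      rfl
    have h2 : ∏ w ∈ hfin.toFinset, w x = ∏ v ∈ hfin.toFinset.map
          (Function.Embedding.inr (α := Σ w : InfinitePlace K, Fin w.mult)),
          (Sum.elim (fun w => w.1.1) (fun w => w.1) v : AbsoluteValue K ℝ) x := by
      rw [Finset.prod_map]
      rfl
    rw [h1, h2, ← Finset.prod_union]
    · refine (Finset.prod_subset hT ?_).symm
      rintro (w | w) _ hw
      · exact absurd (by simp) hw
      · by_contra h
        exact hw (Finset.mem_union_right _ (Finset.mem_map.mpr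
          ⟨w, hfin.mem_toFinset.mpr h, rfl⟩))
    · rw [Finset.disjoint_left]
      intro v hv hv'
      simp only [Finset.mem_map] at hv hv'
      obtain ⟨a, -, rfl⟩ := hv
      obtain ⟨b, -, h⟩ := hv'
      simp at h

theorem siegel (K : Type) [Field K] [NumberField K] {E : Type*} [Finite E] (β : E → K) :
    ∃ C : ℝ, 1 ≤ C ∧ ∀ n : ℕ, 1 ≤ n → ∀ (I J : Type) [Fintype I] [Fintype J],
      Fintype.card I ≤ 2 ^ n →
      0 < Fintype.card I → 2 * Fintype.card J ≤ Fintype.card I → ∀ (a : J → I → ℕ) (t : J → E)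
      (k : J → I → ℕ), (∀ j i, a j i ≤ 2 ^ n) → (∀ j i, k j i ≤ n) →
      ∃ x : I → 𝓞 K, x ≠ 0 ∧ (∀ j, ∑ i, (a j i : K) * β (t j) ^ k j i * (x i : K) = 0) ∧
        ∀ i, house (x i : K) ≤ C ^ n := by
  classical
  obtain ⟨b, hb⟩ := IsLocalization.exist_integer_multiples_of_finite (nonZeroDivisors (𝓞 K)) β
  choose γ hγ using hb
  have hb0 : ((b : 𝓞 K) : K) ≠ 0 := by
    have := nonZeroDivisors.ne_zero b.2
    exact_mod_cast this
  have hγ' : ∀ e, ((γ e : 𝓞 K) : K) = (b : 𝓞 K) * β e := fun e => by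
    rw [← Algebra.smul_def]; exact hγ e
  obtain ⟨B, hB1, hBb, hBγ⟩ : ∃ B : ℝ, 1 ≤ B ∧ house ((b : 𝓞 K) : K) ≤ B ∧
      ∀ e, house ((γ e : 𝓞 K) : K) ≤ B := by
    cases nonempty_fintype E
    refine ⟨1 + house ((b : 𝓞 K) : K) + ∑ e, house ((γ e : 𝓞 K) : K), ?_, ?_, fun e => ?_⟩
    · have := house_nonneg ((b : 𝓞 K) : K)
      have := Finset.sum_nonneg fun e (_ : e ∈ Finset.univ) => house_nonneg ((γ e : 𝓞 K) : K)
      linarith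
    · have := Finset.sum_nonneg fun e (_ : e ∈ Finset.univ) => house_nonneg ((γ e : 𝓞 K) : K)
      linarith
    · have h1 := house_nonneg ((b : 𝓞 K) : K)
      have h2 := Finset.single_le_sum (f := fun e => house ((γ e : 𝓞 K) : K))
        (fun e _ => house_nonneg _) (Finset.mem_univ e)
      linarith
  obtain ⟨c, hc⟩ : ∃ c : ℝ, ∀ (I J : Type) [Fintype I] [Fintype J] [DecidableEq I] [DecidableEq J]
      (M : Matrix J I (𝓞 K)) (_ : M ≠ 0) (p q : ℕ) (_ : 0 < p) (_ : p < q)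
      (_ : Fintype.card J = p) (A : ℝ) (_ : 0 ≤ A)
      (_ : ∀ k l, house (algebraMap (𝓞 K) K (M k l)) ≤ A) (_ : Fintype.card I = q),
      ∃ ξ : I → 𝓞 K, ξ ≠ 0 ∧ M.mulVec ξ = 0 ∧
        ∀ l, house (ξ l).1 ≤ c * ((c * q * A) ^ ((p : ℝ) / (q - p))) := by
    exact ⟨_, fun I J _ _ _ _ M hM p q h0p hpq hJ A hA hMA hI =>
      house.exists_ne_zero_int_vec_house_le K M hM h0p hpq hI hMA hJ⟩
  set c' := max 1 |c| with hc'
  have hc1 : 1 ≤ c' := le_max_left _ _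
  refine ⟨4 * B * c' ^ 2, ?_, ?_⟩
  · nlinarith [one_le_pow₀ hc1 (n := 2)]
  intro n hn I J _ _ hI2 hI0 hJI a t k ha hk
  let M : Matrix J I (𝓞 K) := fun j i => a j i * b ^ (n - k j i) * γ (t j) ^ k j i
  have hM : ∀ j i, ((M j i : 𝓞 K) : K) =
      ((b : 𝓞 K) : K) ^ n * (a j i * β (t j) ^ k j i) := by
    intro j i
    have h1 : ((M j i : 𝓞 K) : K) = (a j i : K) * ((b : 𝓞 K) : K) ^ (n - k j i) *
        ((γ (t j) : 𝓞 K) : K) ^ k j i := by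
      simp only [M]; push_cast; rfl
    rw [h1, hγ', mul_pow, ← Nat.sub_add_cancel (hk j i), pow_add, Nat.add_sub_cancel]
    ring
  have hone : (1 : ℝ) ≤ 4 * B * c' ^ 2 := by nlinarith [one_le_pow₀ hc1 (n := 2)]
  by_cases hM0 : M = 0
  · have hI : Nonempty I := Fintype.card_pos_iff.mp hI0
    refine ⟨fun _ => 1, fun h => one_ne_zero (congrFun h hI.some), fun j => ?_, fun i => ?_⟩
    · refine Finset.sum_eq_zero fun i _ => ?_
      have h1 : M j i = 0 := by rw [hM0]; rfl
      have h2 := hM j i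
      rw [h1] at h2
      have h3 : (a j i * β (t j) ^ k j i : K) = 0 := by
        have h4 := h2.symm
        simp only [map_zero] at h4
        exact (mul_eq_zero.mp h4).resolve_left (pow_ne_zero _ hb0)
      rw [h3, zero_mul]
    · have : house ((1 : 𝓞 K) : K) = 1 := by
        simp [house]
      rw [this]
      exact one_le_pow₀ hone
  · have hJ0 : 0 < Fintype.card J := by
      rw [Fintype.card_pos_iff]
      by_contra h
      rw [not_nonempty_iff] at h
      exact hM0 (Matrix.ext fun j _ => h.elim j)
    have hMA : ∀ j i, house (algebraMap (𝓞 K) K (M j i)) ≤ (2 * B) ^ n := by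
      intro j i
      have h1 : algebraMap (𝓞 K) K (M j i) =
          (a j i : K) * (((b : 𝓞 K) : K) ^ (n - k j i) * ((γ (t j) : 𝓞 K) : K) ^ k j i) := by
        simp only [M]; push_cast; ring
      rw [h1, house_nat_mul]
      calc (a j i : ℝ) * house (((b : 𝓞 K) : K) ^ (n - k j i) * ((γ (t j) : 𝓞 K) : K) ^ k j i)
          ≤ 2 ^ n * (B ^ (n - k j i) * B ^ k j i) := by
            refine mul_le_mul (by exact_mod_cast ha j i) ?_ (house_nonneg _) (by positivity)
            refine (house_mul_le _ _).trans (mul_le_mul ?_ ?_ (house_nonneg _) (by positivity))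
            · exact (house_pow_le _ _).trans (pow_le_pow_left₀ (house_nonneg _) hBb _)
            · exact (house_pow_le _ _).trans (pow_le_pow_left₀ (house_nonneg _) (hBγ _) _)
        _ = (2 * B) ^ n := by
            rw [← pow_add, Nat.sub_add_cancel (hk j i), mul_pow]
    obtain ⟨x, hx0, hx, hxb⟩ := hc I J M hM0 _ _ hJ0 (by omega) rfl ((2 * B) ^ n) (by positivity)
      hMA rfl
    refine ⟨x, hx0, fun j => ?_, fun i => ?_⟩
    · have h1 := congrFun hx j
      simp only [Matrix.mulVec, dotProduct, Pi.zero_apply] at h1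
      have h2 := congrArg (algebraMap (𝓞 K) K) h1
      rw [map_sum, map_zero] at h2
      simp only [map_mul (algebraMap (𝓞 K) K), hM] at h2
      have h3 : ((b : 𝓞 K) : K) ^ n *
          ∑ i, (a j i : K) * β (t j) ^ k j i * (x i : K) = 0 := by
        rw [Finset.mul_sum, ← h2]
        exact Finset.sum_congr rfl fun i _ => by ring
      exact (mul_eq_zero.mp h3).resolve_left (pow_ne_zero _ hb0)
    · refine (hxb i).trans ?_
      set q := Fintype.card I
      set r := Fintype.card J
      have hqr : (0 : ℝ) < q - r := by
        have : (r : ℝ) < q := by exact_mod_cast (by omega : r < q)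
        linarith
      have he0 : 0 ≤ (r : ℝ) / (q - r) := by positivity
      have he1 : (r : ℝ) / (q - r) ≤ 1 := by
        rw [div_le_one hqr]
        have : (2 * r : ℝ) ≤ q := by exact_mod_cast hJI
        linarith
      have hX : |c * q * (2 * B) ^ n| ≤ c' * (4 * B) ^ n := by
        rw [abs_mul, abs_mul, abs_of_nonneg (by positivity : (0 : ℝ) ≤ (2 * B) ^ n),
          abs_of_nonneg (Nat.cast_nonneg (α := ℝ) q)]
        have h1 : (q : ℝ) ≤ 2 ^ n := by exact_mod_cast hI2
        calc |c| * q * (2 * B) ^ n ≤ c' * 2 ^ n * (2 * B) ^ n := by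
              gcongr
              exact le_max_right _ _
          _ = c' * (4 * B) ^ n := by rw [mul_assoc, ← mul_pow]; ring
      have hY1 : 1 ≤ c' * (4 * B) ^ n := by
        have : 1 ≤ (4 * B) ^ n := one_le_pow₀ (by linarith)
        nlinarith
      calc c * (c * q * (2 * B) ^ n) ^ ((r : ℝ) / (q - r))
          ≤ |c| * |(c * q * (2 * B) ^ n) ^ ((r : ℝ) / (q - r))| := by
            rw [← abs_mul]; exact le_abs_self _
        _ ≤ c' * (c' * (4 * B) ^ n) := by
            refine mul_le_mul (le_max_right _ _) ?_ (abs_nonneg _) (by positivity)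
            refine (Real.abs_rpow_le_abs_rpow _ _).trans ?_
            refine (Real.rpow_le_rpow (abs_nonneg _) hX he0).trans ?_
            exact (Real.rpow_le_rpow_of_exponent_le hY1 he1).trans (by rw [Real.rpow_one])
        _ = c' ^ 2 * (4 * B) ^ n := by ring
        _ ≤ (c' ^ 2) ^ n * (4 * B) ^ n := by
            gcongr
            exact le_self_pow₀ (one_le_pow₀ hc1) (by omega)
        _ = (4 * B * c' ^ 2) ^ n := by rw [← mul_pow]; ring

/-- A second-moment bound for the number of lattice points of small weight in a box. -/
theorem card_small_weight_le {m : ℕ} (r : Fin m → ℕ) (hr : ∀ j, 1 ≤ r j) (hm : 0 < m) :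
    (m : ℝ) * (Finset.univ.filter fun α : (j : Fin m) → Fin (r j + 1) =>
      ∑ j, ((α j : ℕ) : ℝ) / r j < m * (9 / 20)).card ≤
      100 * Fintype.card ((j : Fin m) → Fin (r j + 1)) := by
  classical
  set I := (j : Fin m) → Fin (r j + 1)
  let u : Fin m → I → ℝ := fun j α => ((α j : ℕ) : ℝ) / r j - 1 / 2
  have hr' : ∀ j, (0 : ℝ) < r j := fun j => by exact_mod_cast hr j
  have hcross : ∀ j k, j ≠ k → ∑ α, u j α * u k α = 0 := by
    intro j k hjk
    let σ : I → I := fun α => Function.update α j (Fin.rev (α j))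
    have hσ : Function.Involutive σ := fun α => by
      simp [σ]
    have h1 : ∑ α, u j α * u k α = ∑ α, -(u j α * u k α) := by
      refine Fintype.sum_bijective σ hσ.bijective _ _ fun α => ?_
      have hk : u k (σ α) = u k α := by simp [u, σ, Function.update_of_ne hjk.symm]
      have hj : u j (σ α) = -u j α := by
        simp only [u, σ, Function.update_self, Fin.val_rev]
        have : ((r j + 1 - ((α j : ℕ) + 1) : ℕ) : ℝ) = r j - (α j : ℕ) := by
          rw [Nat.add_sub_add_right, Nat.cast_sub (Nat.lt_succ_iff.mp (α j).2)]
        rw [this, sub_div, div_self (hr' j).ne']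
        ring
      rw [hk, hj]; ring
    rw [Finset.sum_neg_distrib] at h1
    linarith
  have hdiag : ∀ j α, u j α * u j α ≤ 1 / 4 := by
    intro j α
    have h1 : ((α j : ℕ) : ℝ) / r j ≤ 1 := by
      rw [div_le_one (hr' j)]
      exact_mod_cast Nat.lt_succ_iff.mp (α j).2
    have h2 : 0 ≤ ((α j : ℕ) : ℝ) / r j := by positivity
    simp only [u]
    nlinarith
  have htot : ∑ α, (∑ j, u j α) ^ 2 ≤ m / 4 * Fintype.card I := by
    calc ∑ α, (∑ j, u j α) ^ 2 = ∑ α, ∑ j, ∑ k, u j α * u k α := by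
          simp_rw [sq, Finset.sum_mul_sum]
      _ = ∑ j, ∑ k, ∑ α, u j α * u k α := by
          rw [Finset.sum_comm]
          exact Finset.sum_congr rfl fun j _ => Finset.sum_comm
      _ = ∑ j, ∑ α, u j α * u j α := by
          refine Finset.sum_congr rfl fun j _ => ?_
          exact Finset.sum_eq_single j (fun k _ hk => hcross j k hk.symm) (by simp)
      _ ≤ ∑ j : Fin m, ∑ α : I, (1 / 4 : ℝ) :=
          Finset.sum_le_sum fun j _ => Finset.sum_le_sum fun α _ => hdiag j α
      _ = m / 4 * Fintype.card I := by
          simp only [Finset.sum_const, Finset.card_univ, Fintype.card_fin, nsmul_eq_mul]; ring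
  set B := Finset.univ.filter fun α : I => ∑ j, ((α j : ℕ) : ℝ) / r j < m * (9 / 20)
  have hm' : (0 : ℝ) < m := by exact_mod_cast hm
  have hlow : (m : ℝ) ^ 2 / 400 * B.card ≤ ∑ α, (∑ j, u j α) ^ 2 := by
    calc (m : ℝ) ^ 2 / 400 * B.card = ∑ α ∈ B, (m : ℝ) ^ 2 / 400 := by
          rw [Finset.sum_const, nsmul_eq_mul, mul_comm]
      _ ≤ ∑ α ∈ B, (∑ j, u j α) ^ 2 := by
          refine Finset.sum_le_sum fun α hα => ?_
          have h1 := (Finset.mem_filter.mp hα).2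
          have h2 : ∑ j, u j α = ∑ j, ((α j : ℕ) : ℝ) / r j - m / 2 := by
            simp only [u, Finset.sum_sub_distrib]
            simp
            ring
          rw [h2]
          nlinarith
      _ ≤ _ := Finset.sum_le_sum_of_subset_of_nonneg (Finset.subset_univ _)
          fun _ _ _ => sq_nonneg _
  have := hlow.trans htot
  have h3 : (m : ℝ) * (m * B.card) ≤ m * (100 * Fintype.card I) := by nlinarith
  exact le_of_mul_le_mul_left h3 hm'

theorem pnrm_monomial_le {σ K : Type*} [Field K] {p : Places K} (v : p.V) (κ : σ →₀ ℕ) (c : K) :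
    p.pnrm v (monomial κ c) ≤ p.abv v c := by
  classical
  by_cases hv : v ∈ p.arch
  · rw [Places.pnrm_arch hv (s := {κ}) support_monomial_subset]
    simp
  · refine Places.pnrm_le_of_nonarch hv ((p.abv v).nonneg _) fun i => ?_
    rw [coeff_monomial]
    split_ifs
    · exact le_rfl
    · simp

theorem nfPlaces_abv_integer_le {K : Type} [Field K] [NumberField K] (v : (nfPlaces K).V) (x : 𝓞 K)
    {B : ℝ} (h : house (x : K) ≤ B) : (nfPlaces K).abv v (x : K) ≤ (nfPlaces K).cst v B := by
  classical
  unfold Places.cst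
  split_ifs with hv
  · obtain ⟨⟨w, i⟩, -, rfl⟩ := Finset.mem_map.mp hv
    refine le_trans ?_ h
    have : w (x : K) = ‖w.embedding (x : K)‖ := (InfinitePlace.norm_embedding_eq w _).symm
    change w (x : K) ≤ _
    rw [this]
    exact norm_embedding_le_house _ _
  · rcases v with w | w
    · exact absurd (Finset.mem_map.mpr ⟨w, Finset.mem_univ _, rfl⟩) hv
    · change w (x : K) ≤ 1
      rw [← FinitePlace.norm_embedding_eq]
      exact FinitePlace.norm_le_one K _ x

/-- The auxiliary polynomial of Roth's theorem. -/
theorem exists_aux_poly (K : Type) [Field K] [NumberField K] (E : Finset (nfPlaces K).V)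
    (β : (nfPlaces K).V → K) {m : ℕ} (hm : 0 < m) (hmE : 200 * E.card ≤ m) :
    ∃ C : ℝ, 0 ≤ C ∧ ∀ r : Fin m → ℕ, (∀ j, 1 ≤ r j) → ∀ ρ : ℝ, (∀ j, (r j : ℝ) ≤ ρ) →
      ∃ P : MvPolynomial (Fin m) K, P ≠ 0 ∧ (∀ j, degreeOf j P ≤ r j) ∧
        (∀ v, (nfPlaces K).pnrm v P ≤ (nfPlaces K).cst v (Real.exp (C * ρ))) ∧
        ∀ v ∈ E, ∀ α, coeff α (translate (fun _ => β v) P) ≠ 0 →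
          m * (9 / 20) ≤ ∑ j, (α j : ℝ) / r j := by
  classical
  obtain ⟨C, hC1, hC⟩ := siegel K (fun v : E => β v)
  refine ⟨m * Real.log (2 * C), mul_nonneg (Nat.cast_nonneg _) (Real.log_nonneg (by linarith)), ?_⟩
  intro r hr ρ hρ
  let I := (j : Fin m) → Fin (r j + 1)
  let κ : I → Fin m →₀ ℕ := fun i => Finsupp.equivFunOnFinite.symm fun j => (i j : ℕ)
  have hκ : ∀ i j, κ i j = (i j : ℕ) := fun i j => rfl
  have hκinj : Function.Injective κ := fun a b hab => by
    funext j
    exact Fin.ext (by rw [← hκ, ← hκ, hab])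
  let B := Finset.univ.filter fun α : I => ∑ j, ((α j : ℕ) : ℝ) / r j < m * (9 / 20)
  let J := {v // v ∈ E} × {α // α ∈ B}
  set n := ∑ j, r j with hn
  have hκr : ∀ i, κ i ≤ Finsupp.equivFunOnFinite.symm r := fun i j =>
    Nat.lt_succ_iff.mp (i j).2
  have hn1 : 1 ≤ n := (hr ⟨0, hm⟩).trans (Finset.single_le_sum (fun j _ => Nat.zero_le (r j))
    (Finset.mem_univ _))
  have hcardI : Fintype.card I ≤ 2 ^ n := by
    rw [Fintype.card_pi, hn, ← Finset.prod_pow_eq_pow_sum]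
    refine Finset.prod_le_prod' fun j _ => ?_
    rw [Fintype.card_fin]
    exact Nat.lt_two_pow_self
  have hI0 : 0 < Fintype.card I := Fintype.card_pos
  have hJ : 2 * Fintype.card J ≤ Fintype.card I := by
    have h1 := card_small_weight_le r hr hm
    change (m : ℝ) * B.card ≤ 100 * Fintype.card I at h1
    have h2 : m * B.card ≤ 100 * Fintype.card I := by exact_mod_cast h1
    rw [Fintype.card_prod, Fintype.card_coe, Fintype.card_coe]
    have h3 := Nat.mul_le_mul_right B.card hmE
    nlinarith
  obtain ⟨x, hx0, hx, hxb⟩ := hC n hn1 I J hcardI hI0 hJ (fun j i => binom (κ i) (κ j.2))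
    (fun j => j.1) (fun j i => ∑ l, (κ i - κ j.2) l)
    (fun j i => by simpa using binom_le (κ := κ j.2) (hκr i))
    (fun j i => Finset.sum_le_sum fun l _ => (Nat.sub_le _ _).trans (hκr i l))
  let P : MvPolynomial (Fin m) K := ∑ i, monomial (κ i) (x i : K)
  have hcoeff : ∀ i, coeff (κ i) P = x i := by
    intro i
    rw [coeff_sum, Finset.sum_eq_single i]
    · simp
    · intro b _ hb
      rw [coeff_monomial, if_neg fun h => hb (hκinj h)]
    · simp
  have heval : ∀ v α, coeff α (translate (fun _ => β v) P) =
      ∑ i, (binom (κ i) α : K) * β v ^ (∑ l, (κ i - α) l) * (x i : K) := by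
    intro v α
    rw [← eval_hasse, hasse_sum, map_sum]
    refine Finset.sum_congr rfl fun i _ => ?_
    rw [hasse_monomial, eval_monomial, Finsupp.prod_fintype _ _ (by simp),
      Finset.prod_pow_eq_pow_sum]
    ring
  refine ⟨P, ?_, ?_, ?_, ?_⟩
  · intro h
    apply hx0
    funext i
    have := hcoeff i
    rw [h, coeff_zero] at this
    exact_mod_cast this.symm
  · intro j
    rw [degreeOf_le_iff]
    intro μ hμ
    rw [mem_support_iff, coeff_sum] at hμ
    obtain ⟨i, -, hi⟩ := Finset.exists_ne_zero_of_sum_ne_zero hμ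
    rw [coeff_monomial] at hi
    split_ifs at hi with h
    · rw [← h]; exact hκr i j
    · exact absurd rfl hi
  · intro v
    have h1 : (nfPlaces K).pnrm v P ≤ (nfPlaces K).cst v (2 ^ n) * (nfPlaces K).cst v (C ^ n) :=
      Places.pnrm_sum_le v _ _ (Places.cst_nonneg v (by positivity))
        (fun i _ => (pnrm_monomial_le v _ _).trans (nfPlaces_abv_integer_le v _ (hxb i)))
        (by rw [Finset.card_univ]; exact_mod_cast hcardI)
    refine h1.trans ?_
    rw [← Places.cst_mul, ← mul_pow]
    apply Places.cst_mono
    have h2 : (n : ℝ) ≤ m * ρ := by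
      rw [hn]; push_cast
      exact (Finset.sum_le_card_nsmul _ _ ρ fun j _ => hρ j).trans (by simp)
    rw [← Real.exp_log (by linarith : 0 < 2 * C), ← Real.exp_nat_mul, Real.log_exp]
    apply Real.exp_le_exp.mpr
    have h3 : 0 ≤ Real.log (2 * C) := Real.log_nonneg (by linarith)
    nlinarith
  · intro v hv α hα
    by_contra! hlt
    apply hα
    by_cases hbox : ∀ j, α j ≤ r j
    · let i₀ : I := fun j => ⟨α j, Nat.lt_succ_of_le (hbox j)⟩
      have hi₀ : κ i₀ = α := Finsupp.ext fun j => rfl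
      have := hx (⟨v, hv⟩, ⟨i₀, Finset.mem_filter.mpr ⟨Finset.mem_univ _, hlt⟩⟩)
      simp only [hi₀] at this
      rw [heval]; exact this
    · rw [heval]
      refine Finset.sum_eq_zero fun i _ => ?_
      rw [binom_eq_zero fun hle => hbox fun j => (hle j).trans (hκr i j)]
      simp

section

variable {K : Type*} [Field K] {p : Places K}

theorem abv_eval_le {σ : Type*} [Fintype σ] (v : p.V) (Q : MvPolynomial σ K) (r : σ → ℕ)
    (hr : ∀ i, degreeOf i Q ≤ r i) (y : σ → K) :
    p.abv v (eval y Q) ≤ (∏ i, max 1 (p.abv v (y i)) ^ r i) * p.pnrm v Q := by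
  rw [eval_eq']
  have := Places.abv_sum_mul_le v (AddMonoidAlgebra.coeff Q) Q.support
    (fun κ => ∏ i, y i ^ κ i) (B := ∏ i, max 1 (p.abv v (y i)) ^ r i)
    (Finset.prod_nonneg fun i _ => by positivity) (fun κ hκ => by
      rw [map_prod]
      refine Finset.prod_le_prod (fun i _ => (p.abv v).nonneg _) fun i _ => ?_
      rw [map_pow]
      refine (pow_le_pow_left₀ ((p.abv v).nonneg _) (le_max_right 1 _) _).trans ?_
      exact pow_le_pow_right₀ (le_max_left _ _) (degreeOf_le_iff.mp (hr i) κ hκ))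
  refine le_trans (le_of_eq ?_) this
  congr 1
  refine Finset.sum_congr rfl fun κ _ => ?_
  rw [mul_comm]; rfl

theorem hasse_eq_zero {σ : Type*} [Fintype σ] {κ : σ →₀ ℕ} {Q : MvPolynomial σ K} {r : σ → ℕ}
    (hr : ∀ i, degreeOf i Q ≤ r i) {i : σ} (hi : r i < κ i) : hasse κ Q = 0 := by
  ext μ
  rw [coeff_hasse, coeff_zero]
  by_contra h
  have := degreeOf_le_iff.mp (hr i) _ (mem_support_iff.mpr (right_ne_zero_of_mul h))
  simp only [Finsupp.add_apply] at this
  omega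

theorem eval_translate {σ : Type*} (ξ y : σ → K) (P : MvPolynomial σ K) :
    eval y (translate ξ P) = eval (fun i => y i + ξ i) P := by
  have : (eval y).comp (translate ξ : MvPolynomial σ K →ₐ[K] _).toRingHom =
      eval fun i => y i + ξ i := by
    apply MvPolynomial.ringHom_ext
    · intro a; simp [translate]
    · intro i; simp [translate]
  exact RingHom.congr_fun this P

theorem abv_eval_le_of_vanishing {σ : Type*} [Fintype σ] (v : p.V) (Q : MvPolynomial σ K)
    (r : σ → ℕ) (hr : ∀ i, degreeOf i Q ≤ r i) (y : σ → K) (b : K) {B : ℝ} (hB0 : 0 ≤ B)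
    (hB : ∀ κ : σ →₀ ℕ, (∀ i, κ i ≤ r i) → coeff κ (translate (fun _ => b) Q) ≠ 0 →
      ∏ i, p.abv v (y i - b) ^ κ i ≤ B) :
    p.abv v (eval y Q) ≤ p.cst v (4 ^ ∑ i, r i) * max 1 (p.abv v b) ^ (∑ i, r i) *
      p.pnrm v Q * B := by
  classical
  set n := ∑ i, r i with hn
  have h0 : eval y Q = eval (fun i => y i - b) (translate (fun _ => b) Q) := by
    rw [eval_translate]; simp
  have hsupp : ∀ κ ∈ (translate (fun _ => b) Q).support, ∀ i, κ i ≤ r i := by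
    intro κ hκ i
    by_contra! h
    rw [mem_support_iff, ← eval_hasse, hasse_eq_zero hr h] at hκ
    simp at hκ
  have h1 : ∀ κ, p.abv v (coeff κ (translate (fun _ => b) Q)) ≤
      max 1 (p.abv v b) ^ n * (p.cst v (2 ^ n) * p.pnrm v Q) := by
    intro κ
    rw [← eval_hasse]
    refine (abv_eval_le v _ r (fun i => (degreeOf_hasse_le κ Q i).trans (hr i)) _).trans ?_
    rw [Finset.prod_pow_eq_pow_sum]
    exact mul_le_mul_of_nonneg_left
      (pnrm_hasse_le v κ (Finsupp.equivFunOnFinite.symm r) Q hr) (by positivity)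
  rw [h0, eval_eq', show (4 : ℝ) = 2 * 2 by norm_num, mul_pow, Places.cst_mul]
  have hc : 0 ≤ p.cst v (2 ^ n) := Places.cst_nonneg v (by positivity)
  have hp := Places.pnrm_nonneg v Q
  refine (Places.abv_sum_le v _ _
    (B := max 1 (p.abv v b) ^ n * (p.cst v (2 ^ n) * p.pnrm v Q) * B) (by positivity) ?_
    (c := 2 ^ n) ?_).trans (le_of_eq (by ring))
  · intro κ hκ
    rw [map_mul, map_prod]
    simp only [map_pow]
    exact mul_le_mul (h1 κ) (hB κ (hsupp κ hκ) (mem_support_iff.mp hκ))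
      (Finset.prod_nonneg fun i _ => by positivity) (by positivity)
  · have : (translate (fun _ => b) Q).support ⊆
        Finset.Iic (Finsupp.equivFunOnFinite.symm r) := fun κ hκ =>
      Finset.mem_Iic.mpr fun i => hsupp κ hκ i
    have h2 := Finset.card_le_card this
    have h3 : (Finset.Iic (Finsupp.equivFunOnFinite.symm r)).card ≤ 2 ^ n := by
      rw [Finsupp.card_Iic, hn, ← Finset.prod_pow_eq_pow_sum]
      refine (Finset.prod_le_prod' fun i _ => ?_).trans
        (Finset.prod_le_prod_of_subset_of_one_le' (Finset.subset_univ _)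
          fun i _ _ => Nat.one_le_two_pow)
      rw [Nat.card_Iic]
      exact Nat.lt_two_pow_self
    exact_mod_cast h2.trans h3

/-- The height of an element is finite. -/
theorem prod_max_one_le (p : Places K) (b : K) : ∃ B : ℝ, 1 ≤ B ∧
    ∀ᶠ T : Finset p.V in atTop, ∏ v ∈ T, max 1 (p.abv v b) ≤ B := by
  classical
  by_cases hb : b = 0
  · exact ⟨1, le_rfl, Eventually.of_forall fun T => by simp [hb]⟩
  obtain ⟨T₀, hT₀⟩ := eventually_atTop.mp (p.prod_eq_one b hb)
  have h1 : ∀ v ∉ T₀, p.abv v b = 1 := by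
    intro v hv
    have h2 := hT₀ (insert v T₀) (Finset.subset_insert _ _)
    rwa [Finset.prod_insert hv, hT₀ T₀ le_rfl, mul_one] at h2
  refine ⟨∏ v ∈ T₀, max 1 (p.abv v b), Finset.one_le_prod fun v _ => le_max_left _ _, ?_⟩
  filter_upwards [eventually_ge_atTop T₀] with T hT
  rw [Finset.prod_subset hT fun v _ hv => by rw [h1 v hv, max_self]]

/-- Liouville's inequality. -/
theorem liouville (p : Places K) (b : K) : ∃ B : ℝ, 1 ≤ B ∧ ∀ v y, y ≠ b →
    ∀ᶠ T : Finset p.V in atTop, 1 ≤ B * p.abv v (y - b) * ∏ w ∈ T, max 1 (p.abv w y) := by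
  classical
  obtain ⟨B, hB1, hB⟩ := prod_max_one_le p b
  refine ⟨2 ^ p.arch.card * B, one_le_mul_of_one_le_of_one_le (one_le_pow₀ (by norm_num)) hB1, ?_⟩
  intro v y hy
  filter_upwards [hB, p.prod_eq_one _ (sub_ne_zero.mpr hy), eventually_ge_atTop p.arch,
    eventually_ge_atTop {v}] with T hTB hT hTa hTv
  have hv : v ∈ T := hTv (Finset.mem_singleton_self v)
  have h1 : ∀ w, p.abv w (y - b) ≤
      p.cst w 2 * (max 1 (p.abv w y) * max 1 (p.abv w b)) := by
    intro w
    have hm1 : p.abv w y ≤ max 1 (p.abv w y) * max 1 (p.abv w b) :=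
      (le_max_right _ _).trans (le_mul_of_one_le_right (by positivity) (le_max_left _ _))
    have hm2 : p.abv w b ≤ max 1 (p.abv w y) * max 1 (p.abv w b) :=
      (le_max_right _ _).trans (le_mul_of_one_le_left (by positivity) (le_max_left _ _))
    unfold Places.cst
    split_ifs with hw
    · have := (p.abv w).sub_le_add y b
      linarith
    · rw [one_mul, sub_eq_add_neg]
      refine (p.nonarch w hw _ _).trans (max_le hm1 ?_)
      rwa [(p.abv w).map_neg]
  have h2 : ∀ w, 1 ≤ p.cst w 2 * (max 1 (p.abv w y) * max 1 (p.abv w b)) := fun w =>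
    one_le_mul_of_one_le_of_one_le (Places.one_le_cst w (by norm_num))
      (one_le_mul_of_one_le_of_one_le (le_max_left _ _) (le_max_left _ _))
  refine hT.symm.le.trans ?_
  rw [← Finset.mul_prod_erase _ _ hv]
  have h3 : ∏ w ∈ T.erase v, p.abv w (y - b) ≤
      ∏ w ∈ T, (p.cst w 2 * (max 1 (p.abv w y) * max 1 (p.abv w b))) := by
    refine (Finset.prod_le_prod (fun w _ => (p.abv w).nonneg _) fun w _ => h1 w).trans ?_
    rw [← Finset.mul_prod_erase T _ hv]
    exact le_mul_of_one_le_left (Finset.prod_nonneg fun w _ => zero_le_one.trans (h2 w)) (h2 v)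
  rw [Finset.prod_mul_distrib, Finset.prod_mul_distrib, Places.prod_cst _ hTa] at h3
  have h4 : 0 ≤ ∏ w ∈ T, max 1 (p.abv w y) := Finset.prod_nonneg fun w _ => by positivity
  calc _ ≤ p.abv v (y - b) * (2 ^ p.arch.card * ((∏ w ∈ T, max 1 (p.abv w y)) * B)) := by
        gcongr
        refine h3.trans ?_
        gcongr
    _ = _ := by ring

end

theorem product_estimate {K : Type*} [Field K] {p : Places K} {m : ℕ} (Q : MvPolynomial (Fin m) K)
    (r : Fin m → ℕ) (hr : ∀ i, degreeOf i Q ≤ r i) {A b : ℝ} (hA : ∀ v, p.pnrm v Q ≤ p.cst v (Real.exp A))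
    (y : Fin m → K) (hq : eval y Q ≠ 0) (E : Finset p.V) (β : p.V → K)
    (hb : ∀ v ∈ E, max 1 (p.abv v (β v)) ≤ Real.exp b) (B : p.V → ℝ)
    (hB : ∀ v ∈ E, ∀ κ : Fin m →₀ ℕ, (∀ i, κ i ≤ r i) →
      coeff κ (translate (fun _ => β v) Q) ≠ 0 →
      ∏ i, p.abv v (y i - β v) ^ κ i ≤ Real.exp (B v)) (Y : Fin m → ℝ)
    (hY : ∀ i, ∀ᶠ T : Finset p.V in atTop, ∏ v ∈ T, max 1 (p.abv v (y i)) ≤ Real.exp (Y i)) :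
    0 ≤ p.arch.card * ((∑ i, r i : ℕ) * Real.log 4 + A) + E.card * ((∑ i, r i : ℕ) * b) +
      ∑ v ∈ E, B v + ∑ i, r i * Y i := by
  classical
  set n := ∑ i, r i with hn
  obtain ⟨T, hT1, hTa, hTE, hTY⟩ := ((p.prod_eq_one _ hq).and ((eventually_ge_atTop p.arch).and
    ((eventually_ge_atTop E).and (eventually_all.mpr hY)))).exists
  have h4 : (4 : ℝ) ^ n = Real.exp (n * Real.log 4) := by
    rw [Real.exp_nat_mul, Real.exp_log (by norm_num)]
  set W : p.V → ℝ := fun v => ∏ i, max 1 (p.abv v (y i)) ^ r i with hW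
  have hW1 : ∀ v, 1 ≤ W v := fun v =>
    Finset.one_le_prod fun i _ => one_le_pow₀ (le_max_left _ _)
  have hexp0 : ∀ v x, 0 ≤ p.cst v (Real.exp x) := fun v x => Places.cst_nonneg v (Real.exp_pos _).le
  have h1 : ∀ v, p.abv v (eval y Q) ≤ p.cst v (Real.exp (n * Real.log 4 + A)) *
      (if v ∈ E then Real.exp (n * b + B v) else W v) := by
    intro v
    rw [Real.exp_add, Places.cst_mul]
    split_ifs with hv
    · refine (abv_eval_le_of_vanishing v Q r hr y (β v) (Real.exp_pos _).le (hB v hv)).trans ?_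
      rw [← hn, h4, Real.exp_add, Real.exp_nat_mul b n]
      have h5 := pow_le_pow_left₀ (by positivity) (hb v hv) n
      have h6 := hA v
      have h7 := Places.pnrm_nonneg v Q
      have h8 := hexp0 v (n * Real.log 4)
      have h9 := hexp0 v A
      calc _ ≤ p.cst v (Real.exp (n * Real.log 4)) * Real.exp b ^ n * p.cst v (Real.exp A) *
            Real.exp (B v) := by gcongr
        _ = _ := by ring
    · refine (abv_eval_le v Q r hr y).trans ?_
      have h8 : 1 ≤ p.cst v (Real.exp (n * Real.log 4)) := Places.one_le_cst v
        (Real.one_le_exp (mul_nonneg (Nat.cast_nonneg _) (Real.log_nonneg (by norm_num))))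
      have h9 := hexp0 v A
      have h10 := hW1 v
      calc _ ≤ W v * p.cst v (Real.exp A) := by gcongr; exact hA v
        _ ≤ p.cst v (Real.exp (n * Real.log 4)) * (W v * p.cst v (Real.exp A)) :=
          le_mul_of_one_le_left (by positivity) h8
        _ = _ := by ring
  have h2 : 1 ≤ ∏ v ∈ T, (p.cst v (Real.exp (n * Real.log 4 + A)) *
      (if v ∈ E then Real.exp (n * b + B v) else W v)) := by
    rw [← hT1]
    exact Finset.prod_le_prod (fun v _ => (p.abv v).nonneg _) fun v _ => h1 v
  rw [Finset.prod_mul_distrib, Places.prod_cst _ hTa] at h2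
  have h3 : ∏ v ∈ T, (if v ∈ E then Real.exp (n * b + B v) else W v) ≤
      (∏ v ∈ E, Real.exp (n * b + B v)) * ∏ v ∈ T, W v := by
    rw [← Finset.prod_sdiff hTE, ← Finset.prod_sdiff (f := W) hTE, mul_comm]
    have e1 : ∏ v ∈ E, (if v ∈ E then Real.exp (n * b + B v) else W v) =
        ∏ v ∈ E, Real.exp (n * b + B v) := Finset.prod_congr rfl fun v hv => if_pos hv
    have e2 : ∏ v ∈ T \ E, (if v ∈ E then Real.exp (n * b + B v) else W v) =
        ∏ v ∈ T \ E, W v :=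
      Finset.prod_congr rfl fun v hv => if_neg (Finset.mem_sdiff.mp hv).2
    rw [e1, e2]
    refine mul_le_mul_of_nonneg_left ?_ (Finset.prod_nonneg fun v _ => (Real.exp_pos _).le)
    exact le_mul_of_one_le_right (Finset.prod_nonneg fun v _ => zero_le_one.trans (hW1 v))
      (Finset.one_le_prod fun v _ => hW1 v)
  have h5 : ∏ v ∈ T, W v ≤ Real.exp (∑ i, r i * Y i) := by
    rw [hW, Finset.prod_comm, Real.exp_sum]
    refine Finset.prod_le_prod (fun i _ => Finset.prod_nonneg fun v _ => by positivity) fun i _ => ?_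
    rw [Finset.prod_pow, Real.exp_nat_mul]
    exact pow_le_pow_left₀ (Finset.prod_nonneg fun v _ => by positivity) (hTY i) _
  have h6 : 1 ≤ Real.exp (p.arch.card * (n * Real.log 4 + A) + (E.card * (n * b) +
      ∑ v ∈ E, B v) + ∑ i, r i * Y i) := by
    have e3 : (∏ v ∈ E, Real.exp (n * b + B v)) = Real.exp (E.card * (n * b) + ∑ v ∈ E, B v) := by
      rw [← Real.exp_sum, Finset.sum_add_distrib, Finset.sum_const, nsmul_eq_mul]
    rw [e3] at h3
    rw [Real.exp_add, Real.exp_add, Real.exp_nat_mul _ p.arch.card, mul_assoc]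
    refine h2.trans (mul_le_mul_of_nonneg_left (h3.trans ?_) (by positivity))
    exact mul_le_mul_of_nonneg_left h5 (Real.exp_pos _).le
  have := Real.one_le_exp_iff.mp h6
  linarith

theorem exists_lacunary {D : ℕ → ℝ} (hD : Tendsto D atTop atTop) (A M : ℝ) (m : ℕ) :
    ∃ k : Fin m → ℕ, (∀ i, M ≤ D (k i)) ∧ ∀ i j, i < j → A * D (k j) ≤ D (k i) := by
  have hex : ∀ x : ℝ, ∃ n, x ≤ D n := fun x => (hD.eventually_ge_atTop x).exists
  choose g hg using hex
  let k : ℕ → ℕ := fun s => Nat.rec (g (max M 0)) (fun _ n => g (max 1 A * D n)) s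
  have hk0 : max M 0 ≤ D (k 0) := hg _
  have hks : ∀ s, max 1 A * D (k s) ≤ D (k (s + 1)) := fun s => hg _
  have hpos : ∀ s, max M 0 ≤ D (k s) := by
    intro s
    induction s with
    | zero => exact hk0
    | succ s ih =>
      have h0 : 0 ≤ D (k s) := (le_max_right _ _).trans ih
      refine ih.trans ((le_mul_of_one_le_left h0 (le_max_left _ _)).trans (hks s))
  have hmono : ∀ s t, s < t → max 1 A * D (k s) ≤ D (k t) := by
    intro s t hst
    induction t, hst using Nat.le_induction with
    | base => exact hks s
    | succ t _ ih =>
      have h0 : 0 ≤ D (k t) := (le_max_right _ _).trans (hpos t)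
      exact ih.trans ((le_mul_of_one_le_left h0 (le_max_left _ _)).trans (hks t))
  refine ⟨fun i => k (m - 1 - i), fun i => (le_max_left _ _).trans (hpos _), fun i j hij => ?_⟩
  have h0 : 0 ≤ D (k (m - 1 - j)) := (le_max_right _ _).trans (hpos _)
  refine le_trans (mul_le_mul_of_nonneg_right (le_max_right 1 A) h0) (hmono _ _ ?_)
  have := j.2
  have : (i : ℕ) < j := hij
  omega

theorem hasse_comm_coeff {σ K : Type*} [Fintype σ] [Field K] (b : K) (α κ : σ →₀ ℕ)
    (P : MvPolynomial σ K)
    (h : coeff κ (translate (fun _ => b) (hasse α P)) ≠ 0) :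
    coeff (κ + α) (translate (fun _ => b) P) ≠ 0 := by
  rw [← hasse_translate, coeff_hasse] at h
  exact right_ne_zero_of_mul h

set_option maxHeartbeats 2000000 in
theorem roth_aux (K : Type) [Field K] [NumberField K] (p : Places K) (hp : p = nfPlaces K) (y : ℕ → K) (D : ℕ → ℝ)
    (hD : Tendsto D atTop atTop) (E : Finset p.V) (β : p.V → K)
    (lam : p.V → ℝ) (hlam : ∀ v ∈ E, 0 ≤ lam v) (hpos : 0 < ∑ v ∈ E, lam v) (c : ℝ) (hc0 : 0 ≤ c)
    (hclose : ∀ n, ∀ v ∈ E, p.abv v (y n - β v) ≤ Real.exp (c - 3 * lam v * D n))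
    (hheight : ∀ n, ∀ᶠ T : Finset p.V in atTop,
      ∏ v ∈ T, max 1 (p.abv v (y n)) ≤ Real.exp (c + (∑ v ∈ E, lam v) * D n))
    (hne : ∀ n, ∀ v ∈ E, y n ≠ β v) : False := by
  classical
  have haux := @exists_aux_poly K _ _
  rw [← hp] at haux
  set L := ∑ v ∈ E, lam v with hL
  obtain ⟨v₀, hv₀E, hv₀⟩ : ∃ v ∈ E, 0 < lam v := by
    by_contra! h
    exact absurd hpos (not_lt.mpr (Finset.sum_nonpos h))
  set ka := lam v₀ with hka
  -- lower bound for the heights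
  obtain ⟨B, hB1, hB⟩ := liouville p (β v₀)
  have hlow : ∀ n, ∀ᶠ T : Finset p.V in atTop,
      Real.exp (3 * ka * D n - c - Real.log B) ≤ ∏ w ∈ T, max 1 (p.abv w (y n)) := by
    intro n
    filter_upwards [hB v₀ (y n) (hne n v₀ hv₀E)] with T hT
    have hP : 0 ≤ ∏ w ∈ T, max 1 (p.abv w (y n)) := Finset.prod_nonneg fun v _ => by positivity
    have h1 : 1 ≤ Real.exp (Real.log B + (c - 3 * ka * D n)) * ∏ w ∈ T, max 1 (p.abv w (y n)) := by
      rw [Real.exp_add, Real.exp_log (by linarith)]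
      refine hT.trans ?_
      gcongr
      exact hclose n v₀ hv₀E
    have h2 := Real.exp_pos (Real.log B + (c - 3 * ka * D n))
    rw [show 3 * ka * D n - c - Real.log B = -(Real.log B + (c - 3 * ka * D n)) by ring,
      Real.exp_neg, inv_le_iff_one_le_mul₀ h2, mul_comm]
    exact h1
  set M := 200 * E.card with hM
  set m := M + 1 with hm
  have hmR : (1 : ℝ) ≤ m := by rw [hm]; push_cast; linarith [(Nat.cast_nonneg M : (0 : ℝ) ≤ M)]
  obtain ⟨C, hC0, hC⟩ := haux E β (m := m) (by omega) (by omega)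
  obtain ⟨η, hη0, hη⟩ := rothLemma p M (m / 20) (by positivity)
  obtain ⟨b, hb0, hb⟩ : ∃ b : ℝ, 0 ≤ b ∧ ∀ v ∈ E, max 1 (p.abv v (β v)) ≤ Real.exp b := by
    refine ⟨Real.log (1 + ∑ v ∈ E, max 1 (p.abv v (β v))), Real.log_nonneg ?_, fun v hv => ?_⟩
    · have := Finset.sum_nonneg fun v (_ : v ∈ E) =>
        (zero_le_one.trans (le_max_left 1 (p.abv v (β v))))
      linarith
    · have h0 := Finset.sum_nonneg fun v (_ : v ∈ E) =>
        (zero_le_one.trans (le_max_left 1 (p.abv v (β v))))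
      have := Finset.single_le_sum (f := fun v => max 1 (p.abv v (β v)))
        (fun v _ => (zero_le_one.trans (le_max_left 1 (p.abv v (β v))))) hv
      rw [Real.exp_log (by linarith)]
      linarith
  set a : ℝ := ((p.arch.card : ℕ) : ℝ) with ha
  have ha0 : 0 ≤ a := Nat.cast_nonneg _
  have hl2 : 0 < Real.log 2 := Real.log_pos (by norm_num)
  have hl4 : 0 < Real.log 4 := Real.log_pos (by norm_num)
  have hlB : 0 ≤ Real.log B := Real.log_nonneg hB1
  -- the constant absorbing the error terms
  obtain ⟨C₁, hC₁⟩ : ∃ C₁ : ℝ, C₁ = a * (m * Real.log 4 + (m * Real.log 2 + C)) +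
    E.card * (m * b) + E.card * (m * c) + m * c := ⟨_, rfl⟩
  have hC₁0 : 0 ≤ C₁ := by rw [hC₁]; positivity
  obtain ⟨Dmin, hDmin⟩ : ∃ Dmin : ℝ, Dmin = 1 + (c + Real.log B) / ka +
    2 * (a * C + 1) / (η * ka) + 20 * (C₁ + 1) / L := ⟨_, rfl⟩
  have hDm1 : 1 ≤ Dmin ∧ (c + Real.log B) / ka ≤ Dmin ∧ 2 * (a * C + 1) / (η * ka) ≤ Dmin ∧
      20 * (C₁ + 1) / L ≤ Dmin := by
    have h1 : 0 ≤ (c + Real.log B) / ka := by positivity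
    have h2 : 0 ≤ 2 * (a * C + 1) / (η * ka) := by positivity
    have h3 : 0 ≤ 20 * (C₁ + 1) / L := by positivity
    refine ⟨?_, ?_, ?_, ?_⟩ <;> rw [hDmin] <;> linarith
  obtain ⟨hD1, hD2, hD3, hD4⟩ := hDm1
  obtain ⟨k, hkM, hkA⟩ := exists_lacunary hD (11 / 10 / η) Dmin m
  have hDpos : ∀ i, 1 ≤ D (k i) := fun i => hD1.trans (hkM i)
  obtain ⟨R, hR⟩ : ∃ R : ℝ, R = 10 * ∑ i, D (k i) := ⟨_, rfl⟩
  have hRD : ∀ i, 10 * D (k i) ≤ R := by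
    intro i
    rw [hR]
    have := Finset.single_le_sum (f := fun i => D (k i))
      (fun i _ => zero_le_one.trans (hDpos i)) (Finset.mem_univ i)
    linarith
  have hR0 : 10 ≤ R := by
    have := hRD 0
    have := hDpos 0
    linarith
  set r : Fin m → ℕ := fun i => ⌈R / D (k i)⌉₊ with hr
  have hr1 : ∀ i, R ≤ r i * D (k i) := by
    intro i
    have h0 := hDpos i
    rw [← div_le_iff₀ (by linarith)]
    exact Nat.le_ceil _
  have hr2 : ∀ i, r i * D (k i) ≤ 11 / 10 * R := by
    intro i
    have h0 := hDpos i
    have h1 : (r i : ℝ) < R / D (k i) + 1 := Nat.ceil_lt_add_one (by positivity)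
    have h2 : (r i : ℝ) * D (k i) ≤ (R / D (k i) + 1) * D (k i) := by gcongr
    rw [add_mul, div_mul_cancel₀ _ (by linarith)] at h2
    linarith [hRD i]
  have hrpos : ∀ i, 1 ≤ r i := by
    intro i
    by_contra! h
    have h0 : r i = 0 := by omega
    have := hr1 i
    rw [h0] at this
    simp at this
    linarith
  have hrpos' : ∀ i, (0 : ℝ) < r i := fun i => by exact_mod_cast hrpos i
  obtain ⟨i₁, -, hi₁⟩ := Finset.exists_max_image Finset.univ (fun i => (r i : ℝ)) ⟨0, Finset.mem_univ _⟩
  obtain ⟨ρ, hρ⟩ : ∃ ρ : ℝ, ρ = r i₁ := ⟨_, rfl⟩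
  have hρr : ∀ i, (r i : ℝ) ≤ ρ := fun i => hρ ▸ hi₁ i (Finset.mem_univ i)
  have hρ1 : 1 ≤ ρ := by rw [hρ]; exact_mod_cast hrpos i₁
  have hρD : ρ * Dmin ≤ 11 / 10 * R := by
    rw [hρ]
    exact le_trans (by gcongr; exact hkM i₁) (hr2 i₁)
  obtain ⟨P, hP0, hPdeg, hPn, hPE⟩ := hC r hrpos ρ hρr
  have hPH : ∀ᶠ T : Finset p.V in atTop, ∏ v ∈ T, p.pnrm v P ≤ Real.exp (a * C * ρ + ρ) := by
    filter_upwards [eventually_ge_atTop p.arch] with T hT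
    refine (Finset.prod_le_prod (fun v _ => Places.pnrm_nonneg v P) fun v _ => hPn v).trans ?_
    rw [Places.prod_cst _ hT, ← Real.exp_nat_mul]
    exact Real.exp_le_exp.mpr (by rw [ha]; nlinarith)
  have hx1 : ∀ i j, i < j → (r i : ℝ) ≤ η * r j := by
    intro i j hij
    have h1 := hkA i j hij
    have h2 := hr2 i
    have h3 := hr1 j
    have h4 := hDpos i
    have h5 := hDpos j
    rw [div_mul_eq_mul_div, div_le_iff₀ hη0] at h1
    have h6 : (r i : ℝ) * (11 / 10 * D (k j)) ≤ (r i : ℝ) * (D (k i) * η) := by gcongr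
    have h7 : (r i : ℝ) * D (k i) * η ≤ 11 / 10 * R * η := by gcongr
    have h8 : R * η ≤ r j * D (k j) * η := by gcongr
    have h9 : (r i : ℝ) * D (k j) ≤ η * r j * D (k j) := by linarith
    exact le_of_mul_le_mul_right h9 (by linarith)
  have hx2 : ∀ i, ∀ᶠ T : Finset p.V in atTop,
      Real.exp (2 * ka * D (k i)) ≤ ∏ v ∈ T, max 1 (p.abv v (y (k i))) := by
    intro i
    filter_upwards [hlow (k i)] with T hT
    refine le_trans (Real.exp_le_exp.mpr ?_) hT
    have h1 := hD2.trans (hkM i)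
    rw [div_le_iff₀ hv₀] at h1
    linarith
  have hx3 : ∀ i, a * C * ρ + ρ ≤ η * (r i * (2 * ka * D (k i))) := by
    intro i
    have h1 := hr1 i
    rw [div_le_iff₀ (by positivity)] at hD3
    have h2 : η * (2 * ka * R) ≤ η * (r i * (2 * ka * D (k i))) := by
      have : 2 * ka * R ≤ r i * (2 * ka * D (k i)) := by nlinarith
      gcongr
    refine le_trans ?_ h2
    have h3 : ρ * (2 * (a * C + 1)) ≤ ρ * (Dmin * (η * ka)) := by gcongr
    have h4 : ρ * Dmin * (η * ka) ≤ 11 / 10 * R * (η * ka) := by gcongr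
    have h5 : 0 ≤ R * (η * ka) := by positivity
    linarith
  obtain ⟨α, hα, hαs⟩ := hη r hrpos hx1 ρ (a * C * ρ + ρ) hρr
    (by have : 0 ≤ a * C * ρ := by positivity
        linarith) P hP0 hPdeg hPH (fun i => y (k i)) (fun i => 2 * ka * D (k i)) hx2 hx3
  set n := ∑ i, r i with hn
  have hnρ : (n : ℝ) ≤ m * ρ := by
    rw [hn]; push_cast
    exact (Finset.sum_le_card_nsmul _ _ ρ fun j _ => hρr j).trans (by simp)
  have hest := product_estimate (p := p) (hasse α P) r
    (fun i => (degreeOf_hasse_le α P i).trans (hPdeg i))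
    (A := n * Real.log 2 + C * ρ) (b := b) (fun v => by
      refine (pnrm_hasse_le v α (Finsupp.equivFunOnFinite.symm r) P hPdeg).trans ?_
      rw [Real.exp_add, Places.cst_mul, Real.exp_nat_mul, Real.exp_log (by norm_num)]
      exact mul_le_mul_of_nonneg_left (hPn v) (Places.cst_nonneg v (by positivity)))
    (fun i => y (k i)) (by rw [eval_hasse]; exact hα) E β hb
    (fun v => n * c - 3 * lam v * (2 / 5 * m * R)) (fun v hv κ hκ hne0 => by
      have h1 := hPE v hv _ (hasse_comm_coeff _ _ _ _ hne0)
      simp only [Finsupp.add_apply, Nat.cast_add, add_div, Finset.sum_add_distrib] at h1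
      have h2 : 2 / 5 * (m : ℝ) ≤ ∑ i, (κ i : ℝ) / r i := by linarith
      have h3 : 2 / 5 * m * R ≤ ∑ i, (κ i : ℝ) * D (k i) := by
        refine (mul_le_mul_of_nonneg_right h2 (by linarith)).trans ?_
        rw [Finset.sum_mul]
        refine Finset.sum_le_sum fun i _ => ?_
        rw [div_mul_eq_mul_div, div_le_iff₀ (hrpos' i), mul_assoc]
        have := hr1 i
        have h0 : (0 : ℝ) ≤ κ i := Nat.cast_nonneg _
        nlinarith
      calc ∏ i, p.abv v (y (k i) - β v) ^ κ i
          ≤ ∏ i, Real.exp (c - 3 * lam v * D (k i)) ^ κ i := by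
            refine Finset.prod_le_prod (fun i _ => pow_nonneg ((p.abv v).nonneg _) _) fun i _ => ?_
            exact pow_le_pow_left₀ ((p.abv v).nonneg _) (hclose (k i) v hv) _
        _ = Real.exp (∑ i, (κ i : ℝ) * (c - 3 * lam v * D (k i))) := by
            rw [Real.exp_sum]
            exact Finset.prod_congr rfl fun i _ => (Real.exp_nat_mul _ _).symm
        _ ≤ _ := by
            apply Real.exp_le_exp.mpr
            have h4 : ∑ i, (κ i : ℝ) * (c - 3 * lam v * D (k i)) =
                (∑ i, (κ i : ℝ)) * c - 3 * lam v * ∑ i, (κ i : ℝ) * D (k i) := by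
              rw [Finset.sum_mul, Finset.mul_sum, ← Finset.sum_sub_distrib]
              exact Finset.sum_congr rfl fun i _ => by ring
            rw [h4]
            have h5 : ∑ i, (κ i : ℝ) ≤ n := by
              rw [hn]; push_cast
              exact Finset.sum_le_sum fun i _ => by exact_mod_cast hκ i
            have h6 := hlam v hv
            have h7 := mul_le_mul_of_nonneg_right h5 hc0
            have h8 := mul_le_mul_of_nonneg_left h3 h6
            linarith)
    (fun i => c + L * D (k i)) (fun i => hheight (k i))
  rw [← hn] at hest
  have hs1 : ∑ v ∈ E, ((n : ℝ) * c - 3 * lam v * (2 / 5 * m * R)) =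
      E.card * (n * c) - 6 / 5 * m * R * L := by
    rw [Finset.sum_sub_distrib, Finset.sum_const, nsmul_eq_mul, hL, Finset.mul_sum]
    congr 1
    exact Finset.sum_congr rfl fun v _ => by ring
  have hs2 : ∑ i, (r i : ℝ) * (c + L * D (k i)) ≤ n * c + L * (m * (11 / 10 * R)) := by
    have e1 : ∑ i, (r i : ℝ) * (c + L * D (k i)) =
        (∑ i, (r i : ℝ)) * c + L * ∑ i, (r i : ℝ) * D (k i) := by
      rw [Finset.sum_mul, Finset.mul_sum, ← Finset.sum_add_distrib]
      exact Finset.sum_congr rfl fun i _ => by ring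
    have e2 : ∑ i, (r i : ℝ) * D (k i) ≤ m * (11 / 10 * R) :=
      (Finset.sum_le_card_nsmul _ _ _ fun j _ => hr2 j).trans (by simp)
    rw [e1]
    have e3 : ∑ i, (r i : ℝ) = n := by rw [hn]; push_cast; rfl
    rw [e3]
    have := mul_le_mul_of_nonneg_left e2 hpos.le
    linarith
  rw [hs1] at hest
  have hA1 : a * (n * Real.log 4 + (n * Real.log 2 + C * ρ)) ≤
      a * (m * Real.log 4 + (m * Real.log 2 + C)) * ρ := by
    have : n * Real.log 4 + (n * Real.log 2 + C * ρ) ≤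
      (m * Real.log 4 + (m * Real.log 2 + C)) * ρ := by nlinarith
    rw [mul_assoc]
    gcongr
  have hA2 : E.card * ((n : ℝ) * b) ≤ E.card * (m * b) * ρ := by
    rw [mul_assoc]
    refine mul_le_mul_of_nonneg_left ?_ (Nat.cast_nonneg _)
    nlinarith
  have hA3 : E.card * ((n : ℝ) * c) ≤ E.card * (m * c) * ρ := by
    rw [mul_assoc]
    refine mul_le_mul_of_nonneg_left ?_ (Nat.cast_nonneg _)
    nlinarith
  have hA4 : (n : ℝ) * c ≤ m * c * ρ := by nlinarith
  clear hC hη hPE hclose hheight haux hB hlow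
  have hfin : m * R * L / 10 ≤ C₁ * ρ := by
    rw [hC₁]
    have hest' : 0 ≤ a * (n * Real.log 4 + (n * Real.log 2 + C * ρ)) + E.card * (n * b) +
      (E.card * (n * c) - 6 / 5 * m * R * L) + ∑ i, (r i : ℝ) * (c + L * D (k i)) := hest
    linarith
  rw [div_le_iff₀ hpos] at hD4
  have hfin2 : ρ * (20 * (C₁ + 1)) ≤ ρ * (Dmin * L) := by gcongr
  have hfin3 : ρ * Dmin * L ≤ 11 / 10 * R * L := by gcongr
  have hfin4 : R * L ≤ m * R * L := by
    rw [mul_assoc]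
    exact le_mul_of_one_le_left (by positivity) hmR
  have : 0 ≤ C₁ * ρ := by positivity
  linarith

/-- Roth's theorem over a number field, with several places and with targets of mixed weights. -/
theorem roth (K : Type) [Field K] [NumberField K] (y : ℕ → K) (D : ℕ → ℝ)
    (hD : Tendsto D atTop atTop) (E : Finset (nfPlaces K).V) (β : (nfPlaces K).V → K)
    (lam : (nfPlaces K).V → ℝ) (hlam : ∀ v ∈ E, 0 ≤ lam v) (hpos : 0 < ∑ v ∈ E, lam v) (c : ℝ)
    (hclose : ∀ n, ∀ v ∈ E, (nfPlaces K).abv v (y n - β v) ≤ Real.exp (c - 3 * lam v * D n))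
    (hheight : ∀ n, ∀ᶠ T : Finset (nfPlaces K).V in atTop,
      ∏ v ∈ T, max 1 ((nfPlaces K).abv v (y n)) ≤ Real.exp (c + (∑ v ∈ E, lam v) * D n))
    (hne : ∀ n, ∀ v ∈ E, y n ≠ β v) : False := by
  have h := le_max_left c 0
  refine roth_aux K _ rfl y D hD E β lam hlam hpos (max c 0) (le_max_right _ _)
    (fun n v hv => (hclose n v hv).trans ?_) (fun n => (hheight n).mono fun T hT => hT.trans ?_) hne
  · exact Real.exp_le_exp.mpr (by linarith)
  · exact Real.exp_le_exp.mpr (by linarith)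

end Roth

namespace Roth

open Filter Asymptotics Topology

/-- The leading parts of the coordinates satisfy an integrality relation along `S`. -/
def HasIntegrality {K : Type*} [Field K] {N : ℕ} (x : ℕ → Fin N → K) (S : Set ℕ) : Prop :=
  ∀ i j : Fin N, ∃ M : ℕ, ∃ h R : MvPolynomial (Fin N) K, h.totalDegree < M ∧ R.totalDegree < M ∧
    ∀ n ∈ S, x n j ^ M = x n i * eval (x n) h + eval (x n) R

/-- The homogenisation of `q` in degree `M` agrees along `S` with a polynomial of lower degree. -/
def HasRelation {K : Type*} [Field K] {N : ℕ} (x : ℕ → Fin N → K) (S : Set ℕ) (i i0 : Fin N)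
    (q : Polynomial K) (M : ℕ) : Prop :=
  q ≠ 0 ∧ q.natDegree ≤ M ∧ ∃ R : MvPolynomial (Fin N) K, R.totalDegree < M ∧
    ∀ n ∈ S, ∑ j ∈ Finset.range (M + 1), q.coeff j * x n i ^ j * x n i0 ^ (M - j) = eval (x n) R

section Local

variable {K : Type*} [NormedField K] {N : ℕ}

theorem norm_eval_le (g : MvPolynomial (Fin N) K) : ∃ C : ℝ, 0 ≤ C ∧ ∀ (D : ℕ),
    g.totalDegree ≤ D → ∀ (x : Fin N → K) (X : ℝ), 1 ≤ X → ‖x‖ ≤ X → ‖eval x g‖ ≤ C * X ^ D := by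
  refine ⟨∑ m ∈ g.support, ‖g.coeff m‖, Finset.sum_nonneg fun _ _ => norm_nonneg _, ?_⟩
  intro D hD x X hX hx
  rw [eval_eq', Finset.sum_mul]
  refine (norm_sum_le _ _).trans (Finset.sum_le_sum fun m hm => ?_)
  rw [norm_mul, norm_prod]
  refine mul_le_mul_of_nonneg_left ?_ (norm_nonneg _)
  calc ∏ i, ‖x i ^ m i‖ ≤ ∏ i, X ^ m i := by
        refine Finset.prod_le_prod (fun _ _ => norm_nonneg _) fun i _ => ?_
        rw [norm_pow]
        exact pow_le_pow_left₀ (norm_nonneg _) ((norm_le_pi_norm x i).trans hx) _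
    _ = X ^ (∑ i, m i) := Finset.prod_pow_eq_pow_sum _ _ _
    _ ≤ X ^ D := by
        refine pow_le_pow_right₀ hX (le_trans ?_ hD)
        have := le_totalDegree hm
        rwa [Finsupp.sum_fintype _ _ (fun _ => rfl)] at this

theorem norm_eval_gap_le {d : ℕ} (g : MvPolynomial (Fin N) K) (hg : g.totalDegree + 3 ≤ d ∨ g = 0) :
    ∃ C : ℝ, 0 ≤ C ∧ ∀ (x : Fin N → K) (X : ℝ), 1 ≤ X → ‖x‖ ≤ X →
      ‖eval x g‖ ≤ C * (X ^ d / X ^ 3) := by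
  rcases hg with hg | rfl
  · obtain ⟨C, hC, h⟩ := norm_eval_le g
    refine ⟨C, hC, fun x X hX hx => ?_⟩
    have := h (d - 3) (by omega) x X hX hx
    rwa [pow_sub₀ _ (by positivity) (by omega), ← div_eq_mul_inv] at this
  · refine ⟨0, le_rfl, fun x X hX hx => by simp⟩

theorem exists_growth_rate (u : ℕ → ℝ) {d n₀ : ℕ} (hd : 2 ≤ d) {c : ℝ}
    (hu : ∀ n, n₀ ≤ n → |u (n + 1) - d * u n| ≤ c) (h0 : c < u n₀) :
    ∃ lam : ℝ, 0 < lam ∧ ∀ n, n₀ ≤ n → |u n - lam * d ^ n| ≤ c := by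
  have hd' : (2 : ℝ) ≤ d := by exact_mod_cast hd
  have hc : 0 ≤ c := (abs_nonneg _).trans (hu n₀ le_rfl)
  have hpos : ∀ n : ℕ, (0 : ℝ) < (d : ℝ) ^ n := fun n => by positivity
  let f : ℕ → ℝ := fun n => (u (n₀ + n) - c) / (d : ℝ) ^ (n₀ + n)
  let g : ℕ → ℝ := fun n => (u (n₀ + n) + c) / (d : ℝ) ^ (n₀ + n)
  have hf : Monotone f := by
    refine monotone_nat_of_le_succ fun n => ?_
    have h := abs_le.mp (hu (n₀ + n) (by omega))
    simp only [f]
    rw [div_le_div_iff₀ (hpos _) (hpos _), ← add_assoc, pow_succ]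
    have := hpos (n₀ + n)
    have : (u (n₀ + n) - c) * d ≤ u (n₀ + n + 1) - c := by nlinarith [h.1]
    nlinarith
  have hg : Antitone g := by
    refine antitone_nat_of_succ_le fun n => ?_
    have h := abs_le.mp (hu (n₀ + n) (by omega))
    simp only [g]
    rw [div_le_div_iff₀ (hpos _) (hpos _), ← add_assoc, pow_succ]
    have := hpos (n₀ + n)
    have : u (n₀ + n + 1) + c ≤ (u (n₀ + n) + c) * d := by nlinarith [h.2]
    nlinarith
  have hfg : ∀ n, f n ≤ g n := fun n => by
    simp only [f, g]
    gcongr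
    linarith
  have hmem := hf.ciSup_mem_iInter_Icc_of_antitone hg hfg
  obtain ⟨lam, hlam⟩ : ∃ lam, lam = ⨆ n, f n := ⟨_, rfl⟩
  rw [← hlam, Set.mem_iInter] at hmem
  refine ⟨lam, ?_, fun n hn => ?_⟩
  · refine lt_of_lt_of_le ?_ (hmem 0).1
    exact div_pos (by simpa using h0) (hpos _)
  · obtain ⟨m, rfl⟩ := Nat.exists_eq_add_of_le hn
    have h := hmem m
    have h1 := h.1
    have h2 := h.2
    simp only [f, g] at h1 h2
    rw [div_le_iff₀ (hpos _)] at h1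
    rw [le_div_iff₀ (hpos _)] at h2
    rw [abs_le]
    constructor <;> linarith

variable {d : ℕ} {g : Fin N → MvPolynomial (Fin N) K} {x : ℕ → Fin N → K}

theorem exists_local_rate (hd : 2 ≤ d) (hg : ∀ i, (g i).totalDegree + 3 ≤ d ∨ g i = 0)
    (hx : ∀ n i, x (n + 1) i = x n i ^ d + eval (x n) (g i)) :
    ∃ lam : ℝ, 0 ≤ lam ∧ ∃ c : ℝ, ∀ n, |Real.log (max 1 ‖x n‖) - lam * d ^ n| ≤ c := by
  choose C hC0 hC using fun i => norm_eval_gap_le (g i) (hg i)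
  obtain ⟨B, hB⟩ : ∃ B, B = 1 + ∑ i, C i := ⟨_, rfl⟩
  have hCB : ∀ i, C i ≤ B := fun i => by
    have := Finset.single_le_sum (fun j _ => hC0 j) (Finset.mem_univ i)
    linarith
  have hB1 : 1 ≤ B := by
    have := Finset.sum_nonneg (fun i (_ : i ∈ Finset.univ) => hC0 i)
    linarith
  obtain ⟨s, hs⟩ : ∃ s : ℕ → ℝ, s = fun n => max 1 ‖x n‖ := ⟨_, rfl⟩
  have hs1 : ∀ n, 1 ≤ s n := fun n => by rw [hs]; exact le_max_left _ _
  have hxs : ∀ n, ‖x n‖ ≤ s n := fun n => by rw [hs]; exact le_max_right _ _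
  have hgs : ∀ n i, ‖eval (x n) (g i)‖ ≤ B * (s n ^ d / s n ^ 3) := fun n i =>
    (hC i (x n) (s n) (hs1 n) (hxs n)).trans (mul_le_mul_of_nonneg_right (hCB i)
      (by have := hs1 n; positivity))
  have hup : ∀ n, s (n + 1) ≤ 2 * B * s n ^ d := by
    intro n
    have h1 := hs1 n
    have hsd : 1 ≤ s n ^ d := one_le_pow₀ h1
    have : s (n + 1) = max 1 ‖x (n + 1)‖ := by rw [hs]
    rw [this]
    refine max_le (by nlinarith) ((pi_norm_le_iff_of_nonneg (by positivity)).mpr fun i => ?_)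
    rw [hx]
    refine (norm_add_le _ _).trans ?_
    have h2 : ‖x n i ^ d‖ ≤ s n ^ d := by
      rw [norm_pow]
      exact pow_le_pow_left₀ (norm_nonneg _) ((norm_le_pi_norm _ _).trans (hxs n)) _
    have h3 : s n ^ d / s n ^ 3 ≤ s n ^ d := div_le_self (by positivity) (one_le_pow₀ h1)
    have h4 := hgs n i
    nlinarith
  have hlow : ∀ n, 2 * B ≤ s n → s n ^ d ≤ 2 * s (n + 1) := by
    intro n hn
    have h1 := hs1 n
    have hne : ∃ i, ‖x n i‖ = s n := by
      have hxn : s n = ‖x n‖ := by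
        have : s n = max 1 ‖x n‖ := by rw [hs]
        rw [this]
        refine max_eq_right ?_
        by_contra hlt
        rw [max_eq_left (by linarith)] at this
        linarith
      rw [hxn]
      have : Nonempty (Fin N) := by
        by_contra hemp
        have : ‖x n‖ = 0 := by
          rw [not_nonempty_iff] at hemp
          rw [Subsingleton.elim (x n) 0, norm_zero]
        linarith
      obtain ⟨i, -, hi⟩ := Finset.exists_mem_eq_sup' (Finset.univ_nonempty (α := Fin N))
        (fun i => ‖x n i‖₊)
      refine ⟨i, ?_⟩
      rw [Pi.norm_def, ← Finset.sup'_eq_sup Finset.univ_nonempty, hi]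
      rfl
    obtain ⟨i, hi⟩ := hne
    have h2 : ‖x n i ^ d‖ ≤ ‖x (n + 1) i‖ + ‖eval (x n) (g i)‖ := by
      have : x n i ^ d = x (n + 1) i - eval (x n) (g i) := by rw [hx]; ring
      rw [this]
      exact norm_sub_le _ _
    rw [norm_pow, hi] at h2
    have h3 := hgs n i
    have h4 : B * (s n ^ d / s n ^ 3) ≤ s n ^ d / 2 := by
      rw [mul_div_assoc', div_le_div_iff₀ (by positivity) (by norm_num)]
      have : 2 * B ≤ s n ^ 3 := hn.trans (le_self_pow₀ h1 (by norm_num))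
      have h5 : 0 < s n ^ d := by positivity
      nlinarith
    have h5 := (norm_le_pi_norm (x (n + 1)) i).trans (hxs (n + 1))
    linarith
  have hlogs : ∀ n, Real.log (max 1 ‖x n‖) = Real.log (s n) := fun n => by rw [hs]
  simp only [hlogs]
  have hlog0 : ∀ n, 0 ≤ Real.log (s n) := fun n => Real.log_nonneg (hs1 n)
  obtain ⟨c, hc⟩ : ∃ c, c = Real.log (2 * B) := ⟨_, rfl⟩
  have hd' : (2 : ℝ) ≤ d := by exact_mod_cast hd
  by_cases hbdd : ∀ n, Real.log (s n) ≤ c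
  · exact ⟨0, le_rfl, c, fun n => by
      rw [zero_mul, sub_zero, abs_of_nonneg (hlog0 n)]; exact hbdd n⟩
  · push Not at hbdd
    obtain ⟨n₀, hn₀⟩ := hbdd
    have hstep : ∀ n, c < Real.log (s n) →
        |Real.log (s (n + 1)) - d * Real.log (s n)| ≤ c := by
      intro n hn
      have hsn := hs1 n
      have hsn' := hs1 (n + 1)
      have h2B : 2 * B ≤ s n := by
        rw [hc] at hn
        exact ((Real.log_lt_log_iff (by positivity) (by positivity)).mp hn).le
      have h1 := Real.log_le_log (by positivity) (hup n)
      have h2 := Real.log_le_log (by positivity) (hlow n h2B)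
      rw [Real.log_mul (by positivity) (by positivity), Real.log_pow, ← hc] at h1
      rw [Real.log_mul (by positivity) (by positivity), Real.log_pow] at h2
      have h3 : Real.log 2 ≤ c := by
        rw [hc]
        exact Real.log_le_log (by norm_num) (by linarith)
      rw [abs_le]
      constructor <;> linarith
    have hall : ∀ n, n₀ ≤ n → c < Real.log (s n) := by
      intro n hn
      induction n, hn using Nat.le_induction with
      | base => exact hn₀
      | succ n hn ih =>
        have := (abs_le.mp (hstep n ih)).1
        have := mul_le_mul_of_nonneg_right hd' (hlog0 n)
        linarith
    obtain ⟨lam, hlam, h⟩ := exists_growth_rate (fun n => Real.log (s n)) hd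
      (fun n hn => hstep n (hall n hn)) hn₀
    have hc0 : 0 ≤ c := (abs_nonneg _).trans (hstep n₀ hn₀)
    refine ⟨lam, hlam.le, c + ∑ n ∈ Finset.range n₀, |Real.log (s n) - lam * d ^ n|, fun n => ?_⟩
    rcases le_or_gt n₀ n with hn | hn
    · have := Finset.sum_nonneg
        (fun n (_ : n ∈ Finset.range n₀) => abs_nonneg (Real.log (s n) - lam * d ^ n))
      linarith [h n hn]
    · have := Finset.single_le_sum (f := fun n => |Real.log (s n) - lam * d ^ n|)
        (fun n _ => abs_nonneg _) (Finset.mem_range.mpr hn)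
      linarith

end Local

section Roots

variable {K : Type*} [NormedField K]

theorem pow_card_le_prod_norm (s : Multiset K) {y : K} {r : ℝ} (hr : 0 ≤ r)
    (h : ∀ b ∈ s, r ≤ ‖y - b‖) : r ^ Multiset.card s ≤ ‖(s.map fun b => y - b).prod‖ := by
  induction s using Multiset.induction with
  | empty => simp
  | cons a s ih =>
    rw [Multiset.card_cons, Multiset.map_cons, Multiset.prod_cons, norm_mul, pow_succ, mul_comm]
    exact mul_le_mul (h a (Multiset.mem_cons_self _ _))
      (ih fun b hb => h b (Multiset.mem_cons_of_mem hb)) (by positivity) (norm_nonneg _)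

theorem exists_root_near {q : Polynomial K} (hq : q.Splits) (hq0 : q ≠ 0) {M : ℕ}
    (hM : q.natDegree ≤ M) (C : ℝ) : ∃ C' T : ℝ, 0 < C' ∧ ∀ (y : K) (t : ℝ), 1 ≤ t → T ≤ t →
      ‖q.eval y‖ * t ^ (3 * M + 1) ≤ C → ∃ b ∈ q.roots, ‖y - b‖ * t ^ 3 ≤ C' := by
  have hlc : 0 < ‖q.leadingCoeff‖ := by simpa using hq0
  refine ⟨1 + |C| / ‖q.leadingCoeff‖, 1 + |C| / ‖q.leadingCoeff‖, by positivity, ?_⟩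
  intro y t ht hT hle
  obtain ⟨A, hA⟩ : ∃ A, A = 1 + |C| / ‖q.leadingCoeff‖ := ⟨_, rfl⟩
  rw [← hA] at hT ⊢
  have hA1 : 1 ≤ A := by rw [hA]; have : 0 ≤ |C| / ‖q.leadingCoeff‖ := by positivity
                         linarith
  have hAC : C < ‖q.leadingCoeff‖ * A := by
    rw [hA, mul_add, mul_div_cancel₀ _ hlc.ne']
    have := le_abs_self C
    linarith
  by_contra! hcon
  have h1 := pow_card_le_prod_norm q.roots (y := y) (r := A / t ^ 3) (by positivity)
    fun b hb => by
      rw [div_le_iff₀ (by positivity)]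
      exact (hcon b hb).le
  have hcard : Multiset.card q.roots = q.natDegree := hq.natDegree_eq_card_roots.symm
  rw [hcard] at h1
  have h2 : ‖q.leadingCoeff‖ * (A / t ^ 3) ^ q.natDegree ≤ ‖q.eval y‖ := by
    rw [hq.eval_eq_prod_roots, norm_mul]
    gcongr
  have h3 : A ^ q.natDegree * t ≤ (A / t ^ 3) ^ q.natDegree * t ^ (3 * M + 1) := by
    rw [div_pow, ← pow_mul, div_mul_eq_mul_div, le_div_iff₀ (by positivity), mul_assoc,
      ← pow_succ']
    gcongr
  have h4 : A ≤ A ^ q.natDegree * t := by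
    have : 1 ≤ A ^ q.natDegree := one_le_pow₀ hA1
    nlinarith
  have h5 := mul_le_mul_of_nonneg_right h2 (by positivity : 0 ≤ t ^ (3 * M + 1))
  have h6 := mul_le_mul_of_nonneg_left (h4.trans h3) hlc.le
  nlinarith

theorem exists_simple_root_near {q : Polynomial K} (hq : q.Splits) (hnd : q.roots.Nodup)
    (hpos : 0 < q.natDegree) :
    ∃ C : ℝ, 0 < C ∧ ∀ w : K, ∃ β ∈ q.roots, ‖w - β‖ ≤ C * ‖q.eval w‖ := by
  classical
  have hq0 : q ≠ 0 := by rintro rfl; simp at hpos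
  have hlc : 0 < ‖q.leadingCoeff‖ := by simpa using hq0
  have hδ : ∃ δ : ℝ, 0 < δ ∧ δ ≤ 1 ∧ ∀ a ∈ q.roots, ∀ b ∈ q.roots, a ≠ b → 2 * δ ≤ ‖a - b‖ := by
    have : ∀ᶠ δ : ℝ in 𝓝[>] 0, δ ≤ 1 ∧
        ∀ a ∈ q.roots.toFinset, ∀ b ∈ q.roots.toFinset, a ≠ b → 2 * δ ≤ ‖a - b‖ := by
      refine Filter.Eventually.and (eventually_nhdsWithin_of_eventually_nhds
        (eventually_le_nhds zero_lt_one)) ?_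
      refine (Filter.eventually_all_finset _).mpr fun a _ =>
        (Filter.eventually_all_finset _).mpr fun b _ => ?_
      by_cases hab : a = b
      · exact Eventually.of_forall fun _ h => absurd hab h
      · have h0 : 0 < ‖a - b‖ / 2 := by
          have := norm_pos_iff.mpr (sub_ne_zero.mpr hab)
          positivity
        filter_upwards [eventually_nhdsWithin_of_eventually_nhds (eventually_le_nhds h0)]
          with δ hδ _
        linarith
    obtain ⟨δ, ⟨h1, h2⟩, h3⟩ := (this.and self_mem_nhdsWithin).exists
    exact ⟨δ, h3, h1, fun a ha b hb => h2 a (Multiset.mem_toFinset.mpr ha) b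
      (Multiset.mem_toFinset.mpr hb)⟩
  obtain ⟨δ, hδ0, hδ1, hδ⟩ := hδ
  refine ⟨1 / (‖q.leadingCoeff‖ * δ ^ q.natDegree), by positivity, fun w => ?_⟩
  have hne : q.roots.toFinset.Nonempty := by
    rw [Finset.nonempty_iff_ne_empty, Ne, Multiset.toFinset_eq_empty, ← Multiset.card_eq_zero,
      ← hq.natDegree_eq_card_roots]
    exact hpos.ne'
  obtain ⟨β, hβ, hmin⟩ := Finset.exists_min_image _ (fun b => ‖w - b‖) hne
  have hβ' := Multiset.mem_toFinset.mp hβ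
  refine ⟨β, hβ', ?_⟩
  obtain ⟨s, hs⟩ := Multiset.exists_cons_of_mem hβ'
  have hsβ : β ∉ s := by
    rw [hs] at hnd
    exact (Multiset.nodup_cons.mp hnd).1
  have h1 := pow_card_le_prod_norm s (y := w) hδ0.le fun b hb => by
    have hb' : b ∈ q.roots := by rw [hs]; exact Multiset.mem_cons_of_mem hb
    have h2 := hmin b (Multiset.mem_toFinset.mpr hb')
    have h3 := hδ β hβ' b hb' (fun h => hsβ (h ▸ hb))
    have h4 : ‖β - b‖ ≤ ‖w - β‖ + ‖w - b‖ := by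
      have : β - b = (w - b) - (w - β) := by ring
      rw [this]
      exact (norm_sub_le _ _).trans (by rw [add_comm])
    linarith
  have hcard : Multiset.card s ≤ q.natDegree := by
    rw [hq.natDegree_eq_card_roots, hs, Multiset.card_cons]
    omega
  have h2 : δ ^ q.natDegree ≤ δ ^ Multiset.card s := pow_le_pow_of_le_one hδ0.le hδ1 hcard
  rw [hq.eval_eq_prod_roots, hs, Multiset.map_cons, Multiset.prod_cons, norm_mul, norm_mul,
    div_mul_eq_mul_div, one_mul, le_div_iff₀ (by positivity)]
  have h3 := mul_le_mul_of_nonneg_left (h2.trans h1)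
    (by positivity : 0 ≤ ‖w - β‖ * ‖q.leadingCoeff‖)
  linarith

end Roots

section Asymp

variable {K : Type*} [NormedField K] {l : Filter ℕ}

theorem isBigO_pow_sub_pow {a b : ℕ → K} {E h : ℕ → ℝ} (ha : a =O[l] E) (hb : b =O[l] E)
    (hab : (fun n => a n - b n) =O[l] (fun n => E n * h n)) (m : ℕ) :
    (fun n => a n ^ m - b n ^ m) =O[l] (fun n => E n ^ m * h n) := by
  induction m with
  | zero => simpa using isBigO_zero _ _
  | succ m ih =>
    have h1 : (fun n => a n * (a n ^ m - b n ^ m)) =O[l] fun n => E n ^ (m + 1) * h n := by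
      refine (ha.mul ih).congr_right fun n => by ring
    have h2 : (fun n => (a n - b n) * b n ^ m) =O[l] fun n => E n ^ (m + 1) * h n := by
      refine (hab.mul (hb.pow m)).congr_right fun n => by ring
    exact (h1.add h2).congr_left fun n => by ring

end Asymp

section LocalApprox

variable {K : Type*} [NormedField K] {N d : ℕ} {g : Fin N → MvPolynomial (Fin N) K}
  {x : ℕ → Fin N → K} {e : ℕ → ℝ} {B : ℝ}

theorem isBigO_coord (hB : ∀ n, ‖x n‖ ≤ B * e n) (j : Fin N) (l : Filter ℕ) :
    (fun n => x n j) =O[l] e :=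
  IsBigO.of_bound |B| (Eventually.of_forall fun n => by
    refine (norm_le_pi_norm _ _).trans ((hB n).trans ?_)
    rw [Real.norm_eq_abs, ← abs_mul]
    exact le_abs_self _)

theorem isBigO_eval (he1 : ∀ n, 1 ≤ e n) (hB1 : 1 ≤ B) (hB : ∀ n, ‖x n‖ ≤ B * e n)
    (R : MvPolynomial (Fin N) K) {D : ℕ} (hR : R.totalDegree ≤ D) (l : Filter ℕ) :
    (fun n => eval (x n) R) =O[l] (fun n => e n ^ D) := by
  obtain ⟨C, hC, h⟩ := norm_eval_le R
  refine IsBigO.of_bound (C * B ^ D) (Eventually.of_forall fun n => ?_)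
  have := he1 n
  refine (h D hR (x n) (B * e n) (by nlinarith) (hB n)).trans ?_
  rw [mul_pow, mul_assoc, Real.norm_of_nonneg (by positivity)]

theorem isBigO_step (hg : ∀ i, (g i).totalDegree + 3 ≤ d ∨ g i = 0)
    (hx : ∀ n i, x (n + 1) i = x n i ^ d + eval (x n) (g i)) (he1 : ∀ n, 1 ≤ e n) (hB1 : 1 ≤ B)
    (hB : ∀ n, ‖x n‖ ≤ B * e n) (i : Fin N) :
    (fun n => x (n + 1) i - x n i ^ d) =O[atTop] (fun n => e n ^ d * (e n ^ 3)⁻¹) := by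
  obtain ⟨C, hC, h⟩ := norm_eval_gap_le (g i) (hg i)
  refine IsBigO.of_bound (C * (B ^ d / B ^ 3)) (Eventually.of_forall fun n => ?_)
  have := he1 n
  rw [hx, add_sub_cancel_left]
  refine (h (x n) (B * e n) (by nlinarith) (hB n)).trans ?_
  rw [mul_pow, mul_pow, Real.norm_of_nonneg (by positivity)]
  refine le_of_eq ?_
  field_simp

theorem isBigO_iterate (hg : ∀ i, (g i).totalDegree + 3 ≤ d ∨ g i = 0)
    (hx : ∀ n i, x (n + 1) i = x n i ^ d + eval (x n) (g i)) (he1 : ∀ n, 1 ≤ e n) (hB1 : 1 ≤ B)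
    (hB : ∀ n, ‖x n‖ ≤ B * e n) (he : ∀ n k, e (n + k) = e n ^ d ^ k) (hd : 2 ≤ d)
    (i : Fin N) (k : ℕ) :
    (fun n => x (n + k) i - x n i ^ d ^ k) =O[atTop]
      (fun n => e n ^ d ^ k * (e n ^ 3)⁻¹) := by
  induction k with
  | zero => simpa using isBigO_zero _ _
  | succ k ih =>
    have h1 : (fun n => x (n + k + 1) i - x (n + k) i ^ d) =O[atTop]
        (fun n => e n ^ d ^ (k + 1) * (e n ^ 3)⁻¹) := by
      have h2 := (isBigO_step hg hx he1 hB1 hB i).comp_tendsto (tendsto_add_atTop_nat k)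
      refine h2.trans (IsBigO.of_bound 1 (Eventually.of_forall fun n => ?_))
      have h3 := he1 n
      have h4 := he1 (n + k)
      simp only [Function.comp]
      rw [Real.norm_of_nonneg (by positivity), Real.norm_of_nonneg (by positivity), one_mul]
      have h5 : e (n + k) ^ d = e n ^ d ^ (k + 1) := by rw [he, ← pow_mul, ← pow_succ]
      have h6 : e n ≤ e (n + k) := by
        rw [he]
        exact le_self_pow₀ h3 (by positivity)
      rw [h5]
      gcongr
    have h2 : (fun n => x (n + k) i ^ d - (x n i ^ d ^ k) ^ d) =O[atTop]
        (fun n => e n ^ d ^ (k + 1) * (e n ^ 3)⁻¹) := by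
      refine (isBigO_pow_sub_pow (E := fun n => e n ^ d ^ k) (h := fun n => (e n ^ 3)⁻¹)
        ?_ ?_ ih d).congr_right fun n => by rw [← pow_mul, ← pow_succ]
      · refine ((isBigO_coord hB i atTop).comp_tendsto (tendsto_add_atTop_nat k)).congr_right
          fun n => he n k
      · exact (isBigO_coord hB i atTop).pow _
    refine (h1.add h2).congr_left fun n => ?_
    rw [← pow_mul, ← pow_succ, add_assoc]
    ring

theorem isBigO_of_integrality (he1 : ∀ n, 1 ≤ e n) (hB1 : 1 ≤ B) (hB : ∀ n, ‖x n‖ ≤ B * e n)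
    (hB' : ∀ n, e n ≤ B * max 1 ‖x n‖) (het : Tendsto e atTop atTop) {S : Set ℕ}
    (hA : HasIntegrality x S) (i : Fin N) :
    e =O[atTop ⊓ 𝓟 S] (fun n => x n i) := by
  choose M h R hh hR hS using hA i
  choose C1 hC1 h1 using fun j => norm_eval_le (h j)
  choose C2 hC2 h2 using fun j => norm_eval_le (R j)
  obtain ⟨A, hA1, hA⟩ : ∃ A : ℝ, 0 ≤ A ∧ ∀ j, B ^ (M j) * (B ^ (M j - 1) * (C1 j + C2 j)) ≤ A := by
    have hnn : ∀ j ∈ Finset.univ, 0 ≤ B ^ (M j) * (B ^ (M j - 1) * (C1 j + C2 j)) := fun j _ => by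
      have := hC1 j
      have := hC2 j
      positivity
    exact ⟨∑ j, B ^ (M j) * (B ^ (M j - 1) * (C1 j + C2 j)), Finset.sum_nonneg hnn,
      fun j => Finset.single_le_sum hnn (Finset.mem_univ j)⟩
  have key : ∀ n ∈ S, B < e n → e n ≤ A * (1 + ‖x n i‖) := by
    intro n hn hlt
    have he := he1 n
    have hne : ∃ j, e n ≤ B * ‖x n j‖ := by
      by_contra! hcon
      have : max 1 ‖x n‖ * B < e n := by
        rcases le_total 1 ‖x n‖ with h | h
        · rw [max_eq_right h, ← lt_div_iff₀ (by positivity)]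
          refine (pi_norm_lt_iff (by positivity)).mpr fun j => ?_
          rw [lt_div_iff₀ (by positivity), mul_comm]
          exact hcon j
        · rw [max_eq_left h, one_mul]
          exact hlt
      linarith [hB' n, mul_comm B (max 1 ‖x n‖)]
    obtain ⟨j, hj⟩ := hne
    have hM : 1 ≤ M j := by have := hh j; omega
    have hBe : 1 ≤ B * e n := by nlinarith
    have h3 := h1 j (M j - 1) (by have := hh j; omega) (x n) (B * e n) hBe (hB n)
    have h4 := h2 j (M j - 1) (by have := hR j; omega) (x n) (B * e n) hBe (hB n)
    have h5 : ‖x n j‖ ^ M j ≤ ‖x n i‖ * ‖eval (x n) (h j)‖ + ‖eval (x n) (R j)‖ := by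
      rw [← norm_pow, hS j n hn, ← norm_mul]
      exact norm_add_le _ _
    have h6 : e n ^ M j ≤ B ^ M j * ‖x n j‖ ^ M j := by
      rw [← mul_pow]
      exact pow_le_pow_left₀ (by positivity) hj _
    have h7 : ‖x n j‖ ^ M j ≤ (C1 j + C2 j) * (1 + ‖x n i‖) * (B * e n) ^ (M j - 1) := by
      have := mul_le_mul_of_nonneg_left h3 (norm_nonneg (x n i))
      have hx0 := norm_nonneg (x n i)
      have hp : 0 ≤ (B * e n) ^ (M j - 1) := by positivity
      have a1 := mul_nonneg (hC1 j) hp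
      have a2 := mul_nonneg (mul_nonneg (hC2 j) hp) hx0
      nlinarith
    have h8 : e n ^ M j = e n * e n ^ (M j - 1) := by
      rw [← pow_succ']; congr 1; omega
    have h9 : e n * e n ^ (M j - 1) ≤
        (B ^ M j * (B ^ (M j - 1) * (C1 j + C2 j)) * (1 + ‖x n i‖)) * e n ^ (M j - 1) := by
      rw [← h8]
      refine h6.trans ((mul_le_mul_of_nonneg_left h7 (by positivity)).trans (le_of_eq ?_))
      rw [mul_pow]; ring
    have h10 := le_of_mul_le_mul_right h9 (by positivity)
    refine h10.trans (mul_le_mul_of_nonneg_right (hA j) (by positivity))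
  refine IsBigO.of_bound (2 * A) ?_
  have h1 : ∀ᶠ n in atTop ⊓ 𝓟 S, B < e n ∧ 2 * A < e n :=
    ((het.eventually_gt_atTop _).and (het.eventually_gt_atTop _)).filter_mono inf_le_left
  filter_upwards [h1, mem_inf_of_right (mem_principal_self S)] with n hn hnS
  have := key n hnS hn.1
  rw [Real.norm_of_nonneg (by linarith [he1 n])]
  linarith [hn.2]

theorem isBigO_eval_quotient (he1 : ∀ n, 1 ≤ e n) (hB1 : 1 ≤ B) (hB : ∀ n, ‖x n‖ ≤ B * e n)
    {S : Set ℕ} {i i0 : Fin N} {q : Polynomial K} {M : ℕ} (hq : HasRelation x S i i0 q M)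
    (h0 : e =O[atTop ⊓ 𝓟 S] (fun n => x n i0)) :
    (fun n => q.eval (x n i / x n i0)) =O[atTop ⊓ 𝓟 S] (fun n => (e n)⁻¹) := by
  obtain ⟨-, hM, R, hR, hS⟩ := hq
  have h1 := isBigO_eval he1 hB1 hB R (D := M - 1) (by omega) (atTop ⊓ 𝓟 S)
  have h2 : (fun n => (x n i0 ^ M)⁻¹) =O[atTop ⊓ 𝓟 S] (fun n => (e n ^ M)⁻¹) := by
    refine (h0.pow M).inv_rev (Eventually.of_forall fun n h => ?_)
    have := he1 n
    exact absurd h (by positivity)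
  have h3 := h1.mul h2
  have hne : ∀ᶠ n in atTop ⊓ 𝓟 S, x n i0 ≠ 0 := by
    filter_upwards [h0.eq_zero_imp] with n hn h
    have := he1 n
    linarith [hn h]
  refine IsBigO.congr' h3 ?_ ?_
  · filter_upwards [hne, mem_inf_of_right (mem_principal_self S)] with n hn hnS
    rw [← hS n hnS, ← div_eq_mul_inv, Finset.sum_div,
      Polynomial.eval_eq_sum_range' (Nat.lt_succ_of_le hM)]
    refine Finset.sum_congr rfl fun j hj => ?_
    have hj' : j ≤ M := Nat.lt_succ_iff.mp (Finset.mem_range.mp hj)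
    rw [div_pow, mul_div_assoc', div_eq_div_iff (by positivity) (by positivity)]
    rw [mul_assoc _ (x n i0 ^ (M - j)), ← pow_add, Nat.sub_add_cancel hj']
  · refine Eventually.of_forall fun n => ?_
    have := he1 n
    have hM1 : M = (M - 1) + 1 := by omega
    simp only
    nth_rw 2 [hM1]
    rw [pow_succ]
    field_simp

end LocalApprox

theorem exists_local_approx {K : Type*} [NormedField K] [CharZero K] {N d : ℕ}
    {g : Fin N → MvPolynomial (Fin N) K} {x : ℕ → Fin N → K} (hd : 2 ≤ d)
    (hg : ∀ i, (g i).totalDegree + 3 ≤ d ∨ g i = 0)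
    (hx : ∀ n i, x (n + 1) i = x n i ^ d + eval (x n) (g i))
    {lam c₀ : ℝ} (hlam : 0 < lam) (hrate : ∀ n, |Real.log (max 1 ‖x n‖) - lam * d ^ n| ≤ c₀)
    {S : Set ℕ} (hA : HasIntegrality x S) {i i0 : Fin N} {q : Polynomial K} {M : ℕ}
    (hrel : HasRelation x S i i0 q M) (hqs : q.Splits) {k : ℕ} (hk : 3 * M + 1 ≤ d ^ k)
    (hsplit : ∀ b ∈ q.roots, b ≠ 0 → (Polynomial.X ^ (d ^ k) - Polynomial.C b).Splits) :
    ∃ c : ℝ, ∀ᶠ n in atTop, n + k ∈ S → x n i0 ≠ 0 ∧ ∃ β, β ≠ 0 ∧ β ^ d ^ k ∈ q.roots ∧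
      ‖x n i / x n i0 - β‖ ≤ Real.exp (c - 3 * lam * d ^ n) := by
  obtain ⟨e, he_def⟩ : ∃ e : ℕ → ℝ, e = fun n => Real.exp (lam * d ^ n) := ⟨_, rfl⟩
  obtain ⟨B, hB_def⟩ : ∃ B : ℝ, B = Real.exp c₀ := ⟨_, rfl⟩
  have hc₀ : 0 ≤ c₀ := (abs_nonneg _).trans (hrate 0)
  have hB1 : 1 ≤ B := by rw [hB_def]; exact Real.one_le_exp hc₀
  have he1 : ∀ n, 1 ≤ e n := fun n => by rw [he_def]; exact Real.one_le_exp (by positivity)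
  have hsz : ∀ n, 0 < max 1 ‖x n‖ := fun n => lt_max_of_lt_left one_pos
  have hB : ∀ n, ‖x n‖ ≤ B * e n := fun n => by
    have h1 := (abs_le.mp (hrate n)).2
    have h2 : max 1 ‖x n‖ ≤ Real.exp (c₀ + lam * d ^ n) := by
      rw [← Real.log_le_iff_le_exp (hsz n)]; linarith
    rw [Real.exp_add, ← hB_def] at h2
    rw [he_def]
    exact (le_max_right _ _).trans h2
  have hB' : ∀ n, e n ≤ B * max 1 ‖x n‖ := fun n => by
    have h1 := (abs_le.mp (hrate n)).1
    rw [← Real.exp_log (hsz n), hB_def, ← Real.exp_add, he_def]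
    exact Real.exp_le_exp.mpr (by linarith)
  have he : ∀ n k, e (n + k) = e n ^ d ^ k := fun n k => by
    rw [he_def]
    simp only
    rw [← Real.exp_nat_mul]
    push_cast
    rw [pow_add]; ring_nf
  have het : Tendsto e atTop atTop := by
    rw [he_def]
    refine Real.tendsto_exp_atTop.comp (Tendsto.const_mul_atTop hlam ?_)
    exact tendsto_pow_atTop_atTop_of_one_lt (by exact_mod_cast (by omega : 1 < d))
  obtain ⟨l, hl⟩ : ∃ l, l = atTop ⊓ 𝓟 {n | n + k ∈ S} := ⟨_, rfl⟩
  have hlle : l ≤ atTop := hl ▸ inf_le_left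
  have htend : Tendsto (fun n => n + k) l (atTop ⊓ 𝓟 S) := by
    rw [hl]
    refine Tendsto.inf (tendsto_add_atTop_nat k) ?_
    exact tendsto_principal_principal.mpr fun n hn => hn
  have hQ : d ^ k ≠ 0 := by positivity
  have hlow : ∀ j, (fun n => e n ^ d ^ k) =O[l] (fun n => x (n + k) j) := fun j =>
    ((isBigO_of_integrality he1 hB1 hB hB' het hA j).comp_tendsto htend).congr_left
      fun n => he n k
  have hupk : ∀ j, (fun n => x (n + k) j) =O[l] (fun n => e n ^ d ^ k) := fun j =>
    ((isBigO_coord hB j (atTop ⊓ 𝓟 S)).comp_tendsto htend).congr_right fun n => he n k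
  have hdiff : ∀ j, (fun n => x (n + k) j - x n j ^ d ^ k) =O[l]
      (fun n => e n ^ d ^ k * (e n ^ 3)⁻¹) := fun j =>
    (isBigO_iterate hg hx he1 hB1 hB he hd j k).mono hlle
  have hsmall : Tendsto (fun n => (e n ^ 3)⁻¹) l (𝓝 0) :=
    (tendsto_inv_atTop_zero.comp ((tendsto_pow_atTop (by norm_num)).comp het)).mono_left hlle
  have hlow' : ∀ j, (fun n => e n ^ d ^ k) =O[l] (fun n => x n j ^ d ^ k) := fun j => by
    refine (hlow j).trans ?_
    have h1 : (fun n => e n ^ d ^ k * (e n ^ 3)⁻¹) =o[l] fun n => e n ^ d ^ k := by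
      have := (isBigO_refl (fun n => e n ^ d ^ k) l).mul_isLittleO
        ((isLittleO_one_iff ℝ).mpr hsmall)
      simpa using this
    have h2 := ((hdiff j).trans_isLittleO h1).trans_isBigO (hlow j)
    exact (h2.right_isBigO_sub).congr_right fun n => by ring
  have hne : ∀ j, ∀ᶠ n in l, x n j ≠ 0 ∧ x (n + k) j ≠ 0 := fun j => by
    filter_upwards [(hlow' j).eq_zero_imp, (hlow j).eq_zero_imp] with n hn hn'
    have := he1 n
    constructor
    · intro h
      have := hn (by rw [h, zero_pow hQ])
      exact absurd this (by positivity)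
    · intro h
      have := hn' h
      exact absurd this (by positivity)
  have hinv : ∀ {z : ℕ → K}, (fun n => e n ^ d ^ k) =O[l] z →
      (fun n => (z n)⁻¹) =O[l] (fun n => (e n ^ d ^ k)⁻¹) := fun h =>
    h.inv_rev (Eventually.of_forall fun n h => by
      have := he1 n
      exact absurd h (by positivity))
  have hratio : (fun n => x (n + k) i / x (n + k) i0 - (x n i / x n i0) ^ d ^ k) =O[l]
      (fun n => (e n ^ 3)⁻¹) := by
    have h1 := (hdiff i).mul (hinv (hlow i0))
    have h2 := ((isBigO_coord hB i l).pow (d ^ k)).mul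
      ((hdiff i0).mul ((hinv (hlow i0)).mul (hinv (hlow' i0))))
    have h1' : (fun n => (x (n + k) i - x n i ^ d ^ k) * (x (n + k) i0)⁻¹) =O[l]
        (fun n => (e n ^ 3)⁻¹) := h1.congr_right fun n => by
      have := he1 n
      field_simp
    have h2' := h2.congr_right (g₂ := fun n => (e n ^ 3)⁻¹) fun n => by
      have := he1 n
      field_simp
    refine (h1'.sub h2').congr' ?_ (EventuallyEq.refl _ _)
    filter_upwards [hne i0] with n hn
    have ha := hn.1
    have hb := hn.2
    have ha' : x n i0 ^ d ^ k ≠ 0 := pow_ne_zero _ ha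
    rw [div_pow]
    field_simp
    ring
  have hylow : (fun _ => (1 : ℝ)) =O[l] (fun n => x (n + k) i / x (n + k) i0) := by
    have h1 : (fun n => (x (n + k) i)⁻¹ * x (n + k) i0) =O[l] (fun _ => (1 : ℝ)) :=
      ((hinv (hlow i)).mul (hupk i0)).congr_right fun n => by
        have := he1 n
        field_simp
    have h2 := h1.inv_rev (Eventually.mp (hne i) ?_)
    · refine h2.congr (fun n => by simp) fun n => ?_
      rw [mul_inv, inv_inv]
      exact (div_eq_mul_inv _ _).symm
    · filter_upwards [hne i0] with n hn hn' h
      exact absurd h (mul_ne_zero (inv_ne_zero hn'.2) hn.2)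
  have hev : (fun n => q.eval (x (n + k) i / x (n + k) i0)) =O[l]
      (fun n => (e n ^ d ^ k)⁻¹) :=
    ((isBigO_eval_quotient he1 hB1 hB hrel
      (isBigO_of_integrality he1 hB1 hB hB' het hA i0)).comp_tendsto htend).congr_right
      fun n => by simp only [Function.comp, he]
  obtain ⟨C1, hC1⟩ := hev.bound
  obtain ⟨C2, hC2⟩ := hratio.bound
  obtain ⟨C3, hC3⟩ := hylow.bound
  obtain ⟨C4, T, hC4, hnear⟩ := exists_root_near hqs hrel.1 hrel.2.1 C1
  have hsimple : ∀ b ∈ q.roots, b ≠ 0 → ∃ C : ℝ, 0 < C ∧ ∀ w : K, ∃ β, β ^ d ^ k = b ∧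
      ‖w - β‖ ≤ C * ‖w ^ d ^ k - b‖ := by
    intro b hb hb0
    have hnd : (Polynomial.X ^ (d ^ k) - Polynomial.C b).roots.Nodup :=
      Polynomial.nodup_roots (Polynomial.separable_X_pow_sub_C b (by exact_mod_cast hQ) hb0)
    obtain ⟨C, hC, h⟩ := exists_simple_root_near (hsplit b hb hb0) hnd
      (by rw [Polynomial.natDegree_X_pow_sub_C]; positivity)
    refine ⟨C, hC, fun w => ?_⟩
    obtain ⟨β, hβ, h1⟩ := h w
    refine ⟨β, ?_, by simpa using h1⟩
    have := Polynomial.isRoot_of_mem_roots hβ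
    simpa [sub_eq_zero] using this
  have hC5 : ∃ C5 : ℝ, 0 < C5 ∧ ∀ b ∈ q.roots, b ≠ 0 → ∀ w : K, ∃ β, β ^ d ^ k = b ∧
      ‖w - β‖ ≤ C5 * ‖w ^ d ^ k - b‖ := by
    classical
    have hev : ∀ᶠ C5 : ℝ in atTop, ∀ b ∈ q.roots.toFinset, b ≠ 0 → ∀ w : K,
        ∃ β, β ^ d ^ k = b ∧ ‖w - β‖ ≤ C5 * ‖w ^ d ^ k - b‖ := by
      refine (Filter.eventually_all_finset _).mpr fun b hb => ?_
      by_cases hb0 : b = 0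
      · exact Eventually.of_forall fun _ h => absurd hb0 h
      · obtain ⟨C, hC, h⟩ := hsimple b (Multiset.mem_toFinset.mp hb) hb0
        filter_upwards [eventually_ge_atTop C] with C5 hC5 _ w
        obtain ⟨β, h1, h2⟩ := h w
        exact ⟨β, h1, h2.trans (mul_le_mul_of_nonneg_right hC5 (norm_nonneg _))⟩
    obtain ⟨C5, h1, h2⟩ := (hev.and (eventually_gt_atTop 0)).exists
    exact ⟨C5, h2, fun b hb => h1 b (Multiset.mem_toFinset.mpr hb)⟩
  obtain ⟨C5, hC5, hroot⟩ := hC5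
  have hfin : ∀ᶠ n in l, x n i0 ≠ 0 ∧ ∃ β, β ≠ 0 ∧ β ^ d ^ k ∈ q.roots ∧
      ‖x n i / x n i0 - β‖ ≤ C5 * (C4 + |C2|) * (e n ^ 3)⁻¹ := by
    have hT : ∀ᶠ n in l, T ≤ e n := (het.eventually_ge_atTop T).filter_mono hlle
    have hbig : ∀ᶠ n in l, C3 * C4 * (e n ^ 3)⁻¹ < 1 := by
      have := hsmall.const_mul (C3 * C4)
      rw [mul_zero] at this
      exact this.eventually_lt_const one_pos
    filter_upwards [hne i0, hC1, hC2, hC3, hT, hbig] with n h0 h1 h2 h3 h4 h5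
    refine ⟨h0.1, ?_⟩
    have hen := he1 n
    have hq1 : ‖q.eval (x (n + k) i / x (n + k) i0)‖ * e n ^ (3 * M + 1) ≤ C1 := by
      rw [Real.norm_of_nonneg (by positivity), ← div_eq_mul_inv, le_div_iff₀ (by positivity)] at h1
      exact le_trans (by gcongr) h1
    obtain ⟨b, hb, hbn⟩ := hnear _ (e n) hen h4 hq1
    rw [← le_div_iff₀ (by positivity), div_eq_mul_inv C4] at hbn
    have hb0 : b ≠ 0 := by
      rintro rfl
      rw [sub_zero] at hbn
      rw [norm_one] at h3
      have hC3 : 0 < C3 := by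
        by_contra! hneg
        nlinarith [norm_nonneg (x (n + k) i / x (n + k) i0)]
      have := mul_le_mul_of_nonneg_left hbn hC3.le
      linarith
    obtain ⟨β, hβ, hβn⟩ := hroot b hb hb0 (x n i / x n i0)
    refine ⟨β, ?_, hβ ▸ hb, hβn.trans ?_⟩
    · rintro rfl
      exact hb0 (by rw [← hβ, zero_pow hQ])
    · rw [mul_assoc]
      refine mul_le_mul_of_nonneg_left ?_ hC5.le
      have h6 : (x n i / x n i0) ^ d ^ k - b = (x (n + k) i / x (n + k) i0 - b) -
        (x (n + k) i / x (n + k) i0 - (x n i / x n i0) ^ d ^ k) := by ring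
      rw [h6, add_mul]
      refine (norm_sub_le _ _).trans (add_le_add hbn (h2.trans ?_))
      rw [Real.norm_of_nonneg (by positivity)]
      exact mul_le_mul_of_nonneg_right (le_abs_self _) (by positivity)
  have hpos : 0 < C5 * (C4 + |C2|) := by positivity
  refine ⟨Real.log (C5 * (C4 + |C2|)), ?_⟩
  rw [hl, eventually_inf_principal] at hfin
  filter_upwards [hfin] with n hn hnS
  obtain ⟨h1, β, h2, h3, h4⟩ := hn hnS
  refine ⟨h1, β, h2, h3, h4.trans (le_of_eq ?_)⟩
  rw [sub_eq_add_neg, Real.exp_add, Real.exp_log hpos, Real.exp_neg, he_def]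
  simp only
  rw [← Real.exp_nat_mul]
  push_cast
  ring_nf

end Roth

namespace Roth

open Filter Asymptotics Topology NumberField

theorem finite_of_abv_le (K : Type) [Field K] [NumberField K] (T : Finset (nfPlaces K).V)
    (B : (nfPlaces K).V → ℝ) :
    {z : K | (∀ v, (nfPlaces K).abv v z ≤ B v) ∧ ∀ v ∉ T, (nfPlaces K).abv v z ≤ 1}.Finite := by
  classical
  obtain ⟨T', hT'⟩ : ∃ T' : Finset (FinitePlace K), ∀ w, w ∈ T' ↔ (Sum.inr w : _ ⊕ _) ∈ T :=
    ⟨T.preimage Sum.inr Sum.inr_injective.injOn, fun w => Finset.mem_preimage⟩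
  obtain ⟨B', hB'⟩ : ∃ B' : (nfPlaces K).V → ℝ, ∀ v, B v ≤ B' v ∧ 1 ≤ B' v :=
    ⟨fun v => max (B v) 1, fun v => ⟨le_max_left _ _, le_max_right _ _⟩⟩
  refine (NumberField.finite_setOfPred_mulHeight₁_le (K := K)
    ((∏ v : InfinitePlace K, B' (Sum.inl ⟨v, ⟨0, v.mult_pos⟩⟩) ^ v.mult) *
      ∏ w ∈ T', B' (Sum.inr w))).subset ?_
  rintro z ⟨h1, h2⟩
  rw [Set.mem_ofPred_eq, NumberField.mulHeight₁_eq]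
  refine mul_le_mul (Finset.prod_le_prod (fun v _ => by positivity) fun v _ => ?_) ?_
    (finprod_nonneg fun w => by positivity)
    (Finset.prod_nonneg fun v _ => pow_nonneg (zero_le_one.trans (hB' _).2) _)
  · refine pow_le_pow_left₀ (by positivity) (max_le ?_ (hB' _).2) _
    exact (h1 (Sum.inl ⟨v, ⟨0, v.mult_pos⟩⟩)).trans (hB' _).1
  · rw [finprod_eq_prod_of_mulSupport_subset (s := T')]
    · refine Finset.prod_le_prod (fun v _ => by positivity) fun w _ => ?_
      exact max_le ((h1 (Sum.inr w)).trans (hB' _).1) (hB' _).2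
    · intro w hw
      by_contra hcon
      refine hw (max_eq_right ?_)
      exact h2 (Sum.inr w) fun h => hcon ((hT' w).mpr h)

theorem Places.exists_bad_set {K : Type*} [Field K] (p : Places K) (b : K) :
    ∃ T : Finset p.V, ∀ v ∉ T, p.abv v b ≤ 1 := by
  classical
  by_cases hb : b = 0
  · exact ⟨∅, fun v _ => by simp [hb]⟩
  obtain ⟨T₀, hT₀⟩ := eventually_atTop.mp (p.prod_eq_one b hb)
  refine ⟨T₀, fun v hv => ?_⟩
  have h2 := hT₀ (insert v T₀) (Finset.subset_insert _ _)
  rw [Finset.prod_insert hv, hT₀ T₀ le_rfl, mul_one] at h2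
  exact h2.le

theorem Places.exists_good_reduction {K : Type*} [Field K] (p : Places K) {N d : ℕ}
    {g : Fin N → MvPolynomial (Fin N) K} {x : ℕ → Fin N → K}
    (hx : ∀ n i, x (n + 1) i = x n i ^ d + eval (x n) (g i)) :
    ∃ T : Finset p.V, p.arch ⊆ T ∧ ∀ v ∉ T, ∀ n i, p.abv v (x n i) ≤ 1 := by
  classical
  choose T1 hT1 using p.exists_bad_set
  refine ⟨p.arch ∪ (Finset.univ.biUnion fun i => T1 (x 0 i)) ∪
    Finset.univ.biUnion fun i => (g i).support.biUnion fun m => T1 ((g i).coeff m),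
    Finset.subset_union_left.trans Finset.subset_union_left, fun v hv n => ?_⟩
  simp only [Finset.mem_union, Finset.mem_biUnion, Finset.mem_univ, true_and, not_or,
    not_exists, not_and] at hv
  obtain ⟨⟨hv1, hv2⟩, hv3⟩ := hv
  have hpn : ∀ i, p.pnrm v (g i) ≤ 1 := fun i =>
    pnrm_le_of_nonarch hv1 zero_le_one fun m => by
      by_cases hm : m ∈ (g i).support
      · exact hT1 _ v (hv3 i m hm)
      · rw [notMem_support_iff.mp hm, map_zero]
        exact zero_le_one
  induction n with
  | zero => exact fun i => hT1 _ v (hv2 i)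
  | succ n ih =>
    intro i
    rw [hx]
    refine (p.nonarch v hv1 _ _).trans (max_le ?_ ?_)
    · rw [map_pow]
      exact pow_le_one₀ ((p.abv v).nonneg _) (ih i)
    · refine (abv_eval_le v (g i) (fun j => degreeOf j (g i)) (fun _ => le_rfl) (x n)).trans ?_
      rw [Finset.prod_congr rfl (fun j _ => by rw [max_eq_left (ih j), one_pow]),
        Finset.prod_const_one, one_mul]
      exact hpn i

theorem exists_abv_rate {K : Type*} [Field K] [CharZero K] (v : AbsoluteValue K ℝ) {N d : ℕ}
    {g : Fin N → MvPolynomial (Fin N) K} {x : ℕ → Fin N → K} (hd : 2 ≤ d)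
    (hg : ∀ i, (g i).totalDegree + 3 ≤ d ∨ g i = 0)
    (hx : ∀ n i, x (n + 1) i = x n i ^ d + eval (x n) (g i)) :
    ∃ lam c₀ : ℝ, 0 ≤ lam ∧ (∀ n i, max 1 (v (x n i)) ≤ Real.exp (c₀ + lam * d ^ n)) ∧
      ((∀ n i, v (x n i) ≤ 1) → lam = 0) ∧
      (0 < lam → ∀ {S : Set ℕ}, HasIntegrality x S → ∀ {i i0 : Fin N} {q : Polynomial K} {M : ℕ},
        HasRelation x S i i0 q M → q.Splits → ∀ {k : ℕ}, 3 * M + 1 ≤ d ^ k →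
        (∀ b ∈ q.roots, b ≠ 0 → (Polynomial.X ^ (d ^ k) - Polynomial.C b).Splits) →
        ∃ c : ℝ, ∀ᶠ n in atTop, n + k ∈ S → x n i0 ≠ 0 ∧ ∃ β, β ≠ 0 ∧ β ^ d ^ k ∈ q.roots ∧
          v (x n i / x n i0 - β) ≤ Real.exp (c - 3 * lam * d ^ n)) := by
  letI := v.toNormedField
  obtain ⟨lam, hlam, c₀, h⟩ := exists_local_rate hd hg hx
  have hsz : ∀ n, 0 < max 1 ‖x n‖ := fun n => lt_max_of_lt_left one_pos
  refine ⟨lam, c₀, hlam, fun n i => ?_, fun hle => ?_, fun hpos S hA i i0 q M hrel hqs k hk hs => ?_⟩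
  · have h1 := (abs_le.mp (h n)).2
    have h2 : max 1 ‖x n‖ ≤ Real.exp (c₀ + lam * d ^ n) := by
      rw [← Real.log_le_iff_le_exp (hsz n)]; linarith
    exact (max_le_max le_rfl (norm_le_pi_norm (x n) i)).trans h2
  · by_contra hne
    have hpos : 0 < lam := lt_of_le_of_ne hlam (Ne.symm hne)
    have h3 : Tendsto (fun n : ℕ => lam * (d : ℝ) ^ n) atTop atTop :=
      Tendsto.const_mul_atTop hpos
        (tendsto_pow_atTop_atTop_of_one_lt (by exact_mod_cast (by omega : 1 < d)))
    obtain ⟨n, hn⟩ := (h3.eventually_gt_atTop c₀).exists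
    have h4 : ‖x n‖ ≤ 1 := (pi_norm_le_iff_of_nonneg zero_le_one).mpr (hle n)
    have h5 := h n
    rw [max_eq_left h4, Real.log_one, zero_sub, abs_neg] at h5
    have := le_abs_self (lam * (d : ℝ) ^ n)
    linarith
  · exact exists_local_approx hd hg hx hpos h hA hrel hqs hk hs

/-- Archimedean and non-archimedean local data for an orbit, with the places controlling its
growth. -/
theorem exists_global_rates (K : Type) [Field K] [NumberField K] (p : Places K)
    (hp : p = nfPlaces K) {N d : ℕ}
    {g : Fin N → MvPolynomial (Fin N) K} {x : ℕ → Fin N → K} (hd : 2 ≤ d)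
    (hg : ∀ i, (g i).totalDegree + 3 ≤ d ∨ g i = 0)
    (hx : ∀ n i, x (n + 1) i = x n i ^ d + eval (x n) (g i)) (horb : (Set.range x).Infinite)
    {S : Set ℕ} (hA : HasIntegrality x S) {i i0 : Fin N} {q : Polynomial K} {M : ℕ}
    (hrel : HasRelation x S i i0 q M) (hqs : q.Splits) {k : ℕ} (hk : 3 * M + 1 ≤ d ^ k)
    (hs : ∀ b ∈ q.roots, b ≠ 0 → (Polynomial.X ^ (d ^ k) - Polynomial.C b).Splits) :
    ∃ (E : Finset p.V) (lam : p.V → ℝ) (c : ℝ), (∀ v ∈ E, 0 ≤ lam v) ∧ 0 < ∑ v ∈ E, lam v ∧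
      (∀ n, x n i0 ≠ 0 → ∀ᶠ T : Finset p.V in atTop, ∏ v ∈ T, max 1 (p.abv v (x n i / x n i0)) ≤
        Real.exp (c + (∑ v ∈ E, lam v) * d ^ n)) ∧
      ∀ᶠ n in atTop, n + k ∈ S → x n i0 ≠ 0 ∧ ∀ v ∈ E, ∃ β, β ≠ 0 ∧ β ^ d ^ k ∈ q.roots ∧
          p.abv v (x n i / x n i0 - β) ≤ Real.exp (c - 3 * lam v * d ^ n) := by
  classical
  obtain ⟨T, -, hT⟩ := p.exists_good_reduction hx
  choose lam c₀ hlam0 hup hzero happ using fun v => exists_abv_rate (p.abv v) hd hg hx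
  have hsum : ∑ v ∈ T.filter (fun v => 0 < lam v), lam v = ∑ v ∈ T, lam v := by
    rw [Finset.sum_filter]
    refine Finset.sum_congr rfl fun v _ => ?_
    split_ifs with h
    · rfl
    · exact le_antisymm (hlam0 v) (not_lt.mp h)
  have hpos : 0 < ∑ v ∈ T, lam v := by
    by_contra hcon
    have hall : ∀ v ∈ T, lam v = 0 := by
      have h0 : ∑ v ∈ T, lam v = 0 :=
        le_antisymm (not_lt.mp hcon) (Finset.sum_nonneg fun v _ => hlam0 v)
      exact (Finset.sum_eq_zero_iff_of_nonneg fun v _ => hlam0 v).mp h0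
    have hall' : ∀ v, lam v = 0 := fun v => by
      by_cases hv : v ∈ T
      · exact hall v hv
      · exact hzero v (hT v hv)
    subst hp
    have hfin := finite_of_abv_le K T (fun v => Real.exp (c₀ v))
    refine horb ((Set.Finite.pi' fun _ : Fin N => hfin).subset ?_)
    rintro _ ⟨n, rfl⟩ j
    refine ⟨fun v => ?_, fun v hv => hT v hv n j⟩
    have := hup v n j
    rw [hall' v, zero_mul, add_zero] at this
    exact (le_max_right _ _).trans this
  choose! c₁ hc₁ using fun v (hv : v ∈ T.filter (fun v => 0 < lam v)) =>
    happ v (Finset.mem_filter.mp hv).2 hA hrel hqs hk hs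
  obtain ⟨c, hcT, hcE⟩ : ∃ c : ℝ, ∑ v ∈ T, c₀ v ≤ c ∧
      ∀ v ∈ T.filter (fun v => 0 < lam v), c₁ v ≤ c :=
    ((eventually_ge_atTop (∑ v ∈ T, c₀ v)).and ((Filter.eventually_all_finset
      (T.filter fun v => 0 < lam v)).mpr fun v _ => eventually_ge_atTop (c₁ v))).exists
  refine ⟨T.filter fun v => 0 < lam v, lam, c, fun v _ => hlam0 v, hsum ▸ hpos, ?_, ?_⟩
  · intro n hn
    rw [hsum]
    filter_upwards [p.prod_eq_one _ hn, eventually_ge_atTop T] with T' hT' hTT'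
    have h1 : ∏ v ∈ T', max 1 (p.abv v (x n i / x n i0)) =
        ∏ v ∈ T', max (p.abv v (x n i0)) (p.abv v (x n i)) := by
      have h0 : ∏ v ∈ T', max 1 (p.abv v (x n i / x n i0)) =
          (∏ v ∈ T', max 1 (p.abv v (x n i / x n i0))) * ∏ v ∈ T', p.abv v (x n i0) := by
        rw [hT', mul_one]
      rw [h0, ← Finset.prod_mul_distrib]
      refine Finset.prod_congr rfl fun v _ => ?_
      rw [max_mul_of_nonneg _ _ ((p.abv v).nonneg _), one_mul, ← map_mul, div_mul_cancel₀ _ hn]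
    rw [h1]
    have h2 : ∀ v, max (p.abv v (x n i0)) (p.abv v (x n i)) ≤ Real.exp (c₀ v + lam v * d ^ n) :=
      fun v => max_le ((le_max_right _ _).trans (hup v n i0)) ((le_max_right _ _).trans (hup v n i))
    have hnn : ∀ v, 0 ≤ max (p.abv v (x n i0)) (p.abv v (x n i)) := fun v =>
      le_max_of_le_left ((p.abv v).nonneg _)
    rw [← Finset.prod_sdiff hTT']
    have h3 : ∏ v ∈ T' \ T, max (p.abv v (x n i0)) (p.abv v (x n i)) ≤ 1 :=
      Finset.prod_le_one (fun v _ => hnn v) fun v hv =>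
        max_le (hT v (Finset.mem_sdiff.mp hv).2 n i0) (hT v (Finset.mem_sdiff.mp hv).2 n i)
    have h4 : ∏ v ∈ T, max (p.abv v (x n i0)) (p.abv v (x n i)) ≤
        Real.exp (c + (∑ v ∈ T, lam v) * d ^ n) := by
      refine (Finset.prod_le_prod (fun v _ => hnn v) fun v _ => h2 v).trans ?_
      rw [← Real.exp_sum, Finset.sum_add_distrib, ← Finset.sum_mul]
      exact Real.exp_le_exp.mpr (by linarith)
    exact (mul_le_of_le_one_left (Finset.prod_nonneg fun v _ => hnn v) h3).trans h4
  · have h1 : ∀ᶠ n in atTop, ∀ v ∈ T.filter (fun v => 0 < lam v), n + k ∈ S → x n i0 ≠ 0 ∧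
        ∃ β, β ≠ 0 ∧ β ^ d ^ k ∈ q.roots ∧
          p.abv v (x n i / x n i0 - β) ≤ Real.exp (c₁ v - 3 * lam v * d ^ n) :=
      (Filter.eventually_all_finset _).mpr hc₁
    have hne : (T.filter fun v => 0 < lam v).Nonempty := by
      by_contra hemp
      rw [Finset.not_nonempty_iff_eq_empty] at hemp
      rw [← hsum, hemp, Finset.sum_empty] at hpos
      exact lt_irrefl _ hpos
    filter_upwards [h1] with n hn hnS
    obtain ⟨v0, hv0⟩ := hne
    refine ⟨(hn v0 hv0 hnS).1, fun v hv => ?_⟩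
    obtain ⟨-, β, h2, h3, h4⟩ := hn v hv hnS
    exact ⟨β, h2, h3, h4.trans (Real.exp_le_exp.mpr (by linarith [hcE v hv]))⟩

theorem exists_ratio (K : Type) [Field K] [NumberField K] {N d : ℕ}
    {g : Fin N → MvPolynomial (Fin N) K} {x : ℕ → Fin N → K} (hd : 2 ≤ d)
    (hg : ∀ i, (g i).totalDegree + 3 ≤ d ∨ g i = 0)
    (hx : ∀ n i, x (n + 1) i = x n i ^ d + eval (x n) (g i)) (horb : (Set.range x).Infinite)
    {S : Set ℕ} (hA : HasIntegrality x S) {i i0 : Fin N} {q : Polynomial K} {M : ℕ}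
    (hrel : HasRelation x S i i0 q M) (hqs : q.Splits) {k : ℕ} (hk : 3 * M + 1 ≤ d ^ k)
    (hs : ∀ b ∈ q.roots, b ≠ 0 → (Polynomial.X ^ (d ^ k) - Polynomial.C b).Splits)
    {P : ℕ → Prop} (hP : ∃ᶠ n in atTop, P n ∧ n + k ∈ S) :
    ∃ β : K, β ≠ 0 ∧ ∃ᶠ n in atTop, (P n ∧ x n i = β * x n i0) ∧ n + k ∈ S := by
  classical
  obtain ⟨p, hp⟩ : ∃ p, p = nfPlaces K := ⟨_, rfl⟩
  obtain ⟨E, lam, c, hlam, hpos, hheight, happ⟩ :=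
    exists_global_rates K p hp hd hg hx horb hA hrel hqs hk hs
  have hBfin : {β : K | β ≠ 0 ∧ β ^ d ^ k ∈ q.roots}.Finite := by
    have h1 : (⋃ b ∈ q.roots.toFinset, {β : K | β ^ d ^ k = b}).Finite := by
      refine Set.Finite.biUnion (Finset.finite_toSet _) fun b _ => ?_
      have hQ : 0 < d ^ k := by positivity
      refine (Polynomial.nthRoots (d ^ k) b).toFinset.finite_toSet.subset fun β hβ => ?_
      simpa [Polynomial.mem_nthRoots hQ] using hβ
    refine h1.subset fun β hβ => ?_
    simp only [Set.mem_iUnion, Multiset.mem_toFinset]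
    exact ⟨_, hβ.2, rfl⟩
  have : Finite {β : K | β ≠ 0 ∧ β ^ d ^ k ∈ q.roots} := hBfin
  have h1 : ∃ b : E → {β : K | β ≠ 0 ∧ β ^ d ^ k ∈ q.roots}, ∃ᶠ n in atTop, (P n ∧ n + k ∈ S ∧
      x n i0 ≠ 0) ∧ ∀ v : E, p.abv v (x n i / x n i0 - b v) ≤
        Real.exp (c - 3 * lam v * d ^ n) := by
    by_contra hcon
    rw [not_exists] at hcon
    have h2 : ∀ᶠ n in atTop, ∀ b : E → {β : K | β ≠ 0 ∧ β ^ d ^ k ∈ q.roots},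
        ¬ ((P n ∧ n + k ∈ S ∧ x n i0 ≠ 0) ∧ ∀ v : E, p.abv v (x n i / x n i0 - b v) ≤
          Real.exp (c - 3 * lam v * d ^ n)) :=
      eventually_all.mpr fun b => not_frequently.mp (hcon b)
    obtain ⟨n, ⟨hn1, hnS⟩, hn2, hn3⟩ := (hP.and_eventually (h2.and happ)).exists
    obtain ⟨h4, h5⟩ := hn3 hnS
    choose b hb1 hb2 hb3 using fun v : E => h5 v v.2
    exact hn2 (fun v => ⟨b v, hb1 v, hb2 v⟩) ⟨⟨hn1, hnS, h4⟩, hb3⟩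
  obtain ⟨b, hb⟩ := h1
  have h2 : ∃ v : E, ∃ᶠ n in atTop, (P n ∧ n + k ∈ S ∧ x n i0 ≠ 0) ∧
      x n i / x n i0 = b v := by
    by_contra hcon
    rw [not_exists] at hcon
    have h3 : ∀ᶠ n in atTop, ∀ v : E, ¬ ((P n ∧ n + k ∈ S ∧ x n i0 ≠ 0) ∧
        x n i / x n i0 = b v) :=
      eventually_all.mpr fun v => not_frequently.mp (hcon v)
    obtain ⟨φ, hφ, hφ'⟩ := extraction_of_frequently_atTop (hb.and_eventually h3)
    obtain ⟨β, hβ⟩ : ∃ β : p.V → K, ∀ v : E, β v = b v :=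
      ⟨fun v => if h : v ∈ E then b ⟨v, h⟩ else 0, fun v => dif_pos v.2⟩
    have hD : Tendsto (fun n => (d : ℝ) ^ φ n) atTop atTop :=
      (tendsto_pow_atTop_atTop_of_one_lt
        (by exact_mod_cast (by omega : 1 < d))).comp hφ.tendsto_atTop
    subst hp
    refine roth K (fun n => x (φ n) i / x (φ n) i0) (fun n => (d : ℝ) ^ φ n) hD E β lam hlam hpos c
      ?_ ?_ ?_
    · intro n v hv
      rw [hβ ⟨v, hv⟩]
      exact (hφ' n).1.2 ⟨v, hv⟩
    · intro n
      exact hheight (φ n) (hφ' n).1.1.2.2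
    · intro n v hv heq
      rw [hβ ⟨v, hv⟩] at heq
      exact (hφ' n).2 ⟨v, hv⟩ ⟨(hφ' n).1.1, heq⟩
  obtain ⟨v, hv⟩ := h2
  refine ⟨b v, (b v).2.1, hv.mono fun n hn => ?_⟩
  exact ⟨⟨hn.1.1, by rw [← hn.2, div_mul_cancel₀ _ hn.1.2.2]⟩, hn.1.2.1⟩

theorem exists_direction (K : Type) [Field K] [NumberField K] {N d : ℕ}
    {g : Fin N → MvPolynomial (Fin N) K} {x : ℕ → Fin N → K} (hd : 2 ≤ d)
    (hg : ∀ i, (g i).totalDegree + 3 ≤ d ∨ g i = 0)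
    (hx : ∀ n i, x (n + 1) i = x n i ^ d + eval (x n) (g i)) (horb : (Set.range x).Infinite)
    {S : Set ℕ} (hA : HasIntegrality x S) {i0 : Fin N} {q : Fin N → Polynomial K} {M : Fin N → ℕ}
    (hrel : ∀ i, HasRelation x S i i0 (q i) (M i)) (hqs : ∀ i, (q i).Splits) {k : ℕ}
    (hk : ∀ i, 3 * M i + 1 ≤ d ^ k)
    (hs : ∀ i, ∀ b ∈ (q i).roots, b ≠ 0 → (Polynomial.X ^ (d ^ k) - Polynomial.C b).Splits)
    {P : ℕ → Prop} (hP : ∃ᶠ n in atTop, P n ∧ n + k ∈ S) :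
    ∃ β : Fin N → K, (∀ i, β i ≠ 0) ∧
      ∃ᶠ n in atTop, (P n ∧ ∀ i, x n i = β i * x n i0) ∧ n + k ∈ S := by
  classical
  have key : ∀ I : Finset (Fin N), ∃ β : Fin N → K, (∀ i, β i ≠ 0) ∧
      ∃ᶠ n in atTop, (P n ∧ ∀ i ∈ I, x n i = β i * x n i0) ∧ n + k ∈ S := by
    intro I
    induction I using Finset.induction_on with
    | empty => exact ⟨fun _ => 1, fun _ => one_ne_zero, by simpa using hP⟩
    | insert i I hi ih =>
      obtain ⟨β, hβ, h⟩ := ih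
      obtain ⟨b, hb, h'⟩ := exists_ratio K hd hg hx horb hA (hrel i) (hqs i) (hk i) (hs i) h
      refine ⟨Function.update β i b, fun j => ?_, h'.mono fun n hn => ⟨⟨hn.1.1.1, ?_⟩, hn.2⟩⟩
      · rcases eq_or_ne j i with rfl | hj
        · simpa using hb
        · simpa [Function.update_of_ne hj] using hβ j
      · intro j hj
        rcases Finset.mem_insert.mp hj with rfl | hjI
        · simpa using hn.1.2
        · rw [Function.update_of_ne (by rintro rfl; exact hi hjI)]
          exact hn.1.1.2 j hjI
  obtain ⟨β, hβ, h⟩ := key Finset.univ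
  exact ⟨β, hβ, h.mono fun n hn => ⟨⟨hn.1.1, fun i => hn.1.2 i (Finset.mem_univ i)⟩, hn.2⟩⟩

theorem totalDegree_map_of_injective {σ R S : Type*} [CommSemiring R] [CommSemiring S]
    {ι : R →+* S} (hι : Function.Injective ι) (p : MvPolynomial σ R) :
    (map ι p).totalDegree = p.totalDegree := by
  rw [totalDegree, totalDegree, support_map_of_injective p hι]

theorem exists_map_eq_of_coeffs {σ R S : Type*} [CommSemiring R] [CommSemiring S]
    {ι : R →+* S} (hι : Function.Injective ι) {p : MvPolynomial σ S}
    (hp : ∀ a ∈ p.coeffs, a ∈ Set.range ι) :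
    ∃ p' : MvPolynomial σ R, map ι p' = p ∧ p'.totalDegree = p.totalDegree ∧
      ∀ y : σ → R, ι (eval y p') = eval (fun i => ι (y i)) p := by
  obtain ⟨p', rfl⟩ := (mem_range_map_iff_coeffs_subset (f := ι)).mpr hp
  refine ⟨p', rfl, (totalDegree_map_of_injective hι p').symm, fun y => ?_⟩
  rw [eval_map, eval, coe_eval₂Hom, eval₂_comp_left]
  rfl

theorem exists_direction_algebraic (F : Type) [Field F] [CharZero F] [Algebra ℚ F]
    [Algebra.IsAlgebraic ℚ F] [IsAlgClosed F] {N d : ℕ}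
    {g : Fin N → MvPolynomial (Fin N) F} {x : ℕ → Fin N → F} (hd : 2 ≤ d)
    (hg : ∀ i, (g i).totalDegree + 3 ≤ d ∨ g i = 0)
    (hx : ∀ n i, x (n + 1) i = x n i ^ d + eval (x n) (g i)) (horb : (Set.range x).Infinite)
    {S : Set ℕ} (hA : HasIntegrality x S) {i0 : Fin N} {q : Fin N → Polynomial F} {M : Fin N → ℕ}
    (hrel : ∀ i, HasRelation x S i i0 (q i) (M i)) {k : ℕ}
    (hk : ∀ i, 3 * M i + 1 ≤ d ^ k)
    {P : ℕ → Prop} (hP : ∃ᶠ n in atTop, P n ∧ n + k ∈ S) :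
    ∃ β : Fin N → F, (∀ i, β i ≠ 0) ∧
      ∃ᶠ n in atTop, (P n ∧ ∀ i, x n i = β i * x n i0) ∧ n + k ∈ S := by
  classical
  choose L h R hh hR hhR using hA
  choose hq0 hqM Q hQ hQq using hrel
  obtain ⟨T, hT⟩ : ∃ T : Finset F, T = (Finset.univ.biUnion fun i => (g i).coeffs) ∪
      (Finset.univ.image fun i => x 0 i) ∪
      (Finset.univ.biUnion fun i => Finset.univ.biUnion fun j => (h i j).coeffs ∪ (R i j).coeffs) ∪
      (Finset.univ.biUnion fun i => (Q i).coeffs ∪ (q i).coeffs ∪ (q i).roots.toFinset) ∪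
      (Finset.univ.biUnion fun i => (q i).roots.toFinset.biUnion fun b =>
        (Polynomial.X ^ (d ^ k) - Polynomial.C b : Polynomial F).roots.toFinset) := ⟨_, rfl⟩
  obtain ⟨K, hK⟩ : ∃ K : IntermediateField ℚ F, K = IntermediateField.adjoin ℚ (T : Set F) :=
    ⟨_, rfl⟩
  have hfd : FiniteDimensional ℚ K := by
    rw [hK]
    exact IntermediateField.finiteDimensional_adjoin fun x _ => Algebra.IsIntegral.isIntegral x
  have : NumberField K := { to_charZero := inferInstance, to_finiteDimensional := by
                              convert hfd; exact Subsingleton.elim _ _ }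
  obtain ⟨ι, hι⟩ : ∃ ι : K →+* F, ι = algebraMap K F := ⟨_, rfl⟩
  have hinj : Function.Injective ι := ι.injective
  have hTK : ∀ a ∈ T, a ∈ Set.range ι := by
    intro a ha
    have : a ∈ K := hK ▸ IntermediateField.subset_adjoin ℚ _ ha
    exact ⟨⟨a, this⟩, by rw [hι]; rfl⟩
  have hTg : ∀ i, ∀ a ∈ (g i).coeffs, a ∈ T := by
    intro i a ha
    rw [hT]; simp only [Finset.mem_union, Finset.mem_biUnion, Finset.mem_univ, true_and]
    exact Or.inl (Or.inl (Or.inl (Or.inl ⟨i, ha⟩)))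
  have hTx : ∀ i, x 0 i ∈ T := by
    intro i
    rw [hT]; simp only [Finset.mem_union, Finset.mem_image, Finset.mem_univ, true_and]
    exact Or.inl (Or.inl (Or.inl (Or.inr ⟨i, rfl⟩)))
  have hTh : ∀ i j, ∀ a, (a ∈ (h i j).coeffs ∨ a ∈ (R i j).coeffs) → a ∈ T := by
    intro i j a ha
    rw [hT]; simp only [Finset.mem_union, Finset.mem_biUnion, Finset.mem_univ, true_and]
    exact Or.inl (Or.inl (Or.inr ⟨i, j, ha⟩))
  have hTq : ∀ i, ∀ a, ((a ∈ (Q i).coeffs ∨ a ∈ (q i).coeffs) ∨ a ∈ (q i).roots) → a ∈ T := by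
    intro i a ha
    rw [hT]; simp only [Finset.mem_union, Finset.mem_biUnion, Finset.mem_univ, true_and,
      Multiset.mem_toFinset]
    exact Or.inl (Or.inr ⟨i, ha⟩)
  have hTr : ∀ i, ∀ b ∈ (q i).roots, ∀ a ∈ (Polynomial.X ^ (d ^ k) - Polynomial.C b).roots,
      a ∈ T := by
    intro i b hb a ha
    rw [hT]; simp only [Finset.mem_union, Finset.mem_biUnion, Finset.mem_univ, true_and,
      Multiset.mem_toFinset]
    exact Or.inr ⟨i, b, hb, ha⟩
  choose g' hg1 hg2 hg3 using fun i =>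
    exists_map_eq_of_coeffs hinj fun a ha => hTK a (hTg i a ha)
  choose h' hh1 hh2 hh3 using fun i j =>
    exists_map_eq_of_coeffs hinj (p := h i j) fun a ha => hTK a (hTh i j a (Or.inl ha))
  choose R' hR1 hR2 hR3 using fun i j =>
    exists_map_eq_of_coeffs hinj (p := R i j) fun a ha => hTK a (hTh i j a (Or.inr ha))
  choose Q' hQ1 hQ2 hQ3 using fun i =>
    exists_map_eq_of_coeffs hinj (p := Q i) fun a ha => hTK a (hTq i a (Or.inl (Or.inl ha)))
  have hqlift : ∀ i, ∃ q' : Polynomial K, q'.map ι = q i := by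
    intro i
    have h1 : q i ∈ Polynomial.lifts ι := by
      rw [Polynomial.lifts_iff_coeff_lifts]
      intro n
      by_cases hn : (q i).coeff n = 0
      · exact ⟨0, by rw [hn, map_zero]⟩
      · exact hTK _ (hTq i _ (Or.inl (Or.inr (Polynomial.coeff_mem_coeffs hn))))
    exact (Polynomial.mem_lifts _).mp h1
  choose q' hq' using hqlift
  have hxlift : ∀ n, ∃ y : Fin N → K, ∀ i, ι (y i) = x n i := by
    intro n
    induction n with
    | zero => exact ⟨fun i => (hTK _ (hTx i)).choose, fun i => (hTK _ (hTx i)).choose_spec⟩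
    | succ n ih =>
      obtain ⟨y, hy⟩ := ih
      refine ⟨fun i => y i ^ d + eval y (g' i), fun i => ?_⟩
      rw [map_add, map_pow, hg3, hx, hy, funext hy]
  choose y hy using hxlift
  have hyx : ∀ n, (fun i => ι (y n i)) = x n := fun n => funext (hy n)
  have hsplit : ∀ i, (q' i).Splits := fun i =>
    Polynomial.Splits.of_splits_map ι (IsAlgClosed.splits _) fun a ha =>
      hTK a (hTq i a (Or.inr (hq' i ▸ ha)))
  have key := exists_direction K (g := g') (x := y) (S := S) (i0 := i0) (q := q') (M := M) (k := k)
    (P := P) hd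
    (fun i => (hg i).imp (fun h => by rwa [hg2]) fun h => by
      apply map_injective ι hinj
      rw [hg1, h, map_zero])
    (fun n i => hinj (by rw [hy, map_add, map_pow, hg3, hyx, hx, hy]))
    (by
      intro hfin
      refine horb ((hfin.image fun (z : Fin N → K) i => ι (z i)).subset ?_)
      rintro _ ⟨n, rfl⟩
      exact ⟨y n, ⟨n, rfl⟩, hyx n⟩)
    (fun i j => ⟨L i j, h' i j, R' i j, by rw [hh2]; exact hh i j, by rw [hR2]; exact hR i j,
      fun n hn => hinj (by
        rw [map_pow, map_add, map_mul, hh3, hR3, hyx, hy, hy]; exact hhR i j n hn)⟩)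
    (fun i => ⟨fun h0 => hq0 i (by rw [← hq' i, h0, Polynomial.map_zero]), by
      rw [← Polynomial.natDegree_map_eq_of_injective hinj, hq']; exact hqM i, Q' i, by
      rw [hQ2]; exact hQ i, fun n hn => hinj (by
        rw [map_sum, hQ3, hyx, ← hQq i n hn]
        refine Finset.sum_congr rfl fun j _ => ?_
        rw [map_mul, map_mul, map_pow, map_pow, hy, hy, ← hq' i, Polynomial.coeff_map])⟩)
    hsplit hk
    (by
      intro i b hb hb0
      refine Polynomial.Splits.of_splits_map ι (IsAlgClosed.splits _) fun a ha => ?_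
      refine hTK a (hTr i (ι b) ?_ a ?_)
      · rw [← hq' i, (hsplit i).roots_map]
        exact Multiset.mem_map_of_mem _ hb
      · simpa using ha)
    hP
  obtain ⟨β, hβ, hfr⟩ := key
  refine ⟨fun i => ι (β i), fun i => by simpa using hβ i, hfr.mono fun n hn =>
    ⟨⟨hn.1.1, fun i => ?_⟩, hn.2⟩⟩
  rw [← hy, ← hy, hn.1.2 i, map_mul]

theorem eval_const_mul_of_isHomogeneous {R : Type*} [CommSemiring R] {N m : ℕ}
    {p : MvPolynomial (Fin N) R} (hp : p.IsHomogeneous m) (t : R) (b : Fin N → R) :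
    eval (fun i => t * b i) p = t ^ m * eval b p := by
  rw [eval_eq', eval_eq', Finset.mul_sum]
  refine Finset.sum_congr rfl fun e he => ?_
  have h1 : ∑ i, e i = m := by
    have := hp (mem_support_iff.mp he)
    rw [← this, Finsupp.weight_apply, Finsupp.sum_fintype _ _ (by simp)]
    simp
  simp only [mul_pow, Finset.prod_mul_distrib, Finset.prod_pow_eq_pow_sum, h1]
  ring

theorem eval_const_mul {R : Type*} [CommSemiring R] {N D : ℕ} {p : MvPolynomial (Fin N) R}
    (hp : p.totalDegree < D) (t : R) (b : Fin N → R) :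
    eval (fun i => t * b i) p = ∑ m ∈ Finset.range D, t ^ m * eval b (homogeneousComponent m p) := by
  have h1 : p = ∑ m ∈ Finset.range D, homogeneousComponent m p := by
    conv_lhs => rw [← sum_homogeneousComponent p]
    refine Finset.sum_subset (Finset.range_subset_range.mpr hp) fun m _ hm => ?_
    rw [Finset.mem_range, not_lt] at hm
    exact homogeneousComponent_eq_zero _ _ hm
  conv_lhs => rw [h1]
  rw [map_sum]
  exact Finset.sum_congr rfl fun m _ =>
    eval_const_mul_of_isHomogeneous (homogeneousComponent_isHomogeneous m p) t b

theorem eval_homogeneousComponent_eq_zero {F : Type*} [Field F] {N : ℕ}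
    {p : MvPolynomial (Fin N) F} {b : Fin N → F} {T : Set F} (hT : T.Infinite)
    (h : ∀ t ∈ T, eval (fun i => t * b i) p = 0) (m : ℕ) :
    eval b (homogeneousComponent m p) = 0 := by
  obtain ⟨D, hD⟩ : ∃ D, D = p.totalDegree + 1 + m := ⟨_, rfl⟩
  have hpD : p.totalDegree < D := by omega
  have hmD : m < D := by omega
  obtain ⟨u, hu⟩ : ∃ u : Polynomial F, u = ∑ m ∈ Finset.range D,
      Polynomial.C (eval b (homogeneousComponent m p)) * Polynomial.X ^ m := ⟨_, rfl⟩
  have hu0 : u = 0 := by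
    refine Polynomial.eq_zero_of_infinite_isRoot u (hT.mono fun t ht => ?_)
    have h1 := h t ht
    rw [eval_const_mul hpD] at h1
    rw [Set.mem_ofPred_eq, Polynomial.IsRoot.def, hu, Polynomial.eval_finsetSum, ← h1]
    refine Finset.sum_congr rfl fun m _ => ?_
    rw [Polynomial.eval_mul, Polynomial.eval_C, Polynomial.eval_pow, Polynomial.eval_X, mul_comm]
  have h2 := congrArg (fun w : Polynomial F => w.coeff m) hu0
  rw [hu] at h2
  simpa [Polynomial.coeff_C_mul, Polynomial.coeff_X_pow, hmD] using h2

/-- An orbit with infinitely many points has no repetitions. -/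
theorem injective_of_infinite_range {α : Type*} {f : α → α} {x : ℕ → α}
    (hx : ∀ n, x (n + 1) = f (x n)) (h : (Set.range x).Infinite) : Function.Injective x := by
  have key : ∀ a b, a < b → x a ≠ x b := by
    intro a b hab heq
    refine h (((Set.finite_Iio b).image x).subset ?_)
    rintro _ ⟨n, rfl⟩
    induction n with
    | zero => exact ⟨0, by simp only [Set.mem_Iio]; omega, rfl⟩
    | succ n ih =>
      obtain ⟨m, hm, hm'⟩ := ih
      rw [hx, ← hm', ← hx]
      rcases Nat.lt_or_eq_of_le (Nat.succ_le_of_lt (Set.mem_Iio.mp hm)) with h' | h'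
      · exact ⟨m + 1, h', rfl⟩
      · refine ⟨a, hab, ?_⟩
        rw [heq, ← h']
  intro a b hab
  rcases lt_trichotomy a b with h' | h' | h'
  · exact absurd hab (key a b h')
  · exact h'
  · exact absurd hab.symm (key b a h')

/-- Two consecutive directions: if infinitely many multiples of `b'` are mapped to multiples
of `b`, then `b = b' ^ d` and all homogeneous parts of `g` respect the direction. -/
theorem direction_step {F : Type*} [Field F] {N d : ℕ} {g : Fin N → MvPolynomial (Fin N) F}
    (hg : ∀ i, (g i).totalDegree < d ∨ g i = 0) (hd : 0 < d) {i0 : Fin N} {b b' : Fin N → F}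
    (hb' : b' i0 = 1) {T : Set F} (hT : T.Infinite)
    (h : ∀ t ∈ T, ∀ i, (t * b' i) ^ d + eval (fun i => t * b' i) (g i) =
      b i * ((t * b' i0) ^ d + eval (fun i => t * b' i) (g i0))) :
    (∀ i, b i = b' i ^ d) ∧ ∀ i m, eval b' (homogeneousComponent m (g i)) =
      b' i ^ d * eval b' (homogeneousComponent m (g i0)) := by
  have hg' : ∀ i, (g i).totalDegree < d := fun i => (hg i).elim id fun h => by
    rw [h, totalDegree_zero]; exact hd
  have key : ∀ i, ∀ m, eval b' (homogeneousComponent m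
      (X i ^ d + g i - C (b i) * (X i0 ^ d + g i0))) = 0 := fun i m =>
    eval_homogeneousComponent_eq_zero hT (fun t ht => by
      simp only [map_sub, map_add, map_mul, map_pow, eval_X, eval_C]
      rw [h t ht i, sub_self]) m
  have hX : ∀ i : Fin N, (X i ^ d : MvPolynomial (Fin N) F) ∈ homogeneousSubmodule (Fin N) F d :=
    fun i => by
      have := (isHomogeneous_X F i).pow d
      rwa [one_mul] at this
  have h1 : ∀ i, b i = b' i ^ d := by
    intro i
    have := key i d
    rw [map_sub, homogeneousComponent_C_mul, map_add, map_add,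
      homogeneousComponent_eq_zero _ _ (hg' i), homogeneousComponent_eq_zero _ _ (hg' i0),
      homogeneousComponent_of_mem (hX i), homogeneousComponent_of_mem (hX i0)] at this
    simp only [if_true, add_zero, map_sub, map_mul, map_pow, eval_X, eval_C, hb', one_pow,
      mul_one] at this
    exact (sub_eq_zero.mp this).symm
  refine ⟨h1, fun i m => ?_⟩
  rcases lt_or_ge m d with hm | hm
  · have := key i m
    rw [map_sub, homogeneousComponent_C_mul, map_add, map_add,
      homogeneousComponent_of_mem (hX i), homogeneousComponent_of_mem (hX i0),
      if_neg hm.ne, zero_add, if_neg hm.ne, zero_add] at this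
    simp only [map_sub, map_mul, eval_C] at this
    rw [← h1]
    exact sub_eq_zero.mp this
  · rw [homogeneousComponent_eq_zero _ _ ((hg' i).trans_le hm),
      homogeneousComponent_eq_zero _ _ ((hg' i0).trans_le hm), map_zero, mul_zero]

/-- A sequence of points with `b (l + 1) ^ d = b l` satisfying a family of equations for all
large `l` contains a point all of whose forward images satisfy the equations. -/
theorem exists_forward_invariant {F : Type*} [Field F] {N d : ℕ} {b : ℕ → Fin N → F}
    (hb : ∀ l i, b l i = b (l + 1) i ^ d) {T : Set (MvPolynomial (Fin N) F)}
    (hT : ∀ p ∈ T, ∀ l, eval (b (l + 1)) p = 0) :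
    ∃ L, ∀ p ∈ T, ∀ j : ℕ, eval (fun i => b L i ^ d ^ j) p = 0 := by
  obtain ⟨I, hI⟩ : ∃ I : ℕ →o Ideal (MvPolynomial (Fin N) F), ∀ L p,
      p ∈ I L ↔ ∀ l, L ≤ l → eval (b l) p = 0 :=
    ⟨⟨fun L => ⨅ l ∈ Set.Ici L, RingHom.ker (eval (b l)), fun L L' hLL' =>
      biInf_mono (Set.Ici_subset_Ici.mpr hLL')⟩, fun L p => by
        simp [Ideal.mem_iInf, RingHom.mem_ker]⟩
  obtain ⟨L, hL⟩ := monotone_stabilizes_iff_noetherian.mpr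
    (inferInstance : IsNoetherian (MvPolynomial (Fin N) F) (MvPolynomial (Fin N) F)) I
  have hpow : ∀ j l i, b l i = b (l + j) i ^ d ^ j := by
    intro j
    induction j with
    | zero => simp
    | succ j ih =>
      intro l i
      rw [ih, hb (l + j), ← pow_mul, pow_succ', add_assoc]
  refine ⟨L, fun p hp j => ?_⟩
  have h1 : bind₁ (fun i => (X i : MvPolynomial (Fin N) F) ^ d ^ j) p ∈ I (L + j + 1) := by
    rw [hI]
    intro l hl
    obtain ⟨l', rfl⟩ : ∃ l', l = l' + 1 + j := ⟨l - j - 1, by omega⟩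
    rw [eval, eval₂Hom_bind₁]
    have h2 := hT p hp l'
    rw [eval] at h2
    convert! h2 using 3
    funext i
    rw [hpow j (l' + 1) i]
    simp
  rw [← hL (L + j + 1) (by omega), hI] at h1
  have h2 := h1 L le_rfl
  rw [eval, eval₂Hom_bind₁] at h2
  rw [eval]
  convert! h2 using 3
  funext i
  simp

/-- A nested sequence of infinite index sets along which the points `x (n - k)` lie on fixed
lines through the origin. -/
theorem exists_directions {F : Type*} [Field F] {N k₀ : ℕ} {x : ℕ → Fin N → F} {i0 : Fin N}
    {S : Set ℕ} (hS : S.Infinite)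
    (h : ∀ k, k₀ ≤ k → ∀ S' ⊆ S, S'.Infinite → ∃ b : Fin N → F, (∀ i, b i ≠ 0) ∧
      {n | n ∈ S' ∧ k ≤ n ∧ ∀ i, x (n - k) i = b i * x (n - k) i0}.Infinite) :
    ∃ (b : ℕ → Fin N → F) (T : ℕ → Set ℕ), (∀ l i, b l i ≠ 0) ∧ (∀ l, (T l).Infinite) ∧
      (∀ l, T l ⊆ S) ∧ (∀ l, T (l + 1) ⊆ T l) ∧
      ∀ l, ∀ n ∈ T l, k₀ + l ≤ n ∧ ∀ i, x (n - (k₀ + l)) i = b l i * x (n - (k₀ + l)) i0 := by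
  choose b hb hinf using fun l => h (k₀ + l) (Nat.le_add_right _ _)
  obtain ⟨nxt, hnxt⟩ : ∃ nxt : ℕ → {S' : Set ℕ // S' ⊆ S ∧ S'.Infinite} →
      {S' : Set ℕ // S' ⊆ S ∧ S'.Infinite}, ∀ l S', (nxt l S' : Set ℕ) =
        {n | n ∈ S'.1 ∧ k₀ + l ≤ n ∧ ∀ i, x (n - (k₀ + l)) i =
          b l S'.1 S'.2.1 S'.2.2 i * x (n - (k₀ + l)) i0} :=
    ⟨fun l S' => ⟨_, fun n hn => S'.2.1 hn.1, hinf l S'.1 S'.2.1 S'.2.2⟩, fun _ _ => rfl⟩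
  obtain ⟨T, hT⟩ : ∃ T : ℕ → {S' : Set ℕ // S' ⊆ S ∧ S'.Infinite},
      ∀ l, T (l + 1) = nxt l (T l) :=
    ⟨fun l => Nat.rec ⟨S, subset_rfl, hS⟩ nxt l, fun _ => rfl⟩
  have hsub : ∀ l, (T (l + 1)).1 ⊆ (T l).1 := fun l n hn => by
    rw [hT, hnxt] at hn
    exact hn.1
  refine ⟨fun l => b l (T l).1 (T l).2.1 (T l).2.2, fun l => (T (l + 1)).1, fun l i => hb _ _ _ _ i,
    fun l => (T _).2.2, fun l => (T _).2.1, fun l => hsub _, fun l n hn => ?_⟩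
  dsimp only at hn
  rw [hT, hnxt] at hn
  exact hn.2

theorem exists_invariant_direction (F : Type) [Field F] [CharZero F] [Algebra ℚ F]
    [Algebra.IsAlgebraic ℚ F] [IsAlgClosed F] {N d : ℕ}
    {g : Fin N → MvPolynomial (Fin N) F} {x : ℕ → Fin N → F} (hd : 2 ≤ d)
    (hg : ∀ i, (g i).totalDegree + 3 ≤ d ∨ g i = 0)
    (hx : ∀ n i, x (n + 1) i = x n i ^ d + eval (x n) (g i)) (horb : (Set.range x).Infinite)
    {S : Set ℕ} (hS : S.Infinite) (hA : HasIntegrality x S) {i0 : Fin N}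
    {q : Fin N → Polynomial F} {M : Fin N → ℕ}
    (hrel : ∀ i, HasRelation x S i i0 (q i) (M i)) :
    ∃ b : Fin N → F, (∀ i, b i ≠ 0) ∧ b i0 = 1 ∧
      {n | n ∈ S ∧ ∀ i, x n i = b i * x n i0}.Infinite ∧
      ∀ (j : ℕ) i m, eval (fun i => b i ^ d ^ j) (homogeneousComponent m (g i)) =
        b i ^ d ^ (j + 1) * eval (fun i => b i ^ d ^ j) (homogeneousComponent m (g i0)) := by
  classical
  have hinj : Function.Injective x :=
    injective_of_infinite_range (f := fun y i => y i ^ d + eval y (g i))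
      (fun n => funext (hx n)) horb
  obtain ⟨k₀, hk₀⟩ : ∃ k₀, ∀ i, 3 * M i + 1 ≤ d ^ k₀ := by
    refine ⟨3 * (∑ i, M i) + 1, fun i => ?_⟩
    have h1 : M i ≤ ∑ i, M i := Finset.single_le_sum (fun _ _ => Nat.zero_le _) (Finset.mem_univ i)
    exact (by omega : 3 * M i + 1 ≤ 3 * (∑ i, M i) + 1).trans (Nat.lt_pow_self hd).le
  obtain ⟨b, T, hb0, hTinf, hTS, hTmono, hT⟩ := exists_directions (x := x) (i0 := i0) (k₀ := k₀) hS
    (by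
      intro k hk S' hS' hinf
      have hP : ∃ᶠ n in atTop, n + k ∈ S' ∧ n + k ∈ S := by
        rw [Nat.frequently_atTop_iff_infinite]
        refine Set.Infinite.mono (s := (fun n => n - k) '' (S' \ Set.Iio k)) ?_ ?_
        · rintro _ ⟨n, hn, rfl⟩
          have : n - k + k = n := Nat.sub_add_cancel (not_lt.mp hn.2)
          simp only [Set.mem_ofPred_eq, this]
          exact ⟨hn.1, hS' hn.1⟩
        · refine Set.Infinite.image ?_ (hinf.sdiff (Set.finite_Iio k))
          intro a ha c hc hac
          have h1 := not_lt.mp (Set.mem_Iio.not.mp ha.2)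
          have h2 := not_lt.mp (Set.mem_Iio.not.mp hc.2)
          simp only at hac
          omega
      obtain ⟨β, hβ, hfr⟩ := exists_direction_algebraic F hd hg hx horb hA hrel (k := k)
        (fun i => (hk₀ i).trans (Nat.pow_le_pow_right (by omega) hk)) hP
      refine ⟨β, hβ, ?_⟩
      rw [Nat.frequently_atTop_iff_infinite] at hfr
      refine Set.Infinite.mono (s := (fun n => n + k) ''
        {n | (n + k ∈ S' ∧ ∀ i, x n i = β i * x n i0) ∧ n + k ∈ S}) ?_
        (hfr.image (add_left_injective k).injOn)
      rintro _ ⟨n, hn, rfl⟩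
      exact ⟨hn.1.1, Nat.le_add_left _ _, by simpa using hn.1.2⟩)
  have hvals : ∀ l, ((fun n => x (n - (k₀ + l)) i0) '' (T l)).Infinite := by
    intro l
    refine Set.Infinite.image ?_ (hTinf l)
    intro a ha c hc hac
    have h1 := hT l a ha
    have h2 := hT l c hc
    have h3 : a - (k₀ + l) = c - (k₀ + l) := by
      refine hinj (funext fun i => ?_)
      rw [h1.2 i, h2.2 i]
      exact congrArg _ hac
    have := h1.1
    have := h2.1
    omega
  have hb1 : ∀ l, b l i0 = 1 := by
    intro l
    obtain ⟨_, ⟨n, hn, rfl⟩, hne⟩ := (hvals l).exists_notMem_finset {0}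
    have h1 := (hT l n hn).2 i0
    simp only [Finset.mem_singleton] at hne
    exact (mul_eq_right₀ hne).mp h1.symm
  have hstep : ∀ l, (∀ i, b l i = b (l + 1) i ^ d) ∧
      ∀ i m, eval (b (l + 1)) (homogeneousComponent m (g i)) =
        b (l + 1) i ^ d * eval (b (l + 1)) (homogeneousComponent m (g i0)) := by
    intro l
    refine direction_step (fun i => (hg i).imp_left fun h => by omega) (by omega) (hb1 _)
      (hvals (l + 1)) ?_
    rintro _ ⟨n, hn, rfl⟩ i
    have h1 := hT (l + 1) n hn
    have h2 := hT l n (hTmono l hn)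
    have h3 : n - (k₀ + l) = n - (k₀ + (l + 1)) + 1 := by omega
    rw [h3] at h2
    have h4 : (fun i => x (n - (k₀ + (l + 1))) i0 * b (l + 1) i) = x (n - (k₀ + (l + 1))) := by
      funext i
      rw [h1.2 i, mul_comm]
    have h5 : ∀ i, x (n - (k₀ + (l + 1))) i0 * b (l + 1) i = x (n - (k₀ + (l + 1))) i :=
      fun i => congrFun h4 i
    simp only [h5]
    rw [← hx, ← hx]
    exact h2.2 i
  obtain ⟨L, hL⟩ := exists_forward_invariant (T := Set.range fun p : Fin N × ℕ =>
      homogeneousComponent p.2 (g p.1) - X p.1 ^ d * homogeneousComponent p.2 (g i0))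
    (fun l => (hstep l).1) (by
      rintro _ ⟨⟨i, m⟩, rfl⟩ l
      rw [map_sub, map_mul, map_pow, eval_X, (hstep l).2 i m, sub_self])
  have hE : ∀ (j : ℕ) i m, eval (fun i => b L i ^ d ^ j) (homogeneousComponent m (g i)) =
        b L i ^ d ^ (j + 1) * eval (fun i => b L i ^ d ^ j) (homogeneousComponent m (g i0)) := by
    intro j i m
    have := hL _ ⟨(i, m), rfl⟩ j
    rw [map_sub, map_mul, map_pow, eval_X, sub_eq_zero] at this
    rw [this, ← pow_mul, ← pow_succ]
  have hg' : ∀ i, (g i).totalDegree < d := fun i => (hg i).elim (fun h => by omega) fun h => by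
    rw [h, totalDegree_zero]; omega
  have hline : ∀ j n, (∀ i, x n i = b L i * x n i0) →
      ∀ i, x (n + j) i = b L i ^ d ^ j * x (n + j) i0 := by
    intro j n hn
    induction j with
    | zero => simpa using hn
    | succ j ih =>
      intro i
      have h1 : x (n + j) = fun i => x (n + j) i0 * b L i ^ d ^ j := by
        funext i
        rw [ih i, mul_comm]
      have h2 : ∀ i, x (n + (j + 1)) i = (x (n + j) i0 * b L i ^ d ^ j) ^ d +
          eval (fun i => x (n + j) i0 * b L i ^ d ^ j) (g i) := by
        intro i
        rw [← add_assoc, hx, ← h1, ih i, mul_comm]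
      rw [h2, h2, eval_const_mul (hg' i), eval_const_mul (hg' i0), hb1, mul_add, Finset.mul_sum]
      congr 1
      · rw [mul_pow, ← pow_mul, ← pow_succ]
        ring
      · refine Finset.sum_congr rfl fun m _ => ?_
        rw [hE j i m]
        ring
  refine ⟨fun i => b L i ^ d ^ (k₀ + L), fun i => pow_ne_zero _ (hb0 L i), by simp [hb1],
    (hTinf L).mono fun n hn => ⟨hTS L hn, fun i => ?_⟩, fun j i m => ?_⟩
  · have := hline (k₀ + L) (n - (k₀ + L)) (hT L n hn).2 i
    rwa [Nat.sub_add_cancel (hT L n hn).1] at this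
  · have := hE (k₀ + L + j) i m
    simp only [← pow_mul, ← pow_add]
    rwa [add_assoc (k₀ + L) j 1] at this

/-- A ring homomorphism to an algebraically closed field extends along an integral extension. -/
theorem exists_extension_of_isIntegral {A R F : Type*} [CommRing A] [CommRing R] [Field F]
    [IsAlgClosed F] [Algebra A R] [Algebra.IsIntegral A R]
    (hinj : Function.Injective (algebraMap A R)) (f : A →+* F) :
    ∃ φ : R →+* F, ∀ a, φ (algebraMap A R a) = f a := by
  haveI hP : (RingHom.ker f).IsPrime := RingHom.ker_isPrime f
  obtain ⟨P, rfl⟩ : ∃ P, P = RingHom.ker f := ⟨_, rfl⟩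
  obtain ⟨Q, -, hQ, hQP⟩ := Ideal.exists_ideal_over_prime_of_isIntegral (S := R) (RingHom.ker f) ⊥
    (by
      intro a ha
      have h0 : algebraMap A R a = 0 := by simpa using ha
      have : a = 0 := hinj (by rw [h0, map_zero])
      rw [this]; exact zero_mem _)
  haveI : Q.LiesOver (RingHom.ker f) := ⟨hQP.symm⟩
  letI : Algebra (A ⧸ RingHom.ker f) F := (RingHom.kerLift f).toAlgebra
  have hinjF : Function.Injective (algebraMap (A ⧸ RingHom.ker f) F) := RingHom.kerLift_injective f
  have hinjR : Function.Injective (algebraMap (A ⧸ RingHom.ker f) (R ⧸ Q)) :=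
    FaithfulSMul.algebraMap_injective _ _
  haveI : Module.IsTorsionFree (A ⧸ RingHom.ker f) F := by
    exact Module.isTorsionFree_iff_algebraMap_injective.mpr hinjF
  haveI : Module.IsTorsionFree (A ⧸ RingHom.ker f) (R ⧸ Q) := by
    exact Module.isTorsionFree_iff_algebraMap_injective.mpr hinjR
  haveI : Algebra.IsAlgebraic (A ⧸ RingHom.ker f) (R ⧸ Q) := inferInstance
  obtain ⟨ψ⟩ : Nonempty ((R ⧸ Q) →ₐ[A ⧸ RingHom.ker f] F) := ⟨IsAlgClosed.lift⟩
  refine ⟨ψ.toRingHom.comp (Ideal.Quotient.mk Q), fun a => ?_⟩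
  have h1 : Ideal.Quotient.mk Q (algebraMap A R a) =
      algebraMap (A ⧸ RingHom.ker f) (R ⧸ Q) (Ideal.Quotient.mk _ a) := rfl
  change ψ (Ideal.Quotient.mk Q (algebraMap A R a)) = f a
  rw [h1, AlgHom.commutes]
  rfl

/-- A root of the specialised minimal polynomial is the value of an extended specialisation. -/
theorem exists_extension_of_root {A R F : Type*} [CommRing A] [CommRing R] [IsDomain A] [IsDomain R]
    [IsIntegrallyClosed A] [Field F] [IsAlgClosed F] [Algebra A R] [Algebra.IsIntegral A R]
    (hinj : Function.Injective (algebraMap A R)) (f : A →+* F) (y : R) (r : F)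
    (hr : (minpoly A y).eval₂ f r = 0) :
    ∃ φ : R →+* F, (∀ a, φ (algebraMap A R a) = f a) ∧ φ y = r := by
  have hy : IsIntegral A y := Algebra.IsIntegral.isIntegral y
  haveI : FaithfulSMul A R := (faithfulSMul_iff_algebraMap_injective A R).mpr hinj
  obtain ⟨ψ, hψ⟩ : ∃ ψ : Algebra.adjoin A {y} →+* F,
      (∀ a, ψ (algebraMap A _ a) = f a) ∧ ψ ⟨y, Algebra.self_mem_adjoin_singleton A y⟩ = r := by
    refine ⟨(AdjoinRoot.lift f r hr).comp (minpoly.equivAdjoin hy).symm.toRingEquiv.toRingHom,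
      fun a => ?_, ?_⟩
    · change AdjoinRoot.lift f r hr ((minpoly.equivAdjoin hy).symm (algebraMap A _ a)) = f a
      rw [AlgEquiv.commutes]
      exact AdjoinRoot.lift_of hr
    · change AdjoinRoot.lift f r hr ((minpoly.equivAdjoin hy).symm _) = r
      have : (minpoly.equivAdjoin hy) (AdjoinRoot.root _) =
          ⟨y, Algebra.self_mem_adjoin_singleton A y⟩ := by
        rw [minpoly.coe_equivAdjoin]
        simp [AdjoinRoot.Minpoly.toAdjoin]
      rw [← this, AlgEquiv.symm_apply_apply]
      exact AdjoinRoot.lift_root hr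
  haveI : Algebra.IsIntegral (Algebra.adjoin A {y}) R := by
    refine ⟨fun z => ?_⟩
    exact (Algebra.IsIntegral.isIntegral (R := A) z).tower_top
  obtain ⟨φ, hφ⟩ := exists_extension_of_isIntegral (A := Algebra.adjoin A {y}) (R := R)
    Subtype.val_injective ψ
  refine ⟨φ, fun a => ?_, ?_⟩
  · rw [← hψ.1 a, ← hφ]; rfl
  · rw [← hψ.2, ← hφ]; rfl

/-- A polynomial of polynomial growth of order `e` at the natural points has total degree at
most `e`. -/
theorem totalDegree_le_of_growth {s e : ℕ} {C : ℝ} (a : MvPolynomial (Fin s) ℚ)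
    (h : ∀ τ : Fin s → ℕ, |((eval (fun i => (τ i : ℚ)) a : ℚ) : ℝ)| ≤
      C * (1 + ∑ i, (τ i : ℝ)) ^ e) : a.totalDegree ≤ e := by
  by_contra hcon
  push Not at hcon
  have ha : a ≠ 0 := by rintro rfl; simp at hcon
  have hL : homogeneousComponent a.totalDegree a ≠ 0 := by
    intro h0
    obtain ⟨m, hm, hmd⟩ := Finset.exists_mem_eq_sup a.support
      (by simpa [Finset.nonempty_iff_ne_empty] using ha) (fun m => m.sum fun _ e => e)
    have hdeg : a.totalDegree = m.degree := by
      rw [show a.totalDegree = a.support.sup (fun m => m.sum fun _ e => e) from rfl, hmd]; rfl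
    have := congrArg (coeff m) h0
    rw [coeff_homogeneousComponent, if_pos hdeg.symm] at this
    exact (mem_support_iff.mp hm) (by simpa using this)
  obtain ⟨u, hu⟩ : ∃ u : Fin s → ℕ,
      eval (fun i => (u i : ℚ)) (homogeneousComponent a.totalDegree a) ≠ 0 := by
    by_contra hall
    push Not at hall
    apply hL
    apply MvPolynomial.funext_set (fun _ => Set.range ((↑) : ℕ → ℚ))
      (fun _ => Set.infinite_range_of_injective Nat.cast_injective)
    intro y hy
    have hy' : ∀ i, ∃ n : ℕ, (n : ℚ) = y i := fun i => hy i (Set.mem_univ i)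
    choose n hn using hy'
    rw [show y = fun i => (n i : ℚ) from funext fun i => (hn i).symm, hall n]
    simp
  obtain ⟨c, hc⟩ : ∃ c : ℕ → ℝ, c = fun m =>
    ((eval (fun i => (u i : ℚ)) (homogeneousComponent m a) : ℚ) : ℝ) := ⟨_, rfl⟩
  obtain ⟨p, hp⟩ : ∃ p : Polynomial ℝ, p = ∑ m ∈ Finset.range (a.totalDegree + 1),
    Polynomial.monomial m (c m) := ⟨_, rfl⟩
  have hpdeg : ((Polynomial.X : Polynomial ℝ) ^ e).degree < p.degree := by
    rw [Polynomial.degree_X_pow]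
    refine lt_of_lt_of_le (Nat.cast_lt.mpr hcon) (Polynomial.le_degree_of_ne_zero ?_)
    rw [hp, Polynomial.finsetSum_coeff, Finset.sum_eq_single_of_mem a.totalDegree (by simp)]
    · rw [Polynomial.coeff_monomial_same, hc]; exact Rat.cast_ne_zero.mpr hu
    · intro m _ hm; rw [Polynomial.coeff_monomial, if_neg hm]
  have heval : ∀ t : ℕ, p.eval (t : ℝ) =
      ((eval (fun i => ((t * u i : ℕ) : ℚ)) a : ℚ) : ℝ) := by
    intro t
    have := eval_const_mul (p := a) (D := a.totalDegree + 1) (Nat.lt_succ_self _) (t : ℚ)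
      (fun i => (u i : ℚ))
    push_cast
    rw [this, hp, Polynomial.eval_finsetSum]
    push_cast
    refine Finset.sum_congr rfl fun m _ => ?_
    rw [Polynomial.eval_monomial, hc, mul_comm]
  have hlim := (Polynomial.abs_div_tendsto_atTop_atTop_of_degree_gt p (Polynomial.X ^ e) hpdeg
    (pow_ne_zero _ Polynomial.X_ne_zero)).comp tendsto_natCast_atTop_atTop
  obtain ⟨t, ht1, ht2⟩ := ((hlim.eventually_gt_atTop
    (|C| * (1 + ∑ i, (u i : ℝ)) ^ e)).and (eventually_ge_atTop 1)).exists
  have ht0 : (1 : ℝ) ≤ t := by exact_mod_cast ht2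
  have htp : (0 : ℝ) < (t : ℝ) ^ e := by positivity
  simp only [Function.comp_apply, Polynomial.eval_pow, Polynomial.eval_X, abs_div,
    abs_of_pos htp] at ht1
  rw [lt_div_iff₀ htp, heval] at ht1
  have h2 := h fun i => t * u i
  have hsum : (1 + ∑ i, ((t * u i : ℕ) : ℝ)) ≤ (1 + ∑ i, (u i : ℝ)) * t := by
    push_cast
    rw [← Finset.mul_sum]
    nlinarith
  have h3 : C * (1 + ∑ i, ((t * u i : ℕ) : ℝ)) ^ e ≤
      |C| * (1 + ∑ i, (u i : ℝ)) ^ e * (t : ℝ) ^ e := by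
    rw [mul_assoc, ← mul_pow]
    have hnn : (0 : ℝ) ≤ 1 + ∑ i, ((t * u i : ℕ) : ℝ) := by positivity
    exact mul_le_mul (le_abs_self C) (pow_le_pow_left₀ hnn hsum e) (by positivity) (abs_nonneg _)
  linarith

/-- Polynomials of bounded total degree whose values at every natural point lie in a finite set
form a finite set. -/
theorem finite_of_values {s e : ℕ} {V : (Fin s → ℕ) → Set ℚ} (hV : ∀ τ, (V τ).Finite) :
    {a : MvPolynomial (Fin s) ℚ | a.totalDegree ≤ e ∧
      ∀ τ : Fin s → ℕ, eval (fun i => (τ i : ℚ)) a ∈ V τ}.Finite := by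
  refine Set.Finite.of_finite_image
    (f := fun a (τ : Fin s → Fin (e + 1)) => eval (fun i => ((τ i : ℕ) : ℚ)) a) ?_ ?_
  · refine (Set.Finite.pi (t := fun τ : Fin s → Fin (e + 1) => V fun i => τ i)
      fun τ => hV _).subset ?_
    rintro _ ⟨a, ha, rfl⟩ τ _
    exact ha.2 _
  · intro a ha b hb hab
    rw [← sub_eq_zero]
    refine MvPolynomial.eq_zero_of_eval_zero_at_prod_finset (a - b)
      (fun _ => (Finset.range (e + 1)).map Nat.castEmbedding) (fun i => ?_) fun y hy => ?_
    · rw [Finset.card_map, Finset.card_range]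
      exact Nat.lt_succ_of_le ((degreeOf_le_totalDegree _ i).trans
        ((totalDegree_sub a b).trans (max_le ha.1 hb.1)))
    · have hy' : ∀ i, ∃ n : ℕ, n < e + 1 ∧ (n : ℚ) = y i := fun i => by
        simpa using hy i
      choose n hn1 hn2 using hy'
      have := congrFun hab fun i => ⟨n i, hn1 i⟩
      rw [show y = fun i => (n i : ℚ) from funext fun i => (hn2 i).symm, map_sub, sub_eq_zero]
      exact this

/-- Monic split polynomials of bounded degree with roots in a finite set have finitely many
coefficients. -/
theorem finite_coeff_of_roots {F : Type*} [Field F] {Y : Set F} (hY : Y.Finite) (D : ℕ) :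
    {c : F | ∃ P : Polynomial F, ∃ k, P.Monic ∧ P.Splits ∧ P.natDegree ≤ D ∧
      (∀ r ∈ P.roots, r ∈ Y) ∧ c = P.coeff k}.Finite := by
  classical
  have hfin : {m : Multiset F | m ≤ D • hY.toFinset.val}.Finite := Set.finite_Iic _
  refine (((hfin.image fun m => (m.map fun r => Polynomial.X - Polynomial.C r).prod).biUnion
    (t := fun P => P.coeff '' (Set.Iic D)) fun P _ => (Set.finite_Iic D).image _).union
    (Set.finite_singleton 0)).subset ?_
  rintro c ⟨P, k, hm, hs, hd, hr, rfl⟩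
  by_cases hk : k ≤ D
  · left
    simp only [Set.mem_iUnion]
    refine ⟨P, ⟨P.roots, ?_, ?_⟩, k, hk, rfl⟩
    · show P.roots ≤ _
      rw [Multiset.le_iff_count]
      intro r
      by_cases hrm : r ∈ P.roots
      · rw [Multiset.count_nsmul, Multiset.count_eq_one_of_mem hY.toFinset.nodup
          (by simpa using hr r hrm), mul_one]
        exact (Multiset.count_le_card _ _).trans ((P.card_roots').trans hd)
      · rw [Multiset.count_eq_zero_of_notMem hrm]; exact Nat.zero_le _
    · exact (hs.eq_prod_roots_of_monic hm).symm
  · right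
    exact Polynomial.coeff_eq_zero_of_natDegree_lt (by omega)

/-- A finite orbit of a perturbed power map is bounded by the coefficients of the
perturbation. -/
theorem norm_le_of_finite_orbit {N d : ℕ} (hd : 2 ≤ d) {g : Fin N → MvPolynomial (Fin N) ℂ}
    (hg : ∀ i, (g i).totalDegree < d) {z : ℕ → Fin N → ℂ}
    (hz : ∀ n i, z (n + 1) i = z n i ^ d + eval (z n) (g i)) (hfin : (Set.range z).Finite)
    {B : ℝ} (hB : ∀ i, ∑ m ∈ (g i).support, ‖coeff m (g i)‖ ≤ B) (hB0 : 0 ≤ B) (n : ℕ) (i : Fin N) :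
    ‖z n i‖ ≤ 1 + B := by
  obtain ⟨⟨n₀, i₀⟩, -, hmax⟩ : ∃ y ∈ (Set.univ : Set (ℕ × Fin N)),
      ∀ y' ∈ (Set.univ : Set (ℕ × Fin N)),
      ‖z y'.1 y'.2‖ ≤ ‖z y.1 y.2‖ := by
    have hfin' : (Set.range fun y : ℕ × Fin N => ‖z y.1 y.2‖).Finite := by
      refine ((hfin.prod (Set.finite_univ (α := Fin N))).image
        fun y : (Fin N → ℂ) × Fin N => ‖y.1 y.2‖).subset ?_
      rintro _ ⟨y, rfl⟩
      exact ⟨(z y.1, y.2), ⟨⟨_, rfl⟩, trivial⟩, rfl⟩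
    obtain ⟨_, ⟨y, rfl⟩, hy⟩ := Set.exists_max_image _ id hfin' ⟨_, (n, i), rfl⟩
    exact ⟨y, trivial, fun y' _ => hy _ ⟨y', rfl⟩⟩
  refine (hmax (n, i) trivial).trans ?_
  by_contra hcon
  push Not at hcon
  obtain ⟨X, hX⟩ : ∃ X, X = ‖z n₀ i₀‖ := ⟨_, rfl⟩
  simp only [← hX] at hcon hmax
  have hX1 : 1 < X := by linarith
  have hgle : ‖eval (z n₀) (g i₀)‖ ≤ B * X ^ (d - 1) := by
    rw [eval_eq]
    refine (norm_sum_le _ _).trans ?_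
    refine le_trans (Finset.sum_le_sum (g := fun m => ‖coeff m (g i₀)‖ * X ^ (d - 1))
      fun m hm => ?_) ?_
    · rw [norm_mul, norm_prod]
      refine mul_le_mul_of_nonneg_left ?_ (norm_nonneg _)
      calc ∏ j ∈ m.support, ‖z n₀ j ^ m j‖ ≤ ∏ j ∈ m.support, X ^ m j := by
            refine Finset.prod_le_prod (fun _ _ => norm_nonneg _) fun j _ => ?_
            rw [norm_pow]
            exact pow_le_pow_left₀ (norm_nonneg _) (hmax (n₀, j) trivial) _
        _ = X ^ (∑ j ∈ m.support, m j) := Finset.prod_pow_eq_pow_sum _ _ _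
        _ ≤ X ^ (d - 1) := by
            refine pow_le_pow_right₀ hX1.le ?_
            have := le_totalDegree hm
            have h2 := hg i₀
            rw [Finsupp.sum] at this
            omega
    · rw [← Finset.sum_mul]
      exact mul_le_mul_of_nonneg_right (hB i₀) (by positivity)
  have hnext := hmax (n₀ + 1, i₀) trivial
  simp only [hz] at hnext
  have h1 : X ^ d - B * X ^ (d - 1) ≤ X := by
    have := norm_sub_le_norm_add (z n₀ i₀ ^ d) (eval (z n₀) (g i₀))
    rw [norm_pow, ← hX] at this
    linarith
  have h2 : X ^ d = X * X ^ (d - 1) := by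
    rw [← pow_succ']; congr 1; omega
  have h3 : X ≤ X ^ (d - 1) := by
    calc X = X ^ 1 := (pow_one X).symm
      _ ≤ _ := pow_le_pow_right₀ hX1.le (by omega)
  have h4 : (0 : ℝ) < X ^ (d - 1) := by positivity
  nlinarith

theorem norm_root_le_of_monic {p : Polynomial ℂ} (hp : p.Monic) {z : ℂ} (hz : p.IsRoot z) :
    ‖z‖ ≤ (∑ k ∈ Finset.range p.natDegree, ‖p.coeff k‖) + 1 := by
  have h := (hz.norm_lt_cauchyBound hp.ne_zero).le
  have h2 : p.cauchyBound ≤ (∑ k ∈ Finset.range p.natDegree, ‖p.coeff k‖₊) + 1 := by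
    rw [Polynomial.cauchyBound, hp.leadingCoeff]
    simp only [nnnorm_one, div_one]
    gcongr
    exact Finset.sup_le fun k hk =>
      Finset.single_le_sum (f := fun k => ‖p.coeff k‖₊) (fun _ _ => zero_le) hk
  have h3 := h.trans h2
  rw [← NNReal.coe_le_coe] at h3
  simpa using h3

/-- The values of an integral element under specialisations grow polynomially. -/
theorem exists_growth_of_isIntegral {s : ℕ} {R F : Type*} [CommRing R] [Field F] [CharZero F]
    [Algebra (MvPolynomial (Fin s) ℚ) R] (σ : F →+* ℂ) {c : R}
    (hc : IsIntegral (MvPolynomial (Fin s) ℚ) c) :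
    ∃ (C : ℝ) (e : ℕ), 0 ≤ C ∧ ∀ (τ : Fin s → ℕ) (φ : R →+* F),
      (∀ a, φ (algebraMap _ R a) = algebraMap ℚ F (eval (fun i => (τ i : ℚ)) a)) →
      ‖σ (φ c)‖ ≤ C * (1 + ∑ i, (τ i : ℝ)) ^ e := by
  obtain ⟨p, hp, hpc⟩ := hc
  choose C hC0 hC using fun k => norm_eval_le (p.coeff k)
  obtain ⟨e, he⟩ : ∃ e, ∀ k ∈ Finset.range p.natDegree, (p.coeff k).totalDegree ≤ e :=
    ⟨_, fun k hk => Finset.le_sup (f := fun k => (p.coeff k).totalDegree) hk⟩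
  refine ⟨(∑ k ∈ Finset.range p.natDegree, C k) + 1, e, ?_, fun τ φ hφ => ?_⟩
  · exact add_nonneg (Finset.sum_nonneg fun k _ => hC0 k) zero_le_one
  have hw : (1 : ℝ) ≤ 1 + ∑ i, (τ i : ℝ) := by
    have : (0 : ℝ) ≤ ∑ i, (τ i : ℝ) := by positivity
    linarith
  obtain ⟨w, hwd⟩ : ∃ w : ℝ, w = 1 + ∑ i, (τ i : ℝ) := ⟨_, rfl⟩
  rw [← hwd] at hw ⊢
  have hx : ‖fun i => (τ i : ℚ)‖ ≤ w := by
    rw [pi_norm_le_iff_of_nonneg (by linarith)]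
    intro i
    rw [hwd]
    have h1 : (τ i : ℝ) ≤ ∑ i, (τ i : ℝ) :=
      Finset.single_le_sum (f := fun i => (τ i : ℝ)) (fun _ _ => Nat.cast_nonneg _)
        (Finset.mem_univ i)
    have h2 : ‖((τ i : ℕ) : ℚ)‖ = (τ i : ℝ) := by
      rw [← Rat.norm_cast_real]
      simp
    rw [h2]; linarith
  obtain ⟨ψ, hψ⟩ : ∃ ψ : MvPolynomial (Fin s) ℚ →+* ℂ,
      ψ = (σ.comp φ).comp (algebraMap (MvPolynomial (Fin s) ℚ) R) := ⟨_, rfl⟩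
  have hψn : ∀ a, ‖ψ a‖ = ‖eval (fun i => (τ i : ℚ)) a‖ := by
    intro a
    rw [hψ]
    simp only [RingHom.comp_apply, hφ]
    rw [← RingHom.comp_apply, Subsingleton.elim (σ.comp (algebraMap ℚ F)) (Rat.castHom ℂ)]
    simp only [Rat.coe_castHom, Complex.norm_ratCast]
    rfl
  have hroot : (p.map ψ).IsRoot (σ (φ c)) := by
    rw [Polynomial.IsRoot, Polynomial.eval_map]
    have := congrArg (σ.comp φ) hpc
    rw [Polynomial.hom_eval₂, map_zero] at this
    rw [hψ]; exact this
  have h := norm_root_le_of_monic (hp.map ψ) hroot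
  rw [hp.natDegree_map] at h
  refine h.trans ?_
  rw [add_mul, Finset.sum_mul]
  refine add_le_add (Finset.sum_le_sum fun k hk => ?_) ?_
  · rw [Polynomial.coeff_map, hψn]
    exact hC k e (he k hk) _ w hw hx
  · rw [one_mul]; exact one_le_pow₀ hw

theorem map_totalDegree_le {R S ι : Type*} [CommSemiring R] [CommSemiring S] (f : R →+* S)
    (p : MvPolynomial ι R) : (map f p).totalDegree ≤ p.totalDegree :=
  Finset.sup_mono (support_map_subset f p)

theorem eval_map_comp {R S ι : Type*} [CommSemiring R] [CommSemiring S] (f : R →+* S)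
    (p : MvPolynomial ι R) (y : ι → R) : eval (fun i => f (y i)) (map f p) = f (eval y p) := by
  rw [eval_map, eval₂_comp]
  rfl

section Specialisation

variable {s N d : ℕ} {R F : Type*} [CommRing R] [Field F] [CharZero F]
  [Algebra (MvPolynomial (Fin s) ℚ) R]

theorem finite_orbit_growth [Algebra.IsIntegral (MvPolynomial (Fin s) ℚ) R] (σ : F →+* ℂ)
    (hd : 2 ≤ d) {g : Fin N → MvPolynomial (Fin N) R}
    (hg : ∀ i, (g i).totalDegree < d) {x : ℕ → Fin N → R}
    (hx : ∀ n i, x (n + 1) i = x n i ^ d + eval (x n) (g i))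
    (hfin : ∀ φ : R →+* F, (Set.range fun n i => φ (x n i)).Finite) :
    ∃ (C : ℝ) (e : ℕ), 0 ≤ C ∧ ∀ (τ : Fin s → ℕ) (φ : R →+* F),
      (∀ a, φ (algebraMap _ R a) = algebraMap ℚ F (eval (fun i => (τ i : ℚ)) a)) →
      ∀ n i, ‖σ (φ (x n i))‖ ≤ C * (1 + ∑ i, (τ i : ℝ)) ^ e := by
  choose C e hC0 hC using fun c : R => exists_growth_of_isIntegral (s := s) (F := F) σ
    (Algebra.IsIntegral.isIntegral (R := MvPolynomial (Fin s) ℚ) c)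
  obtain ⟨E, hE⟩ : ∃ E, ∀ i, ∀ m ∈ (g i).support, e (coeff m (g i)) ≤ E :=
    ⟨Finset.univ.sup fun i => (g i).support.sup fun m => e (coeff m (g i)), fun i m hm =>
      (Finset.le_sup (f := fun m => e (coeff m (g i))) hm).trans
        (Finset.le_sup (f := fun i => (g i).support.sup fun m => e (coeff m (g i)))
          (Finset.mem_univ i))⟩
  obtain ⟨D, hD⟩ : ∃ D, D = ∑ i, ∑ m ∈ (g i).support, C (coeff m (g i)) := ⟨_, rfl⟩
  have hD0 : 0 ≤ D := by
    rw [hD]; exact Finset.sum_nonneg fun i _ => Finset.sum_nonneg fun m _ => hC0 _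
  refine ⟨1 + D, E, by linarith, fun τ φ hφ n i => ?_⟩
  obtain ⟨w, hwd⟩ : ∃ w : ℝ, w = 1 + ∑ i, (τ i : ℝ) := ⟨_, rfl⟩
  have hw : 1 ≤ w := by
    have : (0 : ℝ) ≤ ∑ i, (τ i : ℝ) := by positivity
    linarith
  have key := norm_le_of_finite_orbit hd (g := fun i => map (σ.comp φ) (g i))
    (fun i => (map_totalDegree_le (σ.comp φ) (g i)).trans_lt (hg i)) (z := fun n i => σ (φ (x n i)))
    (fun n i => ?_) ?_ (B := D * w ^ E) (fun i => ?_) (by positivity) n i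
  · refine key.trans ?_
    rw [← hwd, add_mul, one_mul]
    have := one_le_pow₀ (n := E) hw
    linarith
  · rw [hx, map_add, map_add, map_pow, map_pow]
    congr 1
    exact (eval_map_comp (σ.comp φ) (g i) (x n)).symm
  · refine ((hfin φ).image fun y i => σ (y i)).subset ?_
    rintro _ ⟨n, rfl⟩
    exact ⟨_, ⟨n, rfl⟩, rfl⟩
  · rw [hD, Finset.sum_mul]
    refine le_trans ?_ (Finset.single_le_sum
      (f := fun i => (∑ m ∈ (g i).support, C (coeff m (g i))) * w ^ E)
      (fun i _ => mul_nonneg (Finset.sum_nonneg fun m _ => hC0 _) (by positivity))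
      (Finset.mem_univ i))
    refine (Finset.sum_le_sum_of_subset_of_nonneg (support_map_subset _ _)
      fun _ _ _ => norm_nonneg _).trans ?_
    rw [Finset.sum_mul]
    refine Finset.sum_le_sum fun m hm => ?_
    rw [coeff_map]
    refine (hC _ τ φ hφ).trans ?_
    rw [← hwd]
    exact mul_le_mul_of_nonneg_left (pow_le_pow_right₀ hw (hE i m hm)) (hC0 _)

/-- Specialisations above a given point extend to every root of a specialised minimal
polynomial. -/
theorem finite_values [Module.Finite (MvPolynomial (Fin s) ℚ) R] {x : ℕ → Fin N → R}
    (hfin : ∀ φ : R →+* F, (Set.range fun n i => φ (x n i)).Finite) (τ : Fin s → ℕ) :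
    {r : F | ∃ φ : R →+* F,
      (∀ a, φ (algebraMap _ R a) = algebraMap ℚ F (eval (fun i => (τ i : ℚ)) a)) ∧
      ∃ n i, r = φ (x n i)}.Finite := by
  letI : Algebra (MvPolynomial (Fin s) ℚ) F :=
    ((algebraMap ℚ F).comp (eval fun i => (τ i : ℚ))).toAlgebra
  haveI : Finite (R →ₐ[MvPolynomial (Fin s) ℚ] F) := inferInstance
  refine (Set.finite_iUnion fun φ : R →ₐ[MvPolynomial (Fin s) ℚ] F =>
    ((hfin φ.toRingHom).prod (Set.finite_univ (α := Fin N))).image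
      fun y : (Fin N → F) × Fin N => y.1 y.2).subset ?_
  rintro _ ⟨φ, hφ, n, i, rfl⟩
  rw [Set.mem_iUnion]
  exact ⟨{ φ with commutes' := hφ }, ((fun i => φ (x n i)), i), ⟨⟨n, rfl⟩, trivial⟩, rfl⟩

theorem exists_infinite_of_finite_map [IsDomain R] [IsAlgClosed F]
    [Module.Finite (MvPolynomial (Fin s) ℚ) R]
    (hinj : Function.Injective (algebraMap (MvPolynomial (Fin s) ℚ) R)) (σ : F →+* ℂ)
    (hd : 2 ≤ d) {g : Fin N → MvPolynomial (Fin N) R}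
    (hg : ∀ i, (g i).totalDegree < d) {x : ℕ → Fin N → R}
    (hx : ∀ n i, x (n + 1) i = x n i ^ d + eval (x n) (g i)) (hinf : (Set.range x).Infinite) :
    ∃ φ : R →+* F, (Set.range fun n i => φ (x n i)).Infinite := by
  by_contra hcon
  rw [not_exists] at hcon
  have hfin : ∀ φ : R →+* F, (Set.range fun n i => φ (x n i)).Finite := fun φ =>
    Set.not_infinite.mp (hcon φ)
  obtain ⟨C, e, hC0, hC⟩ := finite_orbit_growth (s := s) σ hd hg hx hfin
  have hintg : ∀ c : R, IsIntegral (MvPolynomial (Fin s) ℚ) c := Algebra.IsIntegral.isIntegral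
  obtain ⟨D, hD⟩ : ∃ D, ∀ c : R, (minpoly (MvPolynomial (Fin s) ℚ) c).natDegree ≤ D :=
    ⟨_, fun c => minpoly.natDegree_le_spanFinrank _ c⟩
  obtain ⟨f, hf⟩ : ∃ f : (Fin s → ℕ) → (MvPolynomial (Fin s) ℚ →+* F),
      f = fun τ => (algebraMap ℚ F).comp (eval fun i => (τ i : ℚ)) := ⟨_, rfl⟩
  have hroot : ∀ τ n i r, r ∈ ((minpoly (MvPolynomial (Fin s) ℚ) (x n i)).map (f τ)).roots →
      ∃ φ : R →+* F,
        (∀ a, φ (algebraMap _ R a) = algebraMap ℚ F (eval (fun i => (τ i : ℚ)) a)) ∧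
        φ (x n i) = r := by
    intro τ n i r hr
    obtain ⟨φ, h1, h2⟩ := exists_extension_of_root hinj (f τ) (x n i) r (by
      have := (Polynomial.mem_roots'.mp hr).2
      rwa [Polynomial.IsRoot, Polynomial.eval_map] at this)
    exact ⟨φ, fun a => by rw [h1, hf]; rfl, h2⟩
  obtain ⟨V, hV⟩ : ∃ V : (Fin s → ℕ) → Set ℚ, V = fun τ => {q | ∃ n i k,
      q = eval (fun i => (τ i : ℚ)) ((minpoly (MvPolynomial (Fin s) ℚ) (x n i)).coeff k)} :=
    ⟨_, rfl⟩
  have hVfin : ∀ τ, (V τ).Finite := by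
    intro τ
    refine Set.Finite.of_finite_image (f := algebraMap ℚ F) ?_ (algebraMap ℚ F).injective.injOn
    refine (finite_coeff_of_roots (finite_values hfin τ) D).subset ?_
    rintro _ ⟨q, hq, rfl⟩
    rw [hV] at hq
    obtain ⟨n, i, k, rfl⟩ := hq
    refine ⟨(minpoly (MvPolynomial (Fin s) ℚ) (x n i)).map (f τ), k,
      (minpoly.monic (hintg _)).map _, IsAlgClosed.splits _, ?_, fun r hr => ?_, ?_⟩
    · rw [(minpoly.monic (hintg _)).natDegree_map]; exact hD _
    · obtain ⟨φ, h1, h2⟩ := hroot τ n i r hr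
      exact ⟨φ, h1, n, i, h2.symm⟩
    · rw [Polynomial.coeff_map, hf]; rfl
  have hcoefdeg : ∀ n i k,
      ((minpoly (MvPolynomial (Fin s) ℚ) (x n i)).coeff k).totalDegree ≤ e * D := by
    intro n i k
    refine totalDegree_le_of_growth (C := max C 1 ^ D * D.choose (D / 2)) _ fun τ => ?_
    have hw : (1 : ℝ) ≤ 1 + ∑ i, (τ i : ℝ) := by
      have : (0 : ℝ) ≤ ∑ i, (τ i : ℝ) := by positivity
      linarith
    have h1 := Polynomial.coeff_bdd_of_roots_le (B := C * (1 + ∑ i, (τ i : ℝ)) ^ e)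
      (σ.comp (f τ)) (minpoly.monic (hintg (x n i))) (IsAlgClosed.splits _) (hD _) (fun z hz => ?_) k
    · rw [Polynomial.coeff_map] at h1
      have h2 : ‖(σ.comp (f τ)) ((minpoly (MvPolynomial (Fin s) ℚ) (x n i)).coeff k)‖ =
          |((eval (fun i => (τ i : ℚ)) ((minpoly (MvPolynomial (Fin s) ℚ) (x n i)).coeff k) : ℚ)
            : ℝ)| := by
        rw [hf]
        change ‖(σ.comp (algebraMap ℚ F)) _‖ = _
        rw [Subsingleton.elim (σ.comp (algebraMap ℚ F)) (Rat.castHom ℂ)]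
        simp only [Rat.coe_castHom, Complex.norm_ratCast]
      rw [h2] at h1
      refine h1.trans ?_
      have h3 : max (C * (1 + ∑ i, (τ i : ℝ)) ^ e) 1 ≤ max C 1 * (1 + ∑ i, (τ i : ℝ)) ^ e := by
        refine max_le (mul_le_mul_of_nonneg_right (le_max_left _ _) (by positivity)) ?_
        exact one_le_mul_of_one_le_of_one_le (le_max_right _ _) (one_le_pow₀ hw)
      calc _ ≤ (max C 1 * (1 + ∑ i, (τ i : ℝ)) ^ e) ^ D * (D.choose (D / 2) : ℝ) := by gcongr
        _ = _ := by rw [mul_pow, ← pow_mul]; ring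
    · rw [← Polynomial.map_map] at hz
      have hsplit : ((minpoly (MvPolynomial (Fin s) ℚ) (x n i)).map (f τ)).Splits :=
        IsAlgClosed.splits _
      rw [hsplit.roots_map, Multiset.mem_map] at hz
      obtain ⟨r, hr, rfl⟩ := hz
      obtain ⟨φ, h1, h2⟩ := hroot τ n i r hr
      rw [← h2]
      exact hC τ φ h1 n i
  have hcoef := finite_of_values (e := e * D) hVfin
  have hpoly : {P | ∃ n i, P = minpoly (MvPolynomial (Fin s) ℚ) (x n i)}.Finite := by
    refine Set.Finite.of_finite_image (f := fun P (k : Fin (D + 1)) => P.coeff k) ?_ ?_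
    · refine (Set.Finite.pi (t := fun _ : Fin (D + 1) => _) fun _ => hcoef).subset ?_
      rintro _ ⟨_, ⟨n, i, rfl⟩, rfl⟩ k _
      refine ⟨hcoefdeg n i k, fun τ => ?_⟩
      rw [hV]; exact ⟨n, i, k, rfl⟩
    · rintro _ ⟨n, i, rfl⟩ _ ⟨n', i', rfl⟩ h
      refine Polynomial.ext fun k => ?_
      by_cases hk : k ≤ D
      · exact congrFun h ⟨k, Nat.lt_succ_of_le hk⟩
      · rw [Polynomial.coeff_eq_zero_of_natDegree_lt ((hD _).trans_lt (not_le.mp hk)),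
          Polynomial.coeff_eq_zero_of_natDegree_lt ((hD _).trans_lt (not_le.mp hk))]
  have hval : {c : R | ∃ n i, c = x n i}.Finite := by
    refine (hpoly.biUnion fun P _ => P.rootSet_finite R).subset ?_
    rintro _ ⟨n, i, rfl⟩
    simp only [Set.mem_iUnion]
    refine ⟨_, ⟨n, i, rfl⟩, ?_⟩
    rw [Polynomial.mem_rootSet']
    refine ⟨?_, minpoly.aeval _ _⟩
    exact ((minpoly.monic (hintg _)).map _).ne_zero
  refine hinf ((Set.Finite.pi (t := fun _ : Fin N => {c : R | ∃ n i, c = x n i})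
    fun _ => hval).subset ?_)
  rintro _ ⟨n, rfl⟩ i _
  exact ⟨n, i, rfl⟩

end Specialisation

/-- An infinite orbit over a domain finitely generated over `ℚ` has a specialisation with
infinite orbit. -/
theorem exists_specialisation_infinite {R : Type*} [CommRing R] [IsDomain R] [Algebra ℚ R]
    [Algebra.FiniteType ℚ R] {F : Type*} [Field F] [CharZero F] [IsAlgClosed F] (σ : F →+* ℂ)
    {N d : ℕ} (hd : 2 ≤ d) {g : Fin N → MvPolynomial (Fin N) R}
    (hg : ∀ i, (g i).totalDegree < d) {x : ℕ → Fin N → R}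
    (hx : ∀ n i, x (n + 1) i = x n i ^ d + eval (x n) (g i)) (hinf : (Set.range x).Infinite) :
    ∃ φ : R →+* F, (Set.range fun n i => φ (x n i)).Infinite := by
  obtain ⟨s, ν, hν, hfin⟩ := exists_finite_inj_algHom_of_fg ℚ R
  letI := ν.toRingHom.toAlgebra
  haveI : Module.Finite (MvPolynomial (Fin s) ℚ) R := hfin
  exact exists_infinite_of_finite_map hν σ hd hg hx hinf

theorem exists_pow_mem_of_zeros {N : ℕ} {I : Ideal (MvPolynomial (Fin N) ℂ)}
    {p : MvPolynomial (Fin N) ℂ}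
    (h : ∀ y : Fin N → ℂ, (∀ q ∈ I, eval y q = 0) → eval y p = 0) : ∃ M : ℕ, p ^ M ∈ I := by
  have : p ∈ I.radical := by
    rw [← vanishingIdeal_zeroLocus_eq_radical (K := ℂ) I]
    intro y hy
    exact h y fun q hq => hy q hq
  exact this

theorem homogeneousComponent_mul_of_isHomogeneous {σ K : Type*} [CommSemiring K] {k : ℕ}
    {h : MvPolynomial σ K} (hh : h.IsHomogeneous k) (f : MvPolynomial σ K) (m : ℕ) :
    homogeneousComponent m (h * f) = if k ≤ m then h * homogeneousComponent (m - k) f else 0 := by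
  conv_lhs => rw [← sum_homogeneousComponent f, Finset.mul_sum, map_sum]
  have h1 : ∀ j, homogeneousComponent m (h * homogeneousComponent j f) =
      if k + j = m then h * homogeneousComponent j f else 0 := fun j => by
    rw [homogeneousComponent_of_mem (hh.mul (homogeneousComponent_isHomogeneous j f))]
    simp only [eq_comm]
  simp only [h1]
  split_ifs with hk
  · by_cases hm : m - k ≤ f.totalDegree
    · rw [Finset.sum_eq_single_of_mem (m - k) (by simpa using Nat.lt_succ_of_le hm),
        if_pos (by omega)]
      intro j _ hj
      rw [if_neg (by omega)]
    · rw [homogeneousComponent_eq_zero _ _ (not_le.mp hm), mul_zero]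
      refine Finset.sum_eq_zero fun j hj => ?_
      rw [if_neg]
      have := Finset.mem_range.mp hj
      omega
  · exact Finset.sum_eq_zero fun j _ => by rw [if_neg (by omega)]

/-- `ℓ` is the degree `M` part of a polynomial of total degree at most `M` vanishing on `C`. -/
def IsLeadingForm {N : ℕ} (C : Set (Fin N → ℂ)) (M : ℕ) (l : MvPolynomial (Fin N) ℂ) : Prop :=
  ∃ p : MvPolynomial (Fin N) ℂ, (∀ y ∈ C, eval y p = 0) ∧ p.totalDegree ≤ M ∧
    homogeneousComponent M p = l

section

variable {N : ℕ} {C : Set (Fin N → ℂ)} {M : ℕ} {l l' h : MvPolynomial (Fin N) ℂ}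

theorem IsLeadingForm.zero : IsLeadingForm C M 0 := ⟨0, by simp, by simp, by simp⟩

theorem IsLeadingForm.add (h1 : IsLeadingForm C M l) (h2 : IsLeadingForm C M l') :
    IsLeadingForm C M (l + l') := by
  obtain ⟨p, hp, hpd, rfl⟩ := h1
  obtain ⟨q, hq, hqd, rfl⟩ := h2
  refine ⟨p + q, fun y hy => by rw [map_add, hp y hy, hq y hy, add_zero],
    (totalDegree_add _ _).trans (max_le hpd hqd), map_add _ _ _⟩

theorem IsLeadingForm.mul {k : ℕ} (hh : h.IsHomogeneous k) (h1 : IsLeadingForm C M l) :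
    IsLeadingForm C (k + M) (h * l) := by
  obtain ⟨p, hp, hpd, rfl⟩ := h1
  refine ⟨h * p, fun y hy => by rw [map_mul, hp y hy, mul_zero],
    (totalDegree_mul _ _).trans (add_le_add hh.totalDegree_le hpd), ?_⟩
  rw [homogeneousComponent_mul_of_isHomogeneous hh, if_pos (Nat.le_add_right _ _),
    Nat.add_sub_cancel_left]

theorem IsLeadingForm.sum {ι : Type*} (s : Finset ι) {f : ι → MvPolynomial (Fin N) ℂ}
    (hf : ∀ k ∈ s, IsLeadingForm C M (f k)) : IsLeadingForm C M (∑ k ∈ s, f k) :=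
  Finset.sum_induction f (IsLeadingForm C M) (fun _ _ => IsLeadingForm.add) IsLeadingForm.zero hf

/-- A leading form agrees on the set with a polynomial of smaller degree. -/
theorem IsLeadingForm.exists_eval_eq (hM : 0 < M) (h1 : IsLeadingForm C M l) :
    ∃ R : MvPolynomial (Fin N) ℂ, R.totalDegree < M ∧ ∀ y ∈ C, eval y l = eval y R := by
  obtain ⟨p, hp, hpd, rfl⟩ := h1
  refine ⟨homogeneousComponent M p - p, ?_, fun y hy => by
    rw [map_sub, hp y hy, sub_zero]⟩
  have hle : (homogeneousComponent M p - p).totalDegree ≤ M :=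
    (totalDegree_sub _ _).trans (max_le (homogeneousComponent_isHomogeneous M p).totalDegree_le hpd)
  rw [totalDegree, Finset.sup_lt_iff (by simpa using hM)]
  intro m hm
  refine lt_of_le_of_ne ((le_totalDegree hm).trans hle) fun heq => ?_
  rw [mem_support_iff, coeff_sub, coeff_homogeneousComponent,
    if_pos (show m.degree = M from heq), sub_self] at hm
  exact hm rfl

end

/-- The ideal generated by the leading forms of a set. -/
def leadingIdeal {N : ℕ} (C : Set (Fin N → ℂ)) : Ideal (MvPolynomial (Fin N) ℂ) where
  carrier := {f | ∀ m, IsLeadingForm C m (homogeneousComponent m f)}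
  zero_mem' m := by rw [map_zero]; exact IsLeadingForm.zero
  add_mem' hf hg m := by rw [map_add]; exact (hf m).add (hg m)
  smul_mem' c f hf m := by
    rw [smul_eq_mul, ← sum_homogeneousComponent c, Finset.sum_mul, map_sum]
    refine IsLeadingForm.sum _ fun k _ => ?_
    rw [homogeneousComponent_mul_of_isHomogeneous (homogeneousComponent_isHomogeneous k c)]
    split_ifs with hk
    · have := (hf (m - k)).mul (homogeneousComponent_isHomogeneous k c)
      rwa [Nat.add_sub_cancel' hk] at this
    · exact IsLeadingForm.zero

theorem mem_leadingIdeal_of_isLeadingForm {N M : ℕ} {C : Set (Fin N → ℂ)}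
    {l : MvPolynomial (Fin N) ℂ} (hl : IsLeadingForm C M l) : l ∈ leadingIdeal C := by
  intro m
  have hh : l.IsHomogeneous M := by
    obtain ⟨p, -, -, rfl⟩ := hl
    exact homogeneousComponent_isHomogeneous M p
  rw [homogeneousComponent_of_mem hh]
  split_ifs with h
  · rw [h]; exact hl
  · exact IsLeadingForm.zero

/-- If the points at infinity of `C` have no vanishing coordinate, then powers of each coordinate
are divisible by each other coordinate up to terms of lower degree. -/
theorem exists_integrality {N : ℕ} {C : Set (Fin N → ℂ)}
    (hC : ∀ a : Fin N → ℂ, a ≠ 0 → (∀ M l, IsLeadingForm C M l → eval a l = 0) → ∀ i, a i ≠ 0)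
    (i j : Fin N) : ∃ M, ∃ h R : MvPolynomial (Fin N) ℂ, h.totalDegree < M ∧ R.totalDegree < M ∧
      ∀ y ∈ C, y j ^ M = y i * eval y h + eval y R := by
  obtain ⟨M, hM⟩ := exists_pow_mem_of_zeros (I := leadingIdeal C ⊔ Ideal.span {X i}) (p := X j) (by
    intro y hy
    by_contra hyj
    rw [eval_X] at hyj
    refine hC y (fun h0 => hyj (by rw [h0]; rfl)) (fun M l hl => hy l
      (Ideal.mem_sup_left (mem_leadingIdeal_of_isLeadingForm hl))) i ?_
    have := hy (X i) (Ideal.mem_sup_right (Ideal.subset_span rfl))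
    rwa [eval_X] at this)
  have hM' : (X j : MvPolynomial (Fin N) ℂ) ^ (M + 1) ∈ leadingIdeal C ⊔ Ideal.span {X i} := by
    rw [pow_succ]; exact Ideal.mul_mem_right _ _ hM
  obtain ⟨f, hf, g, hg, hfg⟩ := Submodule.mem_sup.mp hM'
  obtain ⟨q, rfl⟩ := Ideal.mem_span_singleton'.mp hg
  have hcomp := congrArg (homogeneousComponent (M + 1)) hfg
  rw [map_add, mul_comm q, homogeneousComponent_mul_of_isHomogeneous (isHomogeneous_X ℂ i),
    if_pos (Nat.le_add_left _ _), Nat.add_sub_cancel,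
    homogeneousComponent_of_mem (isHomogeneous_X_pow j (M + 1)), if_pos rfl] at hcomp
  obtain ⟨R, hR, hRC⟩ := (hf (M + 1)).exists_eval_eq (Nat.succ_pos M)
  refine ⟨M + 1, homogeneousComponent M q, R, ?_, hR, fun y hy => ?_⟩
  · exact (homogeneousComponent_isHomogeneous M q).totalDegree_le.trans_lt (Nat.lt_succ_self M)
  · have := congrArg (eval y) hcomp
    rw [map_add, map_mul, map_pow, eval_X, eval_X, hRC y hy] at this
    rw [← this, add_comm]

theorem finite_of_relations {N : ℕ} {B : Type*} [CommRing B] [Algebra (Polynomial ℂ) B]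
    {π : MvPolynomial (Fin N) ℂ →+* B} (hπ : Function.Surjective π)
    (hc : ∀ c, π (C c) = algebraMap (Polynomial ℂ) B (Polynomial.C c)) {i0 : Fin N}
    (hX : π (X i0) = algebraMap (Polynomial ℂ) B Polynomial.X) {M : Fin N → ℕ}
    {h R : Fin N → MvPolynomial (Fin N) ℂ} (hh : ∀ j, (h j).totalDegree < M j)
    (hR : ∀ j, (R j).totalDegree < M j)
    (hrel : ∀ j, π (X j ^ M j) = π (X i0 * h j + R j)) : Module.Finite (Polynomial ℂ) B := by
  have hfin : {m : Fin N →₀ ℕ | ∀ j, m j < M j}.Finite :=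
    (Set.finite_Iic (Finsupp.equivFunOnFinite.symm M)).subset fun m hm j => (hm j).le
  obtain ⟨S, hS⟩ : ∃ S, S = Submodule.span (Polynomial ℂ)
    ((fun m => π (monomial m 1)) '' {m : Fin N →₀ ℕ | ∀ j, m j < M j}) := ⟨_, rfl⟩
  have key : ∀ n, ∀ p : MvPolynomial (Fin N) ℂ, p.totalDegree < n → π p ∈ S := by
    intro n
    induction n with
    | zero => intro p hp; omega
    | succ n ih =>
      intro p hp
      rw [p.as_sum, map_sum]
      refine Submodule.sum_mem _ fun m hm => ?_
      have hmn : m.degree ≤ n := (le_totalDegree hm).trans (Nat.lt_succ_iff.mp hp)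
      rw [← mul_one (coeff m p), ← C_mul_monomial, map_mul, hc, ← Algebra.smul_def]
      refine Submodule.smul_mem _ _ ?_
      by_cases hmM : ∀ j, m j < M j
      · rw [hS]; exact Submodule.subset_span ⟨m, hmM, rfl⟩
      · push Not at hmM
        obtain ⟨j, hj⟩ := hmM
        have hle : Finsupp.single j (M j) ≤ m := Finsupp.single_le_iff.mpr hj
        have hdeg : (m - Finsupp.single j (M j)).degree + M j = m.degree := by
          conv_rhs => rw [← tsub_add_cancel_of_le hle]
          rw [map_add, Finsupp.degree_single]
        have hmon : (monomial m (1 : ℂ)) = monomial (m - Finsupp.single j (M j)) 1 * X j ^ M j := by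
          rw [X_pow_eq_monomial, monomial_mul, tsub_add_cancel_of_le hle, mul_one]
        have hlt : ∀ q : MvPolynomial (Fin N) ℂ, q.totalDegree < M j →
            (monomial (m - Finsupp.single j (M j)) (1 : ℂ) * q).totalDegree < n := fun q hq => by
          have h1 := totalDegree_mul (monomial (m - Finsupp.single j (M j)) (1 : ℂ)) q
          have h2 : (monomial (m - Finsupp.single j (M j)) (1 : ℂ)).totalDegree ≤
            (m - Finsupp.single j (M j)).degree := totalDegree_monomial_le _ _
          omega
        rw [hmon, map_mul, hrel, map_add, map_mul, mul_add, mul_left_comm, hX, ← map_mul, ← map_mul,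
          ← Algebra.smul_def]
        exact add_mem (Submodule.smul_mem _ _ (ih _ (hlt _ (hh j)))) (ih _ (hlt _ (hR j)))
  refine ⟨⟨(hfin.image fun m => π (monomial m 1)).toFinset, ?_⟩⟩
  rw [Set.Finite.coe_toFinset, ← hS, eq_top_iff]
  intro b _
  obtain ⟨p, rfl⟩ := hπ b
  exact key _ p (Nat.lt_succ_self _)

/-- Every polynomial function satisfies a monic equation over the polynomials in `x_{i0}`. -/
theorem exists_monic_relation {N : ℕ} {C : Set (Fin N → ℂ)} {i0 : Fin N}
    (hI : ∀ j, ∃ M, ∃ h R : MvPolynomial (Fin N) ℂ, h.totalDegree < M ∧ R.totalDegree < M ∧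
      ∀ y ∈ C, y j ^ M = y i0 * eval y h + eval y R) (p : MvPolynomial (Fin N) ℂ) :
    ∃ P : Polynomial (Polynomial ℂ), P.Monic ∧ ∀ y ∈ C,
      (P.map (Polynomial.evalRingHom (y i0))).eval (eval y p) = 0 := by
  choose M h R hh hR hrel using hI
  obtain ⟨I, hI⟩ : ∃ I : Ideal (MvPolynomial (Fin N) ℂ), ∀ q, q ∈ I ↔ ∀ y ∈ C, eval y q = 0 :=
    ⟨vanishingIdeal ℂ C, fun q => Iff.rfl⟩
  letI alg : Algebra (Polynomial ℂ) (MvPolynomial (Fin N) ℂ ⧸ I) :=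
    ((Ideal.Quotient.mk I).comp
      (Polynomial.eval₂RingHom (MvPolynomial.C : ℂ →+* MvPolynomial (Fin N) ℂ) (X i0))).toAlgebra
  have halg : ∀ q : Polynomial ℂ, algebraMap (Polynomial ℂ) (MvPolynomial (Fin N) ℂ ⧸ I) q =
      Ideal.Quotient.mk I (q.eval₂ MvPolynomial.C (X i0)) := fun q => rfl
  haveI : Module.Finite (Polynomial ℂ) (MvPolynomial (Fin N) ℂ ⧸ I) := by
    refine finite_of_relations (π := Ideal.Quotient.mk I) Ideal.Quotient.mk_surjective
      (fun c => by rw [halg, Polynomial.eval₂_C]) (i0 := i0)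
      (by rw [halg, Polynomial.eval₂_X]) hh hR fun j => ?_
    rw [Ideal.Quotient.eq, hI]
    intro y hy
    rw [map_sub, map_pow, map_add, map_mul, eval_X, eval_X, hrel j y hy, sub_self]
  obtain ⟨P, hP, hPp⟩ := Algebra.IsIntegral.isIntegral (R := Polynomial ℂ)
    (Ideal.Quotient.mk I p)
  refine ⟨P, hP, fun y hy => ?_⟩
  have h1 := congrArg (Ideal.Quotient.lift I (eval y) fun q hq => (hI q).mp hq y hy) hPp
  rw [Polynomial.hom_eval₂, map_zero, Ideal.Quotient.lift_mk] at h1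
  rw [Polynomial.eval_map, ← h1]
  congr 1
  refine Polynomial.ringHom_ext (fun c => ?_) ?_
  · rw [RingHom.comp_apply, halg, Polynomial.eval₂_C, Ideal.Quotient.lift_mk]
    simp
  · rw [RingHom.comp_apply, halg, Polynomial.eval₂_X, Ideal.Quotient.lift_mk]
    simp

/-- An infinite closed set satisfying such relations is unbounded. -/
theorem not_bounded {N : ℕ} {C : Set (Fin N → ℂ)} {T : Set (MvPolynomial (Fin N) ℂ)}
    (hCT : C = {x | ∀ p ∈ T, eval x p = 0}) (hinf : C.Infinite) {i0 : Fin N}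
    (hI : ∀ j, ∃ M, ∃ h R : MvPolynomial (Fin N) ℂ, h.totalDegree < M ∧ R.totalDegree < M ∧
      ∀ y ∈ C, y j ^ M = y i0 * eval y h + eval y R) (B : ℝ) : ∃ y ∈ C, B < ‖y i0‖ := by
  by_contra hcon
  push Not at hcon
  obtain ⟨c, hc⟩ : ∃ c : ℂ, B < ‖c‖ := by
    refine ⟨((|B| + 1 : ℝ) : ℂ), ?_⟩
    rw [Complex.norm_real, Real.norm_eq_abs]
    have := le_abs_self B
    rw [abs_of_nonneg (by positivity)]; linarith
  obtain ⟨m, hm⟩ := exists_pow_mem_of_zeros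
    (I := Ideal.span T ⊔ Ideal.span {X i0 - MvPolynomial.C c}) (p := 1) (by
      intro y hy
      exfalso
      have hyC : y ∈ C := by
        rw [hCT]
        exact fun p hp => hy p (Ideal.mem_sup_left (Ideal.subset_span hp))
      have h2 := hy _ (Ideal.mem_sup_right (Ideal.subset_span (Set.mem_singleton _)))
      rw [map_sub, eval_X, eval_C, sub_eq_zero] at h2
      have := hcon y hyC
      rw [h2] at this
      linarith)
  rw [one_pow] at hm
  obtain ⟨f, hf, g, hg, hfg⟩ := Submodule.mem_sup.mp hm
  obtain ⟨q, rfl⟩ := Ideal.mem_span_singleton'.mp hg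
  have hq : ∀ y ∈ C, eval y q * (y i0 - c) = 1 := by
    intro y hy
    have hf0 : eval y f = 0 := by
      have hle : Ideal.span T ≤ RingHom.ker (eval y) := by
        rw [Ideal.span_le]
        intro p hp
        rw [hCT] at hy
        exact hy p hp
      exact hle hf
    have := congrArg (eval y) hfg
    simpa [hf0] using this
  obtain ⟨P, hP, hPC⟩ := exists_monic_relation hI q
  obtain ⟨U, hU⟩ : ∃ U : Polynomial ℂ, U = ∑ k ∈ Finset.range (P.natDegree + 1),
      P.coeff k * (Polynomial.X - Polynomial.C c) ^ (P.natDegree - k) := ⟨_, rfl⟩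
  have hU0 : U ≠ 0 := by
    intro h0
    have h1 := congrArg (Polynomial.eval c) (hU.symm.trans h0)
    rw [Polynomial.eval_finsetSum, Finset.sum_range_succ, Finset.sum_eq_zero, zero_add] at h1
    · simp [hP.coeff_natDegree] at h1
    · intro k hk
      have := Finset.mem_range.mp hk
      simp [show P.natDegree - k ≠ 0 by omega]
  have hUC : ∀ y ∈ C, U.eval (y i0) = 0 := by
    intro y hy
    have h1 := hPC y hy
    rw [Polynomial.eval_map, Polynomial.eval₂_eq_sum_range] at h1
    have h2 := congrArg (· * (y i0 - c) ^ P.natDegree) h1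
    simp only [zero_mul, Finset.sum_mul, Polynomial.coe_evalRingHom] at h2
    rw [hU, Polynomial.eval_finsetSum, ← h2]
    refine Finset.sum_congr rfl fun k hk => ?_
    have hk' : P.natDegree = k + (P.natDegree - k) := by
      have := Finset.mem_range.mp hk; omega
    conv_rhs => rw [hk', pow_add]
    have h3 : eval y q ^ k * (y i0 - c) ^ k = 1 := by rw [← mul_pow, hq y hy, one_pow]
    rw [Polynomial.eval_mul, Polynomial.eval_pow, Polynomial.eval_sub, Polynomial.eval_X,
      Polynomial.eval_C]
    linear_combination (-(Polynomial.eval (y i0) (P.coeff k) * (y i0 - c) ^ (P.natDegree - k))) * h3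
  refine hinf ?_
  choose P' hP' hPC' using fun j => exists_monic_relation hI (X j)
  refine (Set.Finite.pi (t := fun j => ⋃ t ∈ (U.roots.toFinset : Set ℂ),
    (((P' j).map (Polynomial.evalRingHom t)).roots.toFinset : Set ℂ)) fun j =>
      Set.Finite.biUnion (Finset.finite_toSet _) fun t _ => Finset.finite_toSet _).subset ?_
  intro y hy j _
  simp only [Set.mem_iUnion]
  refine ⟨y i0, ?_, ?_⟩
  · simpa [hU0] using hUC y hy
  · have h1 := hPC' j y hy
    rw [eval_X] at h1
    simp only [Finset.mem_coe, Multiset.mem_toFinset]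
    exact (Polynomial.mem_roots ((hP' j).map _).ne_zero).mpr h1

/-- Two coordinates satisfy a relation whose leading form is a nonzero binary form. -/
theorem exists_relation {N : ℕ} {C : Set (Fin N → ℂ)} (hne : C.Nonempty) {i0 : Fin N}
    (hI : ∀ j, ∃ M, ∃ h R : MvPolynomial (Fin N) ℂ, h.totalDegree < M ∧ R.totalDegree < M ∧
      ∀ y ∈ C, y j ^ M = y i0 * eval y h + eval y R) (i : Fin N) :
    ∃ (q : Polynomial ℂ) (M : ℕ), q ≠ 0 ∧ q.natDegree ≤ M ∧
      ∃ R : MvPolynomial (Fin N) ℂ, R.totalDegree < M ∧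
        ∀ y ∈ C, ∑ j ∈ Finset.range (M + 1), q.coeff j * y i ^ j * y i0 ^ (M - j) = eval y R := by
  classical
  obtain ⟨P, hP, hPC⟩ := exists_monic_relation hI (X i)
  obtain ⟨K, hK⟩ : ∃ K, ∀ j, (P.coeff j).natDegree ≤ K := by
    refine ⟨P.support.sup fun j => (P.coeff j).natDegree, fun j => ?_⟩
    by_cases hj : j ∈ P.support
    · exact Finset.le_sup (f := fun j => (P.coeff j).natDegree) hj
    · rw [Polynomial.notMem_support_iff.mp hj]; simp
  obtain ⟨c, hc⟩ : ∃ c : ℕ → ℕ → ℂ, ∀ j k, c j k = (P.coeff j).coeff k := ⟨_, fun _ _ => rfl⟩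
  obtain ⟨D, hD⟩ : ∃ D : Finset (ℕ × ℕ), ∀ a, a ∈ D ↔ c a.1 a.2 ≠ 0 := by
    refine ⟨(Finset.range (P.natDegree + 1) ×ˢ Finset.range (K + 1)).filter
      fun a => c a.1 a.2 ≠ 0, fun a => ?_⟩
    rw [Finset.mem_filter, Finset.mem_product, Finset.mem_range, Finset.mem_range]
    refine ⟨fun h => h.2, fun h => ⟨⟨?_, ?_⟩, h⟩⟩
    · by_contra hcon
      exact h (by rw [hc, Polynomial.coeff_eq_zero_of_natDegree_lt (p := P) (n := a.1) (by omega),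
        Polynomial.coeff_zero])
    · by_contra hcon
      have := hK a.1
      exact h (by rw [hc, Polynomial.coeff_eq_zero_of_natDegree_lt (by omega)])
  have hsum : ∀ y ∈ C, ∑ a ∈ D, c a.1 a.2 * y i ^ a.1 * y i0 ^ a.2 = 0 := by
    intro y hy
    have h1 := hPC y hy
    rw [eval_X, Polynomial.eval_map, Polynomial.eval₂_eq_sum_range] at h1
    have h2 : ∀ j, (Polynomial.evalRingHom (y i0)) (P.coeff j) * y i ^ j =
        ∑ k ∈ Finset.range (K + 1), c j k * y i ^ j * y i0 ^ k := by
      intro j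
      rw [Polynomial.coe_evalRingHom, Polynomial.eval_eq_sum_range' (Nat.lt_succ_of_le (hK j)),
        Finset.sum_mul]
      refine Finset.sum_congr rfl fun k _ => ?_
      rw [hc]; ring
    rw [Finset.sum_congr rfl fun j _ => h2 j, ← Finset.sum_product'] at h1
    rw [← h1]
    refine Finset.sum_subset ?_ ?_
    · intro a ha
      rw [hD] at ha
      rw [Finset.mem_product, Finset.mem_range, Finset.mem_range]
      refine ⟨?_, ?_⟩
      · by_contra hcon
        exact ha (by rw [hc, Polynomial.coeff_eq_zero_of_natDegree_lt (p := P) (n := a.1) (by omega),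
          Polynomial.coeff_zero])
      · by_contra hcon
        have := hK a.1
        exact ha (by rw [hc, Polynomial.coeff_eq_zero_of_natDegree_lt (by omega)])
    · intro a _ ha
      rw [hD, not_not] at ha
      rw [ha, zero_mul, zero_mul]
  have hn0 : (P.natDegree, 0) ∈ D := by
    rw [hD, hc, hP.coeff_natDegree]; simp
  have hn : 0 < P.natDegree := by
    rw [Nat.pos_iff_ne_zero]
    intro h0
    obtain ⟨y, hy⟩ := hne
    have := hPC y hy
    rw [hP.natDegree_eq_zero.mp h0] at this
    simp at this
  obtain ⟨⟨j₀, k₀⟩, hjk, hmax⟩ := D.exists_max_image (fun a => a.1 + a.2) ⟨_, hn0⟩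
  obtain ⟨M, hM⟩ : ∃ M, M = j₀ + k₀ := ⟨_, rfl⟩
  simp only [← hM] at hmax
  have hM0 : 0 < M := hn.trans_le (hmax _ hn0)
  obtain ⟨q, hq⟩ : ∃ q : Polynomial ℂ, q = ∑ j ∈ Finset.range (M + 1),
    Polynomial.monomial j (c j (M - j)) := ⟨_, rfl⟩
  have hqc : ∀ j ∈ Finset.range (M + 1), q.coeff j = c j (M - j) := by
    intro j hj
    rw [hq, Polynomial.finsetSum_coeff, Finset.sum_eq_single_of_mem j hj,
      Polynomial.coeff_monomial_same]
    intro l _ hl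
    rw [Polynomial.coeff_monomial, if_neg hl]
  refine ⟨q, M, ?_, ?_, -∑ a ∈ D.filter (fun a => ¬ a.1 + a.2 = M),
    MvPolynomial.C (c a.1 a.2) * X i ^ a.1 * X i0 ^ a.2, ?_, fun y hy => ?_⟩
  · intro h0
    have h1 := hqc j₀ (Finset.mem_range.mpr (by omega))
    rw [h0, Polynomial.coeff_zero, show M - j₀ = k₀ by omega] at h1
    exact (hD _).mp hjk h1.symm
  · rw [hq]
    refine Polynomial.natDegree_sum_le_of_forall_le _ _ fun j hj => ?_
    exact (Polynomial.natDegree_monomial_le _).trans (Nat.lt_succ_iff.mp (Finset.mem_range.mp hj))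
  · rw [totalDegree_neg]
    refine lt_of_le_of_lt (totalDegree_finsetSum_le (d := M - 1) fun a ha => ?_) (by omega)
    rw [Finset.mem_filter] at ha
    have h1 : a.1 + a.2 ≤ M := hmax a ha.1
    have h2 : (MvPolynomial.C (c a.1 a.2) * X i ^ a.1 * X i0 ^ a.2 :
        MvPolynomial (Fin N) ℂ).IsHomogeneous (0 + a.1 + a.2) :=
      ((isHomogeneous_C _ _).mul (isHomogeneous_X_pow i _)).mul (isHomogeneous_X_pow i0 _)
    have h3 := h2.totalDegree_le
    have h4 := ha.2
    omega
  · rw [map_neg, map_sum, eq_neg_iff_add_eq_zero, ← hsum y hy,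
      ← Finset.sum_filter_add_sum_filter_not D (fun a => a.1 + a.2 = M)]
    congr 1
    · rw [Finset.sum_congr rfl fun j hj => by rw [hqc j hj],
        ← Finset.Nat.sum_antidiagonal_eq_sum_range_succ (fun j k => c j k * y i ^ j * y i0 ^ k)]
      refine (Finset.sum_subset ?_ ?_).symm
      · intro a ha
        exact Finset.HasAntidiagonal.mem_antidiagonal.mpr (Finset.mem_filter.mp ha).2
      · intro a ha hna
        have : c a.1 a.2 = 0 := by
          by_contra h0
          exact hna (Finset.mem_filter.mpr ⟨(hD a).mpr h0, Finset.HasAntidiagonal.mem_antidiagonal.mp ha⟩)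
        rw [this, zero_mul, zero_mul]
    · refine Finset.sum_congr rfl fun a _ => ?_
      simp

theorem tail_degree {N : ℕ} (μ : Fin (N + 1) →₀ ℕ) : μ.degree = μ 0 + μ.tail.degree := by
  rw [Finsupp.degree_eq_sum, Finsupp.degree_eq_sum, Fin.sum_univ_succ]
  rfl

theorem eval_rep_eq_zero_iff {n m : ℕ} {q : MvPolynomial (Fin n) ℂ} (hq : q.IsHomogeneous m)
    {v : Fin n → ℂ} (hv : v ≠ 0) :
    eval (Projectivization.mk ℂ v hv).rep q = 0 ↔ eval v q = 0 := by
  obtain ⟨c, hc⟩ := Projectivization.exists_smul_eq_mk_rep ℂ v hv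
  rw [← hc]
  have : (c • v) = fun i => (c : ℂ) * v i := rfl
  rw [this, eval_const_mul_of_isHomogeneous hq, mul_eq_zero, or_iff_right (pow_ne_zero _ c.ne_zero)]

/-- A common zero of the leading forms is a point at infinity of the projective closure. -/
theorem coord_ne_zero_of_projClosure {N : ℕ} {C : Set (Fin N → ℂ)}
    (hT : ∀ Q ∈ DML.projClosure ℂ (DML.affToProj ℂ '' C) ∩ DML.Hinf ℂ N,
      ∀ i : Fin N, Q.rep i.succ ≠ 0) (a : Fin N → ℂ) (ha : a ≠ 0)
    (hl : ∀ M l, IsLeadingForm C M l → eval a l = 0) (i : Fin N) : a i ≠ 0 := by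
  have hv : (Fin.cons 0 a : Fin (N + 1) → ℂ) ≠ 0 := by
    intro h0
    apply ha
    funext j
    have := congrFun h0 j.succ
    simpa using this
  obtain ⟨c, hc⟩ := Projectivization.exists_smul_eq_mk_rep ℂ (Fin.cons 0 a : Fin (N + 1) → ℂ) hv
  have h1 := hT (Projectivization.mk ℂ (Fin.cons 0 a : Fin (N + 1) → ℂ) hv) ⟨?_, ?_⟩ i
  · intro h0
    apply h1
    rw [← hc, Pi.smul_apply, Fin.cons_succ, h0, smul_zero]
  · rintro Z ⟨⟨T, hTh, rfl⟩, hZ⟩ q hq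
    obtain ⟨m, hm⟩ := hTh q hq
    rw [eval_rep_eq_zero_iff hm]
    obtain ⟨p, hp⟩ : ∃ p : MvPolynomial (Fin N) ℂ,
      p = ∑ μ ∈ q.support, monomial μ.tail (coeff μ q) := ⟨_, rfl⟩
    have hdeg : ∀ μ ∈ q.support, μ 0 + μ.tail.degree = m := fun μ hμ => by
      rw [← tail_degree]
      have := hm (mem_support_iff.mp hμ)
      rw [← this, Finsupp.degree_eq_weight_one]
      rfl
    have key : eval a (homogeneousComponent m p) = eval (Fin.cons 0 a : Fin (N + 1) → ℂ) q := by
      rw [hp, map_sum, map_sum, eval_eq' _ q]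
      refine Finset.sum_congr rfl fun μ hμ => ?_
      rw [homogeneousComponent_of_mem (isHomogeneous_monomial (n := μ.tail.degree) _ rfl),
        Fin.prod_univ_succ, Fin.cons_zero]
      simp only [Fin.cons_succ]
      split_ifs with h
      · have h0 : μ 0 = 0 := by have := hdeg μ hμ; omega
        rw [h0, pow_zero, one_mul, eval_monomial, Finsupp.prod_fintype _ _ (by simp)]
        rfl
      · have h0 : μ 0 ≠ 0 := by have := hdeg μ hμ; omega
        rw [zero_pow h0, zero_mul, mul_zero, map_zero]
    rw [← key]
    refine hl m _ ⟨p, fun y hy => ?_, ?_, rfl⟩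
    · have h2 := hZ ⟨y, hy, rfl⟩ q hq
      rw [DML.affToProj, eval_rep_eq_zero_iff hm] at h2
      rw [← h2, hp, map_sum, eval_eq' _ q]
      refine Finset.sum_congr rfl fun μ hμ => ?_
      rw [Fin.prod_univ_succ, Fin.cons_zero, one_pow, one_mul, eval_monomial,
        Finsupp.prod_fintype _ _ (by simp)]
      simp only [Fin.cons_succ]
      rfl
    · rw [hp]
      refine totalDegree_finsetSum_le fun μ hμ => (totalDegree_monomial_le _ _).trans ?_
      have := hdeg μ hμ
      change μ.tail.degree ≤ m
      omega
  · change (Projectivization.mk ℂ (Fin.cons 0 a : Fin (N + 1) → ℂ) hv).rep 0 = 0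
    rw [← hc, Pi.smul_apply, Fin.cons_zero, smul_zero]

theorem exists_polynomial_map_eq_of_coeffs {R S : Type*} [CommRing R] [CommRing S] {ι : R →+* S}
    {p : Polynomial S} (hp : ∀ n, p.coeff n ∈ Set.range ι) : ∃ p' : Polynomial R, p'.map ι = p :=
  (Polynomial.mem_lifts p).mp ((Polynomial.lifts_iff_coeff_lifts p).mpr hp)

theorem totalDegree_map_add_three_le {R S σ : Type*} [CommSemiring R] [CommSemiring S] (φ : R →+* S)
    {d : ℕ} {p : MvPolynomial σ R} (hp : p.totalDegree + 3 ≤ d ∨ p = 0) :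
    (map φ p).totalDegree + 3 ≤ d ∨ map φ p = 0 := by
  rcases hp with h | h
  · left; have := map_totalDegree_le φ p; omega
  · right; rw [h, map_zero]

theorem HasIntegrality.map_of_lift {R F : Type*} [CommRing R] [Field F] {N : ℕ}
    {x : ℕ → Fin N → R} {S : Set ℕ} (φ : R →+* F)
    (h : ∀ i j : Fin N, ∃ M, ∃ h r : MvPolynomial (Fin N) R, h.totalDegree < M ∧ r.totalDegree < M ∧
      ∀ n ∈ S, x n j ^ M = x n i * eval (x n) h + eval (x n) r) :
    HasIntegrality (fun n i => φ (x n i)) S := by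
  intro i j
  obtain ⟨M, h, r, hh, hr, hrel⟩ := h i j
  refine ⟨M, map φ h, map φ r, (map_totalDegree_le φ h).trans_lt hh,
    (map_totalDegree_le φ r).trans_lt hr, fun n hn => ?_⟩
  rw [eval_map_comp, eval_map_comp, ← map_pow, hrel n hn, map_add, map_mul]

theorem HasRelation.map_of_lift {R F : Type*} [CommRing R] [Field F] {N : ℕ}
    {x : ℕ → Fin N → R} {S : Set ℕ} (φ : R →+* F) {i i0 : Fin N} {q : Polynomial R} {M : ℕ}
    (hu : IsUnit q.leadingCoeff) (hq : q.natDegree ≤ M)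
    (h : ∃ r : MvPolynomial (Fin N) R, r.totalDegree < M ∧ ∀ n ∈ S,
      ∑ j ∈ Finset.range (M + 1), q.coeff j * x n i ^ j * x n i0 ^ (M - j) = eval (x n) r) :
    HasRelation (fun n i => φ (x n i)) S i i0 (q.map φ) M := by
  obtain ⟨r, hr, hrel⟩ := h
  refine ⟨fun h0 => (hu.map φ).ne_zero ?_, Polynomial.natDegree_map_le.trans hq, map φ r,
    (map_totalDegree_le φ r).trans_lt hr, fun n hn => ?_⟩
  · rw [Polynomial.leadingCoeff, ← Polynomial.coeff_map, h0, Polynomial.coeff_zero]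
  · rw [eval_map_comp, ← hrel n hn, map_sum]
    simp only [Polynomial.coeff_map, map_mul, map_pow]

/-- The orbit `x` of `y ↦ y ^ d + g y` descends to finitely generated `ℚ`-algebras containing any
prescribed finite set and specialises to `F`, where infinitely many points indexed by `S` lie on
a direction `b` whose iterated powers are mapped to one another. -/
def HasSpecialisedDirections (F : Type) [Field F] {N : ℕ} (d : ℕ)
    (g : Fin N → MvPolynomial (Fin N) ℂ) (x : ℕ → Fin N → ℂ) (S : Set ℕ) (i0 : Fin N) : Prop :=
  ∀ E : Set ℂ, E.Finite → ∃ (R : Subalgebra ℚ ℂ) (φ : R →+* F) (x' : ℕ → Fin N → R)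
      (g' : Fin N → MvPolynomial (Fin N) R) (b : Fin N → F),
      E ⊆ R ∧ (∀ i, map (algebraMap R ℂ) (g' i) = g i) ∧ (∀ n i, (x' n i : ℂ) = x n i) ∧
      Function.Injective (fun n i => φ (x' n i)) ∧ (∀ i, b i ≠ 0) ∧ b i0 = 1 ∧
      {n | n ∈ S ∧ ∀ i, φ (x' n i) = b i * φ (x' n i0)}.Infinite ∧
      ∀ (j : ℕ) i m, eval (fun i => b i ^ d ^ j) (homogeneousComponent m (map φ (g' i))) =
        b i ^ d ^ (j + 1) *
          eval (fun i => b i ^ d ^ j) (homogeneousComponent m (map φ (g' i0)))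

theorem hasSpecialisedDirections (F : Type) [Field F] [CharZero F] [Algebra ℚ F]
    [Algebra.IsAlgebraic ℚ F] [IsAlgClosed F] {N d : ℕ} (hd : 2 ≤ d)
    {g : Fin N → MvPolynomial (Fin N) ℂ} {x : ℕ → Fin N → ℂ}
    (hg : ∀ i, (g i).totalDegree + 3 ≤ d ∨ g i = 0)
    (hx : ∀ n i, x (n + 1) i = x n i ^ d + eval (x n) (g i)) (horb : (Set.range x).Infinite)
    {S : Set ℕ} (hS : S.Infinite) (hA : HasIntegrality x S) {i0 : Fin N}
    {q : Fin N → Polynomial ℂ} {M : Fin N → ℕ} (hrel : ∀ i, HasRelation x S i i0 (q i) (M i)) :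
    HasSpecialisedDirections F d g x S i0 := by
  intro E hE
  choose m h r hh hr hintg using hA
  choose hq0 hqM rq hrq hrel using hrel
  obtain ⟨E', hE', hEfin⟩ : ∃ E' : Set ℂ, E' = (E ∪ Set.range (x 0)) ∪
      ((⋃ i, ((g i).coeffs : Set ℂ)) ∪ (⋃ i, ((rq i).coeffs : Set ℂ))) ∪
      ((⋃ i, ⋃ j, ((h i j).coeffs : Set ℂ)) ∪ (⋃ i, ⋃ j, ((r i j).coeffs : Set ℂ))) ∪
      ((⋃ i, ((q i).coeffs : Set ℂ)) ∪ Set.range fun i => (q i).leadingCoeff⁻¹) ∧ E'.Finite := by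
    refine ⟨_, rfl, ?_⟩
    refine (((hE.union (Set.finite_range _)).union ((Set.finite_iUnion fun i => ?_).union
      (Set.finite_iUnion fun i => ?_))).union ((Set.finite_iUnion fun i => Set.finite_iUnion
      fun j => ?_).union (Set.finite_iUnion fun i => Set.finite_iUnion fun j => ?_))).union
      ((Set.finite_iUnion fun i => ?_).union (Set.finite_range _)) <;> exact Finset.finite_toSet _
  obtain ⟨R, hR⟩ : ∃ R : Subalgebra ℚ ℂ, R = Algebra.adjoin ℚ E' := ⟨_, rfl⟩
  have hsub : E' ⊆ R := by rw [hR]; exact Algebra.subset_adjoin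
  haveI : Algebra.FiniteType ℚ R :=
    R.fg_iff_finiteType.mp (hR ▸ Subalgebra.fg_def.mpr ⟨E', hEfin, rfl⟩)
  have hι : Function.Injective (algebraMap R ℂ) := Subtype.val_injective
  have hmem : ∀ {a : ℂ}, a ∈ E' → a ∈ Set.range (algebraMap R ℂ) := fun {a} ha =>
    ⟨⟨a, hsub ha⟩, rfl⟩
  choose g' hg' hgd hge using fun i => exists_map_eq_of_coeffs hι (p := g i) fun a ha =>
    hmem (by
      rw [hE']; exact Or.inl (Or.inl (Or.inr (Or.inl (Set.mem_iUnion.mpr ⟨i, ha⟩)))))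
  choose rq' hrq' hrqd hrqe using fun i => exists_map_eq_of_coeffs hι (p := rq i) fun a ha =>
    hmem (by
      rw [hE']; exact Or.inl (Or.inl (Or.inr (Or.inr (Set.mem_iUnion.mpr ⟨i, ha⟩)))))
  choose h' hh' hhd hhe using fun i j => exists_map_eq_of_coeffs hι (p := h i j) fun a ha =>
    hmem (by
      rw [hE']
      exact Or.inl (Or.inr (Or.inl (Set.mem_iUnion.mpr ⟨i, Set.mem_iUnion.mpr ⟨j, ha⟩⟩))))
  choose r' hr' hrd hre using fun i j => exists_map_eq_of_coeffs hι (p := r i j) fun a ha =>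
    hmem (by
      rw [hE']
      exact Or.inl (Or.inr (Or.inr (Set.mem_iUnion.mpr ⟨i, Set.mem_iUnion.mpr ⟨j, ha⟩⟩))))
  choose q' hq' using fun i => exists_polynomial_map_eq_of_coeffs (ι := algebraMap R ℂ) (p := q i)
    fun n => by
      by_cases h0 : (q i).coeff n = 0
      · exact ⟨0, by rw [h0, map_zero]⟩
      · refine hmem ?_
        rw [hE']
        exact Or.inr (Or.inl (Set.mem_iUnion.mpr ⟨i, Polynomial.coeff_mem_coeffs h0⟩))
  have hxR : ∀ n, ∃ y : Fin N → R, ∀ i, (y i : ℂ) = x n i := by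
    intro n
    induction n with
    | zero =>
      choose y hy using fun i => hmem (a := x 0 i)
        (by rw [hE']; exact Or.inl (Or.inl (Or.inl (Or.inr ⟨i, rfl⟩))))
      exact ⟨y, hy⟩
    | succ n ih =>
      obtain ⟨y, hy⟩ := ih
      refine ⟨fun i => y i ^ d + eval y (g' i), fun i => ?_⟩
      have hy' : x n = fun i => algebraMap R ℂ (y i) := funext fun i => (hy i).symm
      rw [hx, hy', ← hge i y]
      rfl
  choose x' hx' using hxR
  have hx'' : ∀ n, x n = fun i => algebraMap R ℂ (x' n i) := fun n => funext fun i => (hx' n i).symm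
  have hxrec : ∀ n i, x' (n + 1) i = x' n i ^ d + eval (x' n) (g' i) := by
    intro n i
    apply hι
    rw [map_add, hge, ← hx'', map_pow]
    exact (hx' _ _).trans ((hx n i).trans (by rw [← hx' n i]; rfl))
  have hinf : (Set.range x').Infinite := by
    refine Set.infinite_range_of_injective fun a c hac => ?_
    refine injective_of_infinite_range (f := fun y i => y i ^ d + eval y (g i))
      (fun n => funext fun i => hx n i) horb ?_
    rw [hx'', hx'', hac]
  have hg3 : ∀ i, (g' i).totalDegree + 3 ≤ d ∨ g' i = 0 := by
    intro i
    rw [hgd]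
    refine (hg i).imp id fun h0 => ?_
    apply map_injective _ hι
    rw [hg', h0, map_zero]
  have hglt : ∀ i, (g' i).totalDegree < d := by
    intro i
    rcases hg3 i with h0 | h0
    · omega
    · rw [h0, totalDegree_zero]; omega
  let σ : F →+* ℂ :=
    (IsAlgClosed.lift : F →ₐ[ℚ] ℂ).toRingHom
  obtain ⟨φ, hφ⟩ := exists_specialisation_infinite (F := F) σ hd hglt hxrec hinf
  have hφrec : ∀ n i, φ (x' (n + 1) i) =
      φ (x' n i) ^ d + eval (fun i => φ (x' n i)) (map φ (g' i)) := by
    intro n i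
    rw [hxrec, map_add, map_pow, eval_map_comp]
  have hqd : ∀ i, (q' i).natDegree = (q i).natDegree := by
    intro i
    rw [← hq', Polynomial.natDegree_map_eq_of_injective hι]
  have hql : ∀ i, algebraMap R ℂ (q' i).leadingCoeff = (q i).leadingCoeff := by
    intro i
    rw [Polynomial.leadingCoeff, Polynomial.leadingCoeff, hqd, ← hq' i, Polynomial.coeff_map]
  obtain ⟨b, hb0, hb1, hbS, hbg⟩ := exists_invariant_direction F
    (g := fun i => map φ (g' i)) (x := fun n i => φ (x' n i)) hd
    (fun i => totalDegree_map_add_three_le φ (hg3 i)) hφrec hφ hS (i0 := i0)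
    (HasIntegrality.map_of_lift φ fun i j => ⟨m i j, h' i j, r' i j, by rw [hhd]; exact hh i j,
      by rw [hrd]; exact hr i j, fun n hn => hι (by
        rw [map_add, map_mul, map_pow, hhe, hre, ← hx'']
        have := hintg i j n hn
        rwa [← hx' n i, ← hx' n j] at this)⟩)
    (q := fun i => (q' i).map φ) (M := M)
    (fun i => HasRelation.map_of_lift φ (by
        obtain ⟨u, hu⟩ := hmem (a := (q i).leadingCoeff⁻¹)
          (by rw [hE']; exact Or.inr (Or.inr ⟨i, rfl⟩))
        refine IsUnit.of_mul_eq_one u (hι ?_)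
        rw [map_mul, hu, hql, map_one, mul_inv_cancel₀ (Polynomial.leadingCoeff_ne_zero.mpr (hq0 i))])
      (by rw [hqd]; exact hqM i)
      ⟨rq' i, by rw [hrqd]; exact hrq i, fun n hn => hι (by
        rw [hrqe, ← hx'', ← hrel i n hn, map_sum]
        refine Finset.sum_congr rfl fun j _ => ?_
        rw [map_mul, map_mul, map_pow, map_pow, ← hq' i, Polynomial.coeff_map, ← hx' n i,
          ← hx' n i0]
        rfl)⟩)
  refine ⟨R, φ, x', g', b, fun e he => hsub ?_, hg', hx', ?_, hb0, hb1, hbS, hbg⟩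
  · rw [hE']; exact Or.inl (Or.inl (Or.inl (Or.inl he)))
  · exact injective_of_infinite_range
      (f := fun y i => y i ^ d + eval y (map φ (g' i))) (fun n => funext fun i => hφrec n i) hφ

theorem homogeneousComponent_map {σ R S : Type*} [CommSemiring R] [CommSemiring S] (f : R →+* S)
    (m : ℕ) (p : MvPolynomial σ R) :
    homogeneousComponent m (map f p) = map f (homogeneousComponent m p) := by
  refine MvPolynomial.ext _ _ fun a => ?_
  rw [coeff_homogeneousComponent, coeff_map, coeff_map, coeff_homogeneousComponent]
  split_ifs <;> simp

theorem infinite_image_coord {F : Type*} [Field F] {N : ℕ} {z : ℕ → Fin N → F} {b : Fin N → F}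
    {i0 : Fin N} (hz : Function.Injective z) {S : Set ℕ} (hS : S.Infinite)
    (h : ∀ n ∈ S, ∀ i, z n i = b i * z n i0) : ((fun n => z n i0) '' S).Infinite := by
  refine hS.image fun n hn k hk hnk => hz (funext fun i => ?_)
  have hnk' : z n i0 = z k i0 := hnk
  rw [h n hn, h k hk, hnk']

/-- A closed set meeting the orbit along `S` contains a line through the origin. -/
theorem exists_line_subset {F : Type} [Field F] {N d : ℕ} {g : Fin N → MvPolynomial (Fin N) ℂ}
    {x : ℕ → Fin N → ℂ} {S : Set ℕ} {i0 : Fin N} (hspec : HasSpecialisedDirections F d g x S i0)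
    {T : Set (MvPolynomial (Fin N) ℂ)} (hT : ∀ n ∈ S, ∀ p ∈ T, eval (x n) p = 0) :
    ∃ a : Fin N → ℂ, a ≠ 0 ∧ ∀ p ∈ T, ∀ t : ℂ, eval (fun i => t * a i) p = 0 := by
  classical
  by_contra hcon
  obtain ⟨v, hv⟩ : ∃ v : T × ℕ → MvPolynomial (Fin N) ℂ,
      ∀ k, v k = homogeneousComponent k.2 k.1.1 := ⟨_, fun _ => rfl⟩
  obtain ⟨M, hM⟩ := exists_pow_mem_of_zeros (I := Ideal.span (Set.range v)) (p := X i0) (by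
    intro y hy
    by_contra hy0
    refine hcon ⟨y, fun h0 => hy0 (by rw [h0, eval_X]; rfl), fun p hp t => ?_⟩
    rw [eval_const_mul (Nat.lt_succ_self p.totalDegree)]
    refine Finset.sum_eq_zero fun m _ => ?_
    have := hy _ (Ideal.subset_span ⟨(⟨p, hp⟩, m), rfl⟩)
    rw [hv] at this
    rw [this, mul_zero])
  rw [Finsupp.mem_ideal_span_range_iff_exists_finsupp] at hM
  obtain ⟨c, hc⟩ := hM
  obtain ⟨R, φ, x', g', b, hER, -, hx', hinj, -, hb1, hinf, -⟩ := hspec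
    ((⋃ k ∈ c.support, ((c k).coeffs : Set ℂ)) ∪ ⋃ k ∈ c.support, (k.1.1.coeffs : Set ℂ))
    ((Set.Finite.biUnion c.support.finite_toSet fun _ _ => Finset.finite_toSet _).union
      (Set.Finite.biUnion c.support.finite_toSet fun _ _ => Finset.finite_toSet _))
  have hι : Function.Injective (algebraMap R ℂ) := Subtype.val_injective
  have hlc : ∀ k, ∃ c' : MvPolynomial (Fin N) R, k ∈ c.support → map (algebraMap R ℂ) c' = c k := by
    intro k
    by_cases hk : k ∈ c.support
    · obtain ⟨c', hc', -⟩ := exists_map_eq_of_coeffs hι (p := c k) fun a ha =>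
        ⟨⟨a, hER (Or.inl (Set.mem_biUnion hk ha))⟩, rfl⟩
      exact ⟨c', fun _ => hc'⟩
    · exact ⟨0, fun h => absurd h hk⟩
  have hlp : ∀ k, ∃ p' : MvPolynomial (Fin N) R, k ∈ c.support →
      map (algebraMap R ℂ) p' = k.1.1 := by
    intro k
    by_cases hk : k ∈ c.support
    · obtain ⟨p', hp', -⟩ := exists_map_eq_of_coeffs hι (p := k.1.1) fun a ha =>
        ⟨⟨a, hER (Or.inr (Set.mem_biUnion hk ha))⟩, rfl⟩
      exact ⟨p', fun _ => hp'⟩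
    · exact ⟨0, fun h => absurd h hk⟩
  choose c' hc' using hlc
  choose p' hp' using hlp
  have hX : ∑ k ∈ c.support, c' k * homogeneousComponent k.2 (p' k) =
      (X i0 : MvPolynomial (Fin N) R) ^ M := by
    apply map_injective _ hι
    rw [map_pow, map_X, ← hc, map_sum, Finsupp.sum]
    refine Finset.sum_congr rfl fun k hk => ?_
    rw [map_mul, ← homogeneousComponent_map, hc' k hk, hp' k hk, hv]
  have hzero : ∀ k ∈ c.support, eval b (homogeneousComponent k.2 (map φ (p' k))) = 0 := by
    intro k hk
    refine eval_homogeneousComponent_eq_zero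
      (infinite_image_coord hinj hinf fun n hn => hn.2) ?_ k.2
    rintro _ ⟨n, hn, rfl⟩
    have h1 : (fun i => φ (x' n i0) * b i) = fun i => φ (x' n i) :=
      funext fun i => by rw [hn.2 i, mul_comm]
    change eval (fun i => φ (x' n i0) * b i) _ = 0
    rw [h1, eval_map_comp]
    have h2 : eval (x' n) (p' k) = 0 := by
      apply hι
      rw [← eval_map_comp, hp' k hk, map_zero]
      exact (congrArg (fun y => eval y k.1.1) (funext fun i => hx' n i)).trans
        (hT n hn.1 _ k.1.2)
    rw [h2, map_zero]
  have h1 := congrArg (fun u => eval b (map φ u)) hX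
  simp only [map_sum, map_mul, map_pow, map_X, eval_X, hb1, one_pow] at h1
  rw [Finset.sum_eq_zero] at h1
  · exact zero_ne_one h1
  · intro k hk
    rw [← homogeneousComponent_map, hzero k hk, mul_zero]

theorem direction_invariant {F : Type} [Field F] {N d : ℕ} {g : Fin N → MvPolynomial (Fin N) ℂ}
    {x : ℕ → Fin N → ℂ} {S : Set ℕ} {i0 : Fin N} (hspec : HasSpecialisedDirections F d g x S i0)
    {a : Fin N → ℂ} (hline : ∀ n ∈ S, ∀ i, x n i = a i * x n i0) (j : ℕ) (i : Fin N) (m : ℕ) :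
    eval (fun i => a i ^ d ^ j) (homogeneousComponent m (g i)) =
      a i ^ d ^ (j + 1) * eval (fun i => a i ^ d ^ j) (homogeneousComponent m (g i0)) := by
  classical
  by_contra hne
  obtain ⟨δ, hδ⟩ : ∃ δ, δ = eval (fun i => a i ^ d ^ j) (homogeneousComponent m (g i)) -
      a i ^ d ^ (j + 1) * eval (fun i => a i ^ d ^ j) (homogeneousComponent m (g i0)) := ⟨_, rfl⟩
  have hδ0 : δ ≠ 0 := by rw [hδ]; exact sub_ne_zero.mpr hne
  obtain ⟨R, φ, x', g', b, hER, hg', hx', hinj, -, -, hinf, hbg⟩ := hspec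
    (Set.range a ∪ {δ⁻¹}) ((Set.finite_range a).union (Set.finite_singleton _))
  have hι : Function.Injective (algebraMap R ℂ) := Subtype.val_injective
  obtain ⟨a', ha'⟩ : ∃ a' : Fin N → R, ∀ i, algebraMap R ℂ (a' i) = a i :=
    ⟨fun i => ⟨a i, hER (Or.inl ⟨i, rfl⟩)⟩, fun _ => rfl⟩
  obtain ⟨u, hu⟩ : ∃ u : R, algebraMap R ℂ u = δ⁻¹ := ⟨⟨δ⁻¹, hER (Or.inr rfl)⟩, rfl⟩
  have hxa : ∀ n ∈ S, ∀ i, x' n i = a' i * x' n i0 := by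
    intro n hn i
    apply hι
    rw [map_mul, ha']
    exact (hx' n i).trans ((hline n hn i).trans (by rw [← hx' n i0]; rfl))
  have hab : ∀ i, φ (a' i) = b i := by
    obtain ⟨t, ht, ht0⟩ :=
      (infinite_image_coord hinj hinf fun n hn => hn.2).exists_notMem_finite (Set.finite_singleton 0)
    obtain ⟨n, hn, rfl⟩ := ht
    intro i
    have h1 := hn.2 i
    rw [hxa n hn.1 i, map_mul] at h1
    exact mul_right_cancel₀ ht0 h1
  have heval : ∀ k, algebraMap R ℂ (eval (fun i => a' i ^ d ^ j) (homogeneousComponent m (g' k))) =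
      eval (fun i => a i ^ d ^ j) (homogeneousComponent m (g k)) := by
    intro k
    rw [← eval_map_comp, ← homogeneousComponent_map, hg']
    simp only [map_pow, ha']
  have hevalφ : ∀ k, φ (eval (fun i => a' i ^ d ^ j) (homogeneousComponent m (g' k))) =
      eval (fun i => b i ^ d ^ j) (homogeneousComponent m (map φ (g' k))) := by
    intro k
    rw [← eval_map_comp, ← homogeneousComponent_map]
    simp only [map_pow, hab]
  have h1 : (eval (fun i => a' i ^ d ^ j) (homogeneousComponent m (g' i)) -
      a' i ^ d ^ (j + 1) * eval (fun i => a' i ^ d ^ j) (homogeneousComponent m (g' i0))) * u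
        = 1 := by
    apply hι
    rw [map_mul, map_sub, map_mul, heval, heval, hu, map_pow, ha', ← hδ, mul_inv_cancel₀ hδ0,
      map_one]
  have h2 := congrArg φ h1
  rw [map_mul, map_sub, map_mul, hevalφ, hevalφ, map_pow, hab, hbg j i m, sub_self, zero_mul,
    map_one] at h2
  exact zero_ne_one h2

theorem exists_pow_add_eval_eq {N d : ℕ} (hd : 2 ≤ d) {p : MvPolynomial (Fin N) ℂ}
    (hp : p.totalDegree < d) (c : Fin N → ℂ) (s : ℂ) :
    ∃ t : ℂ, t ^ d + eval (fun i => t * c i) p = s := by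
  obtain ⟨w, hw⟩ : ∃ w : Polynomial ℂ, w = ∑ m ∈ Finset.range d,
      Polynomial.C (eval c (homogeneousComponent m p)) * Polynomial.X ^ m - Polynomial.C s :=
    ⟨_, rfl⟩
  have hwd : w.degree < d := by
    rw [hw]
    refine (Polynomial.degree_sub_le _ _).trans_lt (max_lt ?_ ?_)
    · refine (Polynomial.degree_sum_le _ _).trans_lt ?_
      refine (Finset.sup_lt_iff (WithBot.bot_lt_coe d)).mpr fun m hm => ?_
      exact (Polynomial.degree_C_mul_X_pow_le _ _).trans_lt
        (WithBot.coe_lt_coe.mpr (Finset.mem_range.mp hm))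
    · exact Polynomial.degree_C_le.trans_lt (by exact_mod_cast (by omega : 0 < d))
  obtain ⟨t, ht⟩ := IsAlgClosed.exists_root (Polynomial.X ^ d + w) (by
    rw [Polynomial.degree_add_eq_left_of_degree_lt (by rwa [Polynomial.degree_X_pow]),
      Polynomial.degree_X_pow]
    exact_mod_cast (by omega : d ≠ 0))
  refine ⟨t, ?_⟩
  rw [eval_const_mul hp, ← sub_eq_zero, ← ht.eq_zero, hw]
  simp only [Polynomial.eval_add, Polynomial.eval_sub, Polynomial.eval_pow, Polynomial.eval_X,
    Polynomial.eval_finsetSum, Polynomial.eval_mul, Polynomial.eval_C]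
  rw [add_sub_assoc]
  congr 2
  exact Finset.sum_congr rfl fun m _ => mul_comm _ _

/-- The image of a line through the origin with invariant direction is such a line. -/
theorem image_line {N d : ℕ} (hd : 2 ≤ d) {g : Fin N → MvPolynomial (Fin N) ℂ}
    (hg : ∀ i, (g i).totalDegree < d) {i0 : Fin N} {c : Fin N → ℂ}
    (hc : ∀ i m, eval c (homogeneousComponent m (g i)) =
      c i ^ d * eval c (homogeneousComponent m (g i0))) :
    (fun y i => y i ^ d + eval y (g i)) '' (Set.range fun t : ℂ => t • c) =
      Set.range fun t : ℂ => t • fun i => c i ^ d := by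
  have key : ∀ t : ℂ, (fun i => (t • c) i ^ d + eval (t • c) (g i)) =
      (t ^ d + eval (fun i => t * c i) (g i0)) • fun i => c i ^ d := by
    intro t
    funext i
    change (t * c i) ^ d + eval (fun i => t * c i) (g i) =
      (t ^ d + eval (fun i => t * c i) (g i0)) * c i ^ d
    rw [eval_const_mul (hg i), eval_const_mul (hg i0), mul_pow, add_mul, Finset.sum_mul]
    congr 1
    refine Finset.sum_congr rfl fun m _ => ?_
    rw [hc]; ring
  ext y
  constructor
  · rintro ⟨_, ⟨t, rfl⟩, rfl⟩
    exact ⟨_, (key t).symm⟩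
  · rintro ⟨s, rfl⟩
    obtain ⟨t, ht⟩ := exists_pow_add_eval_eq hd (hg i0) c s
    refine ⟨_, ⟨t, rfl⟩, (key t).trans ?_⟩
    rw [ht]

theorem periodic_line {F : Type} [Field F] {N d : ℕ} (hd : 2 ≤ d)
    {g : Fin N → MvPolynomial (Fin N) ℂ} (hg : ∀ i, (g i).totalDegree < d)
    {x : ℕ → Fin N → ℂ} (hx : ∀ n, x (n + 1) = fun i => x n i ^ d + eval (x n) (g i))
    (hinj : Function.Injective x) {S : Set ℕ} (hS : S.Infinite) {i0 : Fin N}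
    (hspec : HasSpecialisedDirections F d g x S i0) {a : Fin N → ℂ} (ha1 : a i0 = 1)
    (hline : ∀ n ∈ S, ∀ i, x n i = a i * x n i0) :
    ∃ m : ℕ, 1 ≤ m ∧ (fun y i => y i ^ d + eval y (g i))^[m] '' (Set.range fun t : ℂ => t • a) =
      Set.range fun t : ℂ => t • a := by
  have hinv := direction_invariant hspec hline
  have himg : ∀ k : ℕ, (fun y i => y i ^ d + eval y (g i))^[k] ''
      (Set.range fun t : ℂ => t • a) = Set.range fun t : ℂ => t • fun i => a i ^ d ^ k := by
    intro k
    induction k with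
    | zero => simp
    | succ k ih =>
      rw [Function.iterate_succ', Set.image_comp, ih, image_line hd hg (i0 := i0)]
      · simp only [← pow_mul, ← pow_succ]
      · intro i m
        rw [← pow_mul, ← pow_succ]
        exact hinv k i m
  obtain ⟨n, hn⟩ := hS.nonempty
  have hS' : (S \ Set.Iic n).Infinite := hS.sdiff (Set.finite_Iic n)
  obtain ⟨t, ⟨n', hn', rfl⟩, ht0⟩ := (infinite_image_coord hinj hS' (b := a)
    fun k hk => hline k hk.1).exists_notMem_finite (Set.finite_singleton 0)
  have hlt : n < n' := not_le.mp hn'.2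
  obtain ⟨k, rfl⟩ := Nat.exists_eq_add_of_lt hlt
  have hmem : x (n + k + 1) ∈ (fun y i => y i ^ d + eval y (g i))^[k + 1] ''
      (Set.range fun t : ℂ => t • a) := by
    refine ⟨x n, ⟨x n i0, funext fun i => ?_⟩, ?_⟩
    · rw [hline n hn i, mul_comm]; rfl
    · have : ∀ l, (fun y i => y i ^ d + eval y (g i))^[l] (x n) = x (n + l) := by
        intro l
        induction l with
        | zero => rfl
        | succ l ih => rw [Function.iterate_succ_apply', ih, ← add_assoc, hx]
      exact this (k + 1)
  rw [himg] at hmem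
  obtain ⟨t, ht⟩ := hmem
  have ht' : ∀ i, t * a i ^ d ^ (k + 1) = x (n + k + 1) i := fun i => congrFun ht i
  have ht1 : t = x (n + k + 1) i0 := by
    rw [← ht' i0, ha1, one_pow, mul_one]
  refine ⟨k + 1, by omega, ?_⟩
  rw [himg]
  have : (fun i => a i ^ d ^ (k + 1)) = a := by
    funext i
    have h1 := ht' i
    rw [hline _ hn'.1 i, ht1, mul_comm] at h1
    exact mul_right_cancel₀ ht0 h1
  rw [this]

theorem affClosed_line {N : ℕ} {a : Fin N → ℂ} {i0 : Fin N} (ha : a i0 = 1) :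
    DML.AffClosed ℂ (Set.range fun t : ℂ => t • a) := by
  refine ⟨Set.range fun i => X i - C (a i) * X i0, ?_⟩
  ext y
  constructor
  · rintro ⟨t, rfl⟩ _ ⟨i, rfl⟩
    simp [ha, mul_comm]
  · intro hy
    refine ⟨y i0, funext fun i => ?_⟩
    have := hy _ ⟨i, rfl⟩
    simp only [map_sub, map_mul, eval_X, eval_C] at this
    rw [sub_eq_zero.mp this, mul_comm]
    rfl

theorem isLeadingForm_eval_eq_zero {N M : ℕ} {C : Set (Fin N → ℂ)} {l : MvPolynomial (Fin N) ℂ}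
    {a : Fin N → ℂ} (h : ∀ t : ℂ, t • a ∈ C) (hl : IsLeadingForm C M l) : eval a l = 0 := by
  obtain ⟨p, hp, -, rfl⟩ := hl
  exact eval_homogeneousComponent_eq_zero Set.infinite_univ (fun t _ => hp _ (h t)) M

/-- The dynamical Mordell–Lang statement for curves meeting infinity in the torus. -/
theorem exists_periodic_line {N d : ℕ} (hd : 2 ≤ d) {G : Fin N → MvPolynomial (Fin N) ℂ}
    (hG : ∀ i, (G i).totalDegree + 3 ≤ d ∨ G i = 0) (hGlt : ∀ i, (G i).totalDegree < d)
    {C : Set (Fin N → ℂ)} (hC : DML.IsIrredCurve ℂ C) (i0 : Fin N)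
    (hL : ∀ a : Fin N → ℂ, a ≠ 0 → (∀ M l, IsLeadingForm C M l → eval a l = 0) → ∀ i, a i ≠ 0)
    {x : Fin N → ℂ}
    (hinf : (C ∩ Set.range fun n : ℕ => (fun y i => y i ^ d + eval y (G i))^[n] x).Infinite) :
    DML.IsVertLine ℂ C ∧ DML.IsPerCurve ℂ (fun y i => y i ^ d + eval y (G i)) C := by
  obtain ⟨T, hCT⟩ := hC.closed
  obtain ⟨z, hz⟩ : ∃ z : ℕ → Fin N → ℂ,
    z = fun n : ℕ => (fun y i => y i ^ d + eval y (G i))^[n] x := ⟨_, rfl⟩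
  rw [← hz] at hinf
  have hzrec : ∀ n, z (n + 1) = fun i => z n i ^ d + eval (z n) (G i) := fun n => by
    rw [hz]; exact Function.iterate_succ_apply' _ _ _
  have hrange : (Set.range z).Infinite := hinf.mono Set.inter_subset_right
  have hS : {n | z n ∈ C}.Infinite := by
    refine Set.Infinite.of_image z (hinf.mono ?_)
    rintro _ ⟨hn, n, rfl⟩
    exact ⟨n, hn, rfl⟩
  have hzinj : Function.Injective z :=
    injective_of_infinite_range (f := fun y i => y i ^ d + eval y (G i)) hzrec hrange
  have hA : HasIntegrality z {n | z n ∈ C} := fun i j => by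
    obtain ⟨M, h, R, hh, hR, hrel⟩ := exists_integrality hL i j
    exact ⟨M, h, R, hh, hR, fun n hn => hrel _ hn⟩
  choose q M hq0 hqM R hR hrel using
    exists_relation hC.infinite.nonempty (exists_integrality hL i0)
  have hspec : HasSpecialisedDirections (AlgebraicClosure ℚ) d G z {n | z n ∈ C} i0 :=
    @hasSpecialisedDirections (AlgebraicClosure ℚ) _ _ (AlgebraicClosure.instAlgebra ℚ)
      (AlgebraicClosure.isAlgebraic ℚ) _ N d hd G z hG (fun n i => congrFun (hzrec n) i) hrange _ hS
      hA i0 q M fun i => ⟨hq0 i, hqM i, R i, hR i, fun n hn => hrel i _ hn⟩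
  obtain ⟨c, hc0, hc⟩ := exists_line_subset hspec (T := T) fun n hn p hp => by
    have hn' : z n ∈ C := hn
    rw [hCT] at hn'
    exact hn' p hp
  have hcC : ∀ t : ℂ, t • c ∈ C := fun t => by
    rw [hCT]; exact fun p hp => hc p hp t
  have hci : ∀ i, c i ≠ 0 := hL c hc0 fun M l hl => isLeadingForm_eval_eq_zero hcC hl
  obtain ⟨a, ha⟩ : ∃ a : Fin N → ℂ, a = (c i0)⁻¹ • c := ⟨_, rfl⟩
  have ha1 : a i0 = 1 := by rw [ha]; exact inv_mul_cancel₀ (hci i0)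
  have haC : (Set.range fun t : ℂ => t • a) ⊆ C := by
    rintro _ ⟨t, rfl⟩
    change t • a ∈ C
    rw [ha, smul_smul]
    exact hcC _
  have ha0 : a ≠ 0 := fun h0 => by simp [h0] at ha1
  have hCa : C = Set.range fun t : ℂ => t • a := by
    refine Set.Subset.antisymm ?_ haC
    by_contra hcon
    have hfin := hC.dim_le_one _ (affClosed_line ha1) hcon
    rw [Set.inter_eq_right.mpr haC] at hfin
    exact Set.infinite_range_of_injective (smul_left_injective ℂ ha0) hfin
  refine ⟨⟨a, ha0, hCa⟩, ?_⟩
  have hline : ∀ n ∈ {n | z n ∈ C}, ∀ i, z n i = a i * z n i0 := by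
    intro n hn i
    have hn' : z n ∈ C := hn
    rw [hCa] at hn'
    obtain ⟨t, ht⟩ := hn'
    have h1 : ∀ i, t * a i = z n i := fun i => congrFun ht i
    rw [← h1 i, ← h1 i0, ha1, mul_one, mul_comm]
  obtain ⟨m, hm, hper⟩ := periodic_line hd hGlt hzrec hzinj hS hspec ha1 hline
  exact ⟨m, hm, by rw [hCa]; exact hper⟩

/-- A periodic curve meeting infinity in the torus contains infinitely many points of an orbit. -/
theorem exists_infinite_orbit {N d : ℕ} (hd : 2 ≤ d) {G : Fin N → MvPolynomial (Fin N) ℂ}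
    (hGlt : ∀ i, (G i).totalDegree < d)
    {C : Set (Fin N → ℂ)} (hC : DML.IsIrredCurve ℂ C) (i0 : Fin N)
    (hL : ∀ a : Fin N → ℂ, a ≠ 0 → (∀ M l, IsLeadingForm C M l → eval a l = 0) → ∀ i, a i ≠ 0)
    (hper : DML.IsPerCurve ℂ (fun y i => y i ^ d + eval y (G i)) C) :
    ∃ x : Fin N → ℂ,
      (C ∩ Set.range fun n : ℕ => (fun y i => y i ^ d + eval y (G i))^[n] x).Infinite := by
  obtain ⟨T, hCT⟩ := hC.closed
  obtain ⟨m, hm, hmC⟩ := hper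
  obtain ⟨B, hB⟩ : ∃ B : ℝ, B = ∑ i, ∑ μ ∈ (G i).support, ‖coeff μ (G i)‖ := ⟨_, rfl⟩
  have hnn : ∀ i, 0 ≤ ∑ μ ∈ (G i).support, ‖coeff μ (G i)‖ := fun i =>
    Finset.sum_nonneg fun _ _ => norm_nonneg _
  obtain ⟨y, hy, hyB⟩ := not_bounded hCT hC.infinite (exists_integrality hL i0) (1 + B)
  obtain ⟨z, hz⟩ : ∃ z : ℕ → Fin N → ℂ,
    z = fun n : ℕ => (fun y i => y i ^ d + eval y (G i))^[n] y := ⟨_, rfl⟩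
  have hzrec : ∀ n, z (n + 1) = fun i => z n i ^ d + eval (z n) (G i) := fun n => by
    rw [hz]; exact Function.iterate_succ_apply' _ _ _
  have hrange : (Set.range z).Infinite := by
    intro hfin
    have := norm_le_of_finite_orbit hd hGlt (fun n i => congrFun (hzrec n) i) hfin (B := B)
      (fun i => by
        rw [hB]
        exact Finset.single_le_sum (f := fun i => ∑ μ ∈ (G i).support, ‖coeff μ (G i)‖)
          (fun i _ => hnn i) (Finset.mem_univ i))
      (by rw [hB]; exact Finset.sum_nonneg fun i _ => hnn i) 0 i0
    have h0 : z 0 = y := by rw [hz]; rfl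
    rw [h0] at this
    exact absurd this (not_le.mpr hyB)
  have hzinj : Function.Injective z :=
    injective_of_infinite_range (f := fun y i => y i ^ d + eval y (G i)) hzrec hrange
  refine ⟨y, ?_⟩
  rw [← hz]
  have hmem : ∀ k, z (m * k) ∈ C := by
    intro k
    induction k with
    | zero => rw [hz]; exact hy
    | succ k ih =>
      rw [← hmC]
      refine ⟨_, ih, ?_⟩
      rw [hz, Nat.mul_succ, Nat.add_comm]
      exact (Function.iterate_add_apply _ _ _ _).symm
  refine (Set.infinite_range_of_injective (f := fun k => z (m * k)) fun k l hkl => ?_).mono ?_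
  · exact Nat.eq_of_mul_eq_mul_left (by omega) (hzinj hkl)
  · rintro _ ⟨k, rfl⟩
    exact ⟨hmem k, _, rfl⟩

end Roth

open DML in
/-- Let `d > 1` and `f(x) = (x_1^d + g_1, …, x_N^d + g_N)` with
`deg g_i ≤ d - 3`.  If `C` is an irreducible closed curve meeting an orbit of `f` in an
infinite set and `C̄ ∩ H_∞ ⊆ {x_1 ⋯ x_N ≠ 0}`, then `C` is an `f`-periodic vertical line.
In particular, every irreducible `f`-periodic curve with `C̄ ∩ H_∞ ⊆ {x_1 ⋯ x_N ≠ 0}` is a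
vertical line. -/
theorem statement2 (N d : ℕ) (hd : 1 < d)
    (G : Fin N → MvPolynomial (Fin N) ℂ)
    (hG : ∀ i, (G i).totalDegree + 3 ≤ d ∨ G i = 0) :
    (∀ C : Set (Fin N → ℂ), IsIrredCurve ℂ C →
      ∀ x : Fin N → ℂ,
        (C ∩ Set.range fun n : ℕ =>
          (fun y i => y i ^ d + MvPolynomial.eval y (G i))^[n] x).Infinite →
        (∀ Q ∈ projClosure ℂ (affToProj ℂ '' C) ∩ Hinf ℂ N,
          ∀ i : Fin N, Q.rep i.succ ≠ 0) →
        IsVertLine ℂ C ∧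
          IsPerCurve ℂ (fun y i => y i ^ d + MvPolynomial.eval y (G i)) C) ∧
    (∀ C : Set (Fin N → ℂ), IsIrredCurve ℂ C →
      IsPerCurve ℂ (fun y i => y i ^ d + MvPolynomial.eval y (G i)) C →
      (∀ Q ∈ projClosure ℂ (affToProj ℂ '' C) ∩ Hinf ℂ N,
        ∀ i : Fin N, Q.rep i.succ ≠ 0) →
      IsVertLine ℂ C) := by
  have hGlt : ∀ i, (G i).totalDegree < d := fun i => by
    rcases hG i with h | h
    · omega
    · rw [h, totalDegree_zero]; omega
  have hN : ∀ C : Set (Fin N → ℂ), IsIrredCurve ℂ C → Nonempty (Fin N) := fun C hC => by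
    by_contra hcon
    rw [not_nonempty_iff] at hcon
    exact hC.infinite (Set.toFinite C)
  refine ⟨fun C hC x hx hT => ?_, fun C hC hper hT => ?_⟩
  · obtain ⟨i0⟩ := hN C hC
    exact Roth.exists_periodic_line hd hG hGlt hC i0 (Roth.coord_ne_zero_of_projClosure hT) hx
  · obtain ⟨i0⟩ := hN C hC
    obtain ⟨x, hx⟩ := Roth.exists_infinite_orbit hd hGlt hC i0
      (Roth.coord_ne_zero_of_projClosure hT) hper
    exact (Roth.exists_periodic_line hd hG hGlt hC i0
      (Roth.coord_ne_zero_of_projClosure hT) hx).1
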